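/- Let G be a nilpotent subgroup of Homeo(T²). Then: (i) if G ⊆ Homeo₀(T²), every element of the derived group G' = [G,G] is irrotational; (ii) if G ⊆ Homeo₊(T²), every element of the second derived group G'' = [G',G'] is irrotational; (iii) in all cases, every element of the third derived group G''' = [G'',G''] is irrotational. -/

import Mathlib

open MeasureTheory Set

noncomputable section

/-- The group of self-homeomorphisms of a topological space. -/
noncomputable instance homeoGroup {X : Type*} [TopologicalSpace X] : Group (X ≃ₜ X) where
  mul f g := g.trans f
  one := Homeomorph.refl X
  inv := Homeomorph.symm
  mul_assoc _ _ _ := Homeomorph.ext fun _ => rfl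
  one_mul _ := Homeomorph.ext fun _ => rfl
  mul_one _ := Homeomorph.ext fun _ => rfl
  inv_mul_cancel f := Homeomorph.ext f.symm_apply_apply

/-- The 2-torus ℝ²/ℤ². -/
abbrev T2 : Type := AddCircle (1 : ℝ) × AddCircle (1 : ℝ)

/-- The universal covering map π : ℝ² → T². -/
def torusProj (p : ℝ × ℝ) : T2 := (↑p.1, ↑p.2)

/-- `F : ℝ² → ℝ²` is a (continuous) lift of `f : T² → T²` to the universal covering. -/
def IsLift (f : T2 → T2) (F : ℝ × ℝ → ℝ × ℝ) : Prop :=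
  Continuous F ∧ ∀ p, torusProj (F p) = f (torusProj p)

/-- `f` is isotopic to the identity relative to the set `K`:
there is a continuous family of homeomorphisms from the identity to `f`,
each fixing `K` pointwise. -/
def IsotopicToIdRel {X : Type*} [TopologicalSpace X] (f : X → X) (K : Set X) : Prop :=
  ∃ F : ℝ → X → X, Continuous (fun q : ℝ × X => F q.1 q.2) ∧
    (∀ t, IsHomeomorph (F t)) ∧ F 0 = id ∧ F 1 = f ∧
    ∀ t, ∀ x ∈ K, F t x = x

/-- `f` is (C⁰-)isotopic to the identity. -/
def IsotopicToId {X : Type*} [TopologicalSpace X] (f : X → X) : Prop :=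
  IsotopicToIdRel f (∅ : Set X)

/-- A homeomorphism of the torus is a C¹ diffeomorphism if it and its inverse
admit C¹ lifts to the universal covering. -/
def IsDiff1 (f : T2 ≃ₜ T2) : Prop :=
  (∃ F, IsLift (⇑f) F ∧ ContDiff ℝ 1 F) ∧ (∃ F, IsLift (⇑f.symm) F ∧ ContDiff ℝ 1 F)

/-- Membership in Diff¹₀(T²): a C¹ diffeomorphism isotopic to the identity. -/
def InDiff10 (f : T2 ≃ₜ T2) : Prop := IsDiff1 f ∧ IsotopicToId (⇑f)

/-- The support of a measure: points all whose neighbourhoods have positive measure. -/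
def measSupport {X : Type*} [TopologicalSpace X] [MeasurableSpace X] (μ : Measure X) :
    Set X := {x | ∀ U ∈ nhds x, μ U ≠ 0}

/-- The rotation vector of the lift `F` with respect to the measure `μ` is `v`:
the displacement `F - Id` descends to a continuous map `g` on the torus and
`∫ g dμ = v`. -/
def HasRotVec (F : ℝ × ℝ → ℝ × ℝ) (μ : Measure T2) (v : ℝ × ℝ) : Prop :=
  ∃ g : C(T2, ℝ × ℝ), (∀ p : ℝ × ℝ, g (torusProj p) = F p - p) ∧ (∫ x, g x ∂μ) = v

/-- `φ` is irrotational: it is isotopic to the identity and has a lift whose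
rotation vector vanishes for every `φ`-invariant Borel probability measure. -/
def IsIrrotational (φ : T2 ≃ₜ T2) : Prop :=
  IsotopicToId (⇑φ) ∧ ∃ F, IsLift (⇑φ) F ∧
    ∀ μ : Measure T2, IsProbabilityMeasure μ → MeasurePreserving (⇑φ) μ μ →
      HasRotVec F μ (0, 0)

/-- `φ` is irrotational with respect to all measures invariant by every element of `S`. -/
def IsIrrotationalFor (φ : T2 ≃ₜ T2) (S : Set (T2 ≃ₜ T2)) : Prop :=
  IsotopicToId (⇑φ) ∧ ∃ F, IsLift (⇑φ) F ∧
    ∀ μ : Measure T2, IsProbabilityMeasure μ → (∀ ψ ∈ S, MeasurePreserving (⇑ψ) μ μ) →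
      HasRotVec F μ (0, 0)

/-- `A ∈ GL(2,ℤ)` is the mapping class of `f`: some lift `F` of `f` satisfies
`F(p + v) = F(p) + Av` for every `v ∈ ℤ²`. -/
def HasMCG (f : T2 → T2) (A : GL (Fin 2) ℤ) : Prop :=
  ∃ F, IsLift f F ∧ ∀ (p : ℝ × ℝ) (m n : ℤ),
    F (p.1 + (m : ℝ), p.2 + (n : ℝ)) =
      ((F p).1 + ((((A : Matrix (Fin 2) (Fin 2) ℤ) 0 0) * m
        + ((A : Matrix (Fin 2) (Fin 2) ℤ) 0 1) * n : ℤ) : ℝ),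
       (F p).2 + ((((A : Matrix (Fin 2) (Fin 2) ℤ) 1 0) * m
        + ((A : Matrix (Fin 2) (Fin 2) ℤ) 1 1) * n : ℤ) : ℝ))

/-- `f` is orientation preserving iff its mapping class has determinant 1. -/
def OrientationPreserving (f : T2 → T2) : Prop :=
  ∃ A : GL (Fin 2) ℤ, HasMCG f A ∧ (A : Matrix (Fin 2) (Fin 2) ℤ).det = 1

end

section

open Set Filter Topology Metric Complex

namespace RMT

lemma one_sub_conj_mul_ne {a z : ℂ} (ha : ‖a‖ < 1) (hz : ‖z‖ < 1) :
    1 - (starRingEnd ℂ) a * z ≠ 0 := by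
  intro h
  have h1 : (starRingEnd ℂ) a * z = 1 := by linear_combination -h
  have h2 : ‖a‖ * ‖z‖ = 1 := by
    have := congrArg norm h1
    simpa using this
  nlinarith [norm_nonneg a, norm_nonneg z]

/-- The Moebius map of the disc sending `a` to `0`. -/
noncomputable def mob (a z : ℂ) : ℂ := (z - a) / (1 - (starRingEnd ℂ) a * z)

lemma mob_norm {a z : ℂ} (ha : ‖a‖ < 1) (hz : ‖z‖ < 1) : ‖mob a z‖ < 1 := by
  have hne := one_sub_conj_mul_ne ha hz
  rw [mob, norm_div, div_lt_one (norm_pos_iff.mpr hne)]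
  apply lt_of_pow_lt_pow_left₀ 2 (norm_nonneg _)
  have h1 : ‖z - a‖ ^ 2 = ‖z‖ ^ 2 + ‖a‖ ^ 2 - 2 * (z.re * a.re + z.im * a.im) := by
    rw [← Complex.normSq_eq_norm_sq, ← Complex.normSq_eq_norm_sq, ← Complex.normSq_eq_norm_sq]
    simp [Complex.normSq_apply]; ring
  have h2 : ‖1 - (starRingEnd ℂ) a * z‖ ^ 2 =
      1 + ‖z‖ ^ 2 * ‖a‖ ^ 2 - 2 * (z.re * a.re + z.im * a.im) := by
    rw [← Complex.normSq_eq_norm_sq, ← Complex.normSq_eq_norm_sq, ← Complex.normSq_eq_norm_sq]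
    simp [Complex.normSq_apply]; ring
  have h3 : ‖a‖ ^ 2 < 1 := by nlinarith [norm_nonneg a]
  have h4 : ‖z‖ ^ 2 < 1 := by nlinarith [norm_nonneg z]
  nlinarith

lemma mob_hasDerivAt {a z : ℂ} (ha : ‖a‖ < 1) (hz : ‖z‖ < 1) :
    HasDerivAt (mob a) ((1 - ‖a‖ ^ 2) / (1 - (starRingEnd ℂ) a * z) ^ 2) z := by
  have hne := one_sub_conj_mul_ne ha hz
  have h1 : HasDerivAt (fun z : ℂ => z - a) 1 z := (hasDerivAt_id z).sub_const a
  have h2 : HasDerivAt (fun z : ℂ => 1 - (starRingEnd ℂ) a * z) (-((starRingEnd ℂ) a)) z := by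
    simpa using ((hasDerivAt_id z).const_mul ((starRingEnd ℂ) a)).const_sub 1
  have := h1.fun_div h2 hne
  refine this.congr_deriv ?_
  have h3 : (starRingEnd ℂ) a * a = (‖a‖ : ℂ) ^ 2 := Complex.conj_mul' a
  rw [← h3]
  congr 1
  ring

lemma mob_inj {a z w : ℂ} (ha : ‖a‖ < 1) (hz : ‖z‖ < 1) (hw : ‖w‖ < 1)
    (h : mob a z = mob a w) : z = w := by
  have hnz := one_sub_conj_mul_ne ha hz
  have hnw := one_sub_conj_mul_ne ha hw
  unfold mob at h
  rw [div_eq_div_iff hnz hnw] at h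
  have h3 : (starRingEnd ℂ) a * a = (‖a‖ : ℂ) ^ 2 := Complex.conj_mul' a
  have h4 : (1 - (‖a‖ : ℂ) ^ 2) * (z - w) = 0 := by
    rw [← h3]; linear_combination h
  have h5 : (1 - (‖a‖ : ℂ) ^ 2) ≠ 0 := by
    have : (1 - ‖a‖ ^ 2 : ℝ) ≠ 0 := by nlinarith [norm_nonneg a]
    exact_mod_cast this
  rcases mul_eq_zero.mp h4 with h | h
  · exact absurd h h5
  · linear_combination h

/-- Local Hurwitz theorem. -/
lemma hurwitz {ι : Type*} {p : Filter ι} [p.NeBot] {U : Set ℂ} (hU : IsOpen U)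
    {f : ι → ℂ → ℂ} {g : ℂ → ℂ}
    (hf : ∀ n, DifferentiableOn ℂ (f n) U) (hlim : TendstoLocallyUniformlyOn f g p U)
    {z₀ : ℂ} (hz₀ : z₀ ∈ U) (hg0 : g z₀ = 0) (hnc : ¬ ∀ᶠ z in 𝓝 z₀, g z = 0)
    {V : Set ℂ} (hV : V ∈ 𝓝 z₀) :
    ∀ᶠ n in p, ∃ z ∈ V, f n z = 0 := by
  have hgd : DifferentiableOn ℂ g U := hlim.differentiableOn (Eventually.of_forall hf) hU
  have hga : AnalyticAt ℂ g z₀ := hgd.analyticAt (hU.mem_nhds hz₀)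
  have hne := hga.eventually_eq_zero_or_eventually_ne_zero.resolve_left hnc
  rw [eventually_nhdsWithin_iff] at hne
  obtain ⟨r, hr, hball⟩ := Metric.nhds_basis_closedBall.mem_iff.mp
    (inter_mem (inter_mem hne (hU.mem_nhds hz₀)) hV)
  have hUr : closedBall z₀ r ⊆ U := fun z hz => (hball hz).1.2
  have hK : IsCompact (closedBall z₀ r) := isCompact_closedBall _ _
  have hS : IsCompact (sphere z₀ r) := isCompact_sphere _ _
  have hSU : sphere z₀ r ⊆ U := sphere_subset_closedBall.trans hUr
  obtain ⟨m, hm, hmin⟩ : ∃ m : ℝ, 0 < m ∧ ∀ z ∈ sphere z₀ r, m ≤ ‖g z‖ := by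
    have hSne : (sphere z₀ r).Nonempty := NormedSpace.sphere_nonempty.mpr hr.le
    obtain ⟨x, hx, hxm⟩ := hS.exists_isMinOn hSne ((hgd.continuousOn.mono hSU).norm)
    refine ⟨‖g x‖, norm_pos_iff.mpr ?_, fun z hz => hxm hz⟩
    refine (hball (sphere_subset_closedBall hx)).1.1 ?_
    intro h
    simp only [mem_singleton_iff] at h
    rw [h, mem_sphere, dist_self] at hx
    exact hr.ne hx
  have hunif : TendstoUniformlyOn f g p (closedBall z₀ r) :=
    (tendstoLocallyUniformlyOn_iff_forall_isCompact hU).mp hlim _ hUr hK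
  have hev := (Metric.tendstoUniformlyOn_iff.mp hunif) (m / 8) (by positivity)
  filter_upwards [hev] with n hn
  have hfc : DiffContOnCl ℂ (f n) (ball z₀ r) := by
    apply DifferentiableOn.diffContOnCl
    rw [closure_ball _ hr.ne']
    exact (hf n).mono hUr
  have hz0n : ‖f n z₀‖ < m / 8 := by
    have := hn z₀ (mem_closedBall_self hr.le)
    rwa [hg0, dist_zero_left] at this
  have hsph : ∀ z ∈ sphere z₀ r, m / 2 ≤ ‖f n z - f n z₀‖ := by
    intro z hz
    have h1 := hn z (sphere_subset_closedBall hz)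
    rw [dist_eq_norm] at h1
    have h2 := hmin z hz
    have h3 : ‖g z‖ ≤ ‖g z - f n z‖ + ‖f n z - f n z₀‖ + ‖f n z₀‖ := by
      calc ‖g z‖ = ‖(g z - f n z) + (f n z - f n z₀) + f n z₀‖ := by congr 1; ring
        _ ≤ _ := norm_add₃_le
    linarith
  have hfreq : ∃ᶠ z in 𝓝 z₀, f n z ≠ f n z₀ := by
    intro hcon
    simp only [not_not] at hcon
    have han : AnalyticOnNhd ℂ (f n) (closedBall z₀ r) := fun z hz =>
      (hf n).analyticAt (hU.mem_nhds (hUr hz))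
    have heq := han.eqOn_of_preconnected_of_eventuallyEq (analyticOnNhd_const (v := f n z₀))
      (convex_closedBall z₀ r).isPreconnected (mem_closedBall_self hr.le) hcon
    obtain ⟨x, hx⟩ : (sphere z₀ r).Nonempty := NormedSpace.sphere_nonempty.mpr hr.le
    have := hsph x hx
    rw [heq (sphere_subset_closedBall hx)] at this
    simp at this
    linarith
  have h0 : (0 : ℂ) ∈ ball (f n z₀) (m / 2 / 2) := by
    rw [mem_ball, dist_zero_left]; linarith
  obtain ⟨z, hz, hz'⟩ := hfc.ball_subset_image_closedBall hr hsph hfreq h0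
  exact ⟨z, (hball hz).2, hz'⟩

/-- Montel-type statement along an ultrafilter. -/
lemma montel {ι : Type*} (p : Ultrafilter ι) {U : Set ℂ} (hU : IsOpen U)
    {f : ι → ℂ → ℂ} (hf : ∀ n, DifferentiableOn ℂ (f n) U)
    (hb : ∀ n, ∀ z ∈ U, ‖f n z‖ ≤ 1) :
    ∃ g : ℂ → ℂ, TendstoLocallyUniformlyOn f g p U := by
  have hex : ∀ z : ℂ, ∃ w : ℂ, z ∈ U → Tendsto (fun n => f n z) p (𝓝 w) := by
    intro z
    by_cases hz : z ∈ U
    · have hc : IsCompact (closedBall (0 : ℂ) 1) := isCompact_closedBall _ _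
      have := hc.ultrafilter_le_nhds (p.map (fun n => f n z)) (by
        rw [le_principal_iff]
        have hh : ∀ᶠ n in (p : Filter ι), f n z ∈ closedBall (0 : ℂ) 1 :=
          Eventually.of_forall fun n => by simpa using hb n z hz
        exact hh)
      obtain ⟨w, -, hw⟩ := this
      exact ⟨w, fun _ => hw⟩
    · exact ⟨0, fun h => absurd h hz⟩
  choose g hg using hex
  refine ⟨g, ?_⟩
  rw [Metric.tendstoLocallyUniformlyOn_iff]
  intro ε hε z hz
  obtain ⟨r, hr, hrU⟩ := Metric.isOpen_iff.mp hU z hz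
  have hlip : ∀ n, ∀ w ∈ ball z r, dist (f n w) (f n z) ≤ 2 / r * dist w z := by
    intro n w hw
    refine Complex.dist_le_div_mul_dist_of_mapsTo_ball ((hf n).mono hrU) ?_ hw
    intro y hy
    rw [mem_closedBall, dist_eq_norm]
    have h1 := hb n y (hrU hy)
    have h2 := hb n z hz
    calc ‖f n y - f n z‖ ≤ ‖f n y‖ + ‖f n z‖ := norm_sub_le _ _
      _ ≤ 2 := by linarith
  set δ : ℝ := min r (ε * r / 8) with hδ
  have hδ0 : 0 < δ := lt_min hr (by positivity)
  refine ⟨ball z δ, mem_nhdsWithin_of_mem_nhds (ball_mem_nhds _ hδ0), ?_⟩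
  have hfar : ∀ n, ∀ w ∈ ball z δ, dist (f n w) (f n z) ≤ ε / 4 := by
    intro n w hw
    have h1 := hlip n w (ball_subset_ball (min_le_left _ _) hw)
    have h2 : dist w z ≤ ε * r / 8 := (mem_ball.mp hw).le.trans (min_le_right _ _)
    calc _ ≤ 2 / r * dist w z := h1
      _ ≤ 2 / r * (ε * r / 8) := by gcongr
      _ = ε / 4 := by field_simp; ring
  have hgfar : ∀ w ∈ ball z δ, dist (g w) (g z) ≤ ε / 4 := by
    intro w hw
    have hwU : w ∈ U := hrU (ball_subset_ball (min_le_left _ _) hw)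
    exact le_of_tendsto ((hg w hwU).dist (hg z hz)) (Eventually.of_forall fun n => hfar n w hw)
  have hz' := (Metric.tendsto_nhds.mp (hg z hz)) (ε / 4) (by positivity)
  filter_upwards [hz'] with n hn w hw
  have h1 := hfar n w hw
  have h2 := hgfar w hw
  calc dist (g w) (f n w) ≤ dist (g w) (g z) + dist (g z) (f n z) + dist (f n z) (f n w) :=
        dist_triangle4 _ _ _ _
    _ < ε := by rw [dist_comm (f n z) (f n w), dist_comm (g z) (f n z)]; linarith

/-- The competing family in the Riemann mapping theorem. -/
def Fam (U : Set ℂ) (f : ℂ → ℂ) : Prop :=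
  DifferentiableOn ℂ f U ∧ (∀ z ∈ U, ‖f z‖ < 1) ∧ InjOn f U ∧ f 0 = 0 ∧ ∀ z ∈ U, deriv f z ≠ 0

lemma exists_extremal {U : Set ℂ} (hU : IsOpen U) (hUc : IsPreconnected U) (h0 : (0 : ℂ) ∈ U)
    (hne : ∃ f, Fam U f) : ∃ f, Fam U f ∧ ∀ h, Fam U h → ‖deriv h 0‖ ≤ ‖deriv f 0‖ := by
  obtain ⟨r, hr, hrU⟩ := Metric.isOpen_iff.mp hU 0 h0
  set S : Set ℝ := {x | ∃ f, Fam U f ∧ x = ‖deriv f 0‖} with hS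
  have hSne : S.Nonempty := by
    obtain ⟨f, hf⟩ := hne
    exact ⟨_, f, hf, rfl⟩
  have hbdd : BddAbove S := by
    refine ⟨1 / r, ?_⟩
    rintro x ⟨f, hf, rfl⟩
    refine Complex.norm_deriv_le_div_of_mapsTo_ball (hf.1.mono hrU) ?_ hr
    intro y hy
    rw [hf.2.2.2.1]
    simpa using (hf.2.1 y (hrU hy)).le
  obtain ⟨u, -, hut, huS⟩ := exists_seq_tendsto_sSup hSne hbdd
  choose f hfF hfu using huS
  set p : Ultrafilter ℕ := hyperfilter ℕ
  have hp : (p : Filter ℕ) ≤ atTop := by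
    rw [← Nat.cofinite_eq_atTop]; exact hyperfilter_le_cofinite
  obtain ⟨g, hg⟩ := montel p hU (fun n => (hfF n).1) (fun n z hz => ((hfF n).2.1 z hz).le)
  have hgd : DifferentiableOn ℂ g U :=
    hg.differentiableOn (Eventually.of_forall fun n => (hfF n).1) hU
  have hder : TendstoLocallyUniformlyOn (deriv ∘ f) (deriv g) p U :=
    hg.deriv (Eventually.of_forall fun n => (hfF n).1) hU
  have hd0 : Tendsto (fun n => deriv (f n) 0) p (𝓝 (deriv g 0)) := hder.tendsto_at h0
  have hd0' : ‖deriv g 0‖ = sSup S := by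
    have h1 : Tendsto (fun n => ‖deriv (f n) 0‖) p (𝓝 (sSup S)) := by
      have : (fun n => ‖deriv (f n) 0‖) = u := by
        funext n; exact (hfu n).symm
      rw [this]; exact hut.mono_left hp
    exact tendsto_nhds_unique hd0.norm h1
  have hpos : 0 < ‖deriv g 0‖ := by
    obtain ⟨k, hk⟩ := hne
    rw [hd0']
    exact lt_of_lt_of_le (norm_pos_iff.mpr (hk.2.2.2.2 0 h0)) (le_csSup hbdd ⟨k, hk, rfl⟩)
  have hgan : AnalyticOnNhd ℂ g U := fun z hz => hgd.analyticAt (hU.mem_nhds hz)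
  have hnc : ∀ z ∈ U, ∀ c, ¬ ∀ᶠ w in 𝓝 z, g w = c := by
    intro z hz c hcon
    have heq := hgan.eqOn_of_preconnected_of_eventuallyEq (analyticOnNhd_const (v := c)) hUc hz hcon
    have : deriv g 0 = 0 := by
      have h1 : g =ᶠ[𝓝 0] fun _ => c := by
        filter_upwards [hU.mem_nhds h0] with w hw using heq hw
      rw [h1.deriv_eq]; simp
    rw [this] at hpos; simp at hpos
  have hle : ∀ z ∈ U, ‖g z‖ ≤ 1 := fun z hz =>
    le_of_tendsto (hg.tendsto_at hz).norm (Eventually.of_forall fun n => ((hfF n).2.1 z hz).le)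
  refine ⟨g, ⟨hgd, ?_, ?_, ?_, ?_⟩, fun h hh => ?_⟩
  · intro z hz
    by_contra hcon
    have h1 : ‖g z‖ = 1 := le_antisymm (hle z hz) (not_lt.mp hcon)
    have hmax : IsMaxOn (norm ∘ g) U z := fun w hw => by
      simp only [mem_ofPred_eq, Function.comp_apply, h1]; exact hle w hw
    have := Complex.eqOn_of_isPreconnected_of_isMaxOn_norm hUc hU hgd hz hmax
    apply hnc z hz (g z)
    filter_upwards [hU.mem_nhds hz] with w hw using this hw
  · intro a ha b hb hab
    by_contra hne'
    obtain ⟨V, W, hV, hW, haV, hbW, hVW⟩ := t2_separation hne'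
    have hF : TendstoLocallyUniformlyOn (fun n z => f n z - f n a) (fun z => g z - g a) p U := by
      have hc : TendstoLocallyUniformlyOn (fun n (_ : ℂ) => f n a) (fun _ => g a) p U := by
        rw [Metric.tendstoLocallyUniformlyOn_iff]
        intro ε hε z hz
        refine ⟨U, self_mem_nhdsWithin, ?_⟩
        have := (Metric.tendsto_nhds.mp (hg.tendsto_at ha)) ε hε
        filter_upwards [this] with n hn y _
        rw [dist_comm]; exact hn
      exact hg.sub hc
    have := hurwitz hU (fun n => ((hfF n).1.sub_const (f n a))) hF hb (by simp [hab]) (by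
      intro hcon
      apply hnc b hb (g a)
      filter_upwards [hcon] with w hw
      exact sub_eq_zero.mp hw) (inter_mem (hW.mem_nhds hbW) (hU.mem_nhds hb))
    obtain ⟨n, z, hz, hz'⟩ := this.exists
    have hza : z = a := (hfF n).2.2.1 hz.2 ha (sub_eq_zero.mp hz')
    exact (Set.disjoint_left.mp hVW (hza ▸ haV)) hz.1
  · have h1 := hg.tendsto_at h0
    have h2 : (fun n => f n 0) = fun _ => 0 := by funext n; exact (hfF n).2.2.2.1
    rw [h2] at h1
    exact tendsto_nhds_unique h1 tendsto_const_nhds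
  · intro z hz hz0
    have hdan : AnalyticOnNhd ℂ (deriv g) U := hgan.deriv
    have := hurwitz hU (fun n => (hfF n).1.deriv hU) hder hz hz0 (by
      intro hcon
      have heq := hdan.eqOn_of_preconnected_of_eventuallyEq (analyticOnNhd_const (v := 0)) hUc hz hcon
      rw [heq h0] at hpos
      simp at hpos) (hU.mem_nhds hz)
    obtain ⟨n, w, hw, hw'⟩ := this.exists
    exact (hfF n).2.2.2.2 w hw hw'
  · rw [hd0']
    exact le_csSup hbdd ⟨h, hh, rfl⟩

lemma extremal_surj {U : Set ℂ} (hU : IsOpen U) (hUc : IsSimplyConnected U) (h0 : (0 : ℂ) ∈ U)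
    {f : ℂ → ℂ} (hf : Fam U f) (hmax : ∀ h, Fam U h → ‖deriv h 0‖ ≤ ‖deriv f 0‖)
    {w : ℂ} (hw : ‖w‖ < 1) : ∃ z ∈ U, f z = w := by
  by_contra hcon
  push Not at hcon
  obtain ⟨hfd, hfb, hfi, hf0, hfn⟩ := hf
  have hw0 : w ≠ 0 := fun h => hcon 0 h0 (by rw [hf0, h])
  have hk : ∀ z ∈ U, HasDerivAt (fun z => mob w (f z))
      ((1 - ‖w‖ ^ 2) / (1 - (starRingEnd ℂ) w * f z) ^ 2 * deriv f z) z := fun z hz =>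
    (mob_hasDerivAt hw (hfb z hz)).comp z ((hfd.differentiableAt (hU.mem_nhds hz)).hasDerivAt)
  have hk0 : (0 : ℂ) ∉ (fun z => mob w (f z)) '' U := by
    rintro ⟨z, hz, hz'⟩
    have := div_eq_zero_iff.mp hz'
    rcases this with h | h
    · exact hcon z hz (sub_eq_zero.mp h)
    · exact one_sub_conj_mul_ne hw (hfb z hz) h
  obtain ⟨g, hgc, hg⟩ := exists_continuousOn_pow_eq hUc hU
    (fun z hz => (hk z hz).continuousAt.continuousWithinAt) hk0 two_ne_zero
  have hg0 : ∀ z ∈ U, g z ≠ 0 := by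
    intro z hz h
    apply hk0
    refine ⟨z, hz, ?_⟩
    have := hg z
    rw [h] at this
    simpa using this.symm
  have hgn : ∀ z ∈ U, ‖g z‖ < 1 := by
    intro z hz
    have h1 := mob_norm hw (hfb z hz)
    rw [← hg z, norm_pow] at h1
    nlinarith [norm_nonneg (g z)]
  have hgd : ∀ z ∈ U, HasDerivAt g ((2 * g z)⁻¹ *
      ((1 - ‖w‖ ^ 2) / (1 - (starRingEnd ℂ) w * f z) ^ 2 * deriv f z)) z := by
    intro z hz
    have hcz : ContinuousAt g z := hgc.continuousAt (hU.mem_nhds hz)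
    have h2 : HasDerivAt (fun y : ℂ => y ^ 2) (2 * g z) (g z) := by
      simpa using hasDerivAt_pow 2 (g z)
    have hne : (2 * g z) ≠ 0 := mul_ne_zero two_ne_zero (hg0 z hz)
    have hstrict : HasStrictDerivAt (fun y : ℂ => y ^ 2) (2 * g z) (g z) := by
      simpa using hasStrictDerivAt_pow 2 (g z)
    -- local inverse of the square
    have hloc := hstrict.to_localInverse hne
    have heq : ∀ᶠ y in 𝓝 z, hstrict.localInverse _ _ _ hne (mob w (f y)) = g y := by
      have := hstrict.eventually_left_inverse hne
      filter_upwards [hcz.eventually this] with y hy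
      rw [← hg y]; exact hy
    have hcomp := hloc.hasDerivAt.comp_of_eq z (hk z hz) (by simpa using (hg z))
    exact hcomp.congr_of_eventuallyEq (heq.mono fun y hy => hy.symm)
  have hgi : InjOn g U := by
    intro a ha b hb hab
    apply hfi ha hb
    apply mob_inj hw (hfb a ha) (hfb b hb)
    rw [← hg a, ← hg b, hab]
  set c := g 0 with hc
  have hcn : ‖c‖ < 1 := hgn 0 h0
  have hhd : ∀ z ∈ U, HasDerivAt (fun z => mob c (g z))
      ((1 - ‖c‖ ^ 2) / (1 - (starRingEnd ℂ) c * g z) ^ 2 * ((2 * g z)⁻¹ *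
      ((1 - ‖w‖ ^ 2) / (1 - (starRingEnd ℂ) w * f z) ^ 2 * deriv f z))) z := fun z hz =>
    (mob_hasDerivAt hcn (hgn z hz)).comp z (hgd z hz)
  have hne1 : ∀ a : ℂ, ‖a‖ < 1 → (1 - (‖a‖ : ℂ) ^ 2) ≠ 0 := by
    intro a ha
    have : (1 - ‖a‖ ^ 2 : ℝ) ≠ 0 := by nlinarith [norm_nonneg a]
    exact_mod_cast this
  have hF : Fam U (fun z => mob c (g z)) := by
    refine ⟨fun z hz => (hhd z hz).differentiableAt.differentiableWithinAt,
      fun z hz => mob_norm hcn (hgn z hz), ?_, by simp [mob, hc], ?_⟩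
    · intro a ha b hb hab
      exact hgi ha hb (mob_inj hcn (hgn a ha) (hgn b hb) hab)
    · intro z hz
      rw [(hhd z hz).deriv]
      have e1 := one_sub_conj_mul_ne hcn (hgn z hz)
      have e2 := one_sub_conj_mul_ne hw (hfb z hz)
      have e3 := hg0 z hz
      have e4 := hfn z hz
      have e5 := hne1 c hcn
      have e6 := hne1 w hw
      exact mul_ne_zero (div_ne_zero e5 (pow_ne_zero _ e1)) (mul_ne_zero
        (inv_ne_zero (mul_ne_zero two_ne_zero e3)) (mul_ne_zero (div_ne_zero e6 (pow_ne_zero _ e2)) e4))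
  have hle := hmax _ hF
  rw [(hhd 0 h0).deriv] at hle
  have hcw : ‖c‖ ^ 2 = ‖w‖ := by
    rw [← norm_pow, hc, hg 0, hf0]; simp [mob]
  have hcpos : 0 < ‖c‖ := norm_pos_iff.mpr (hg0 0 h0)
  have hdpos : 0 < ‖deriv f 0‖ := norm_pos_iff.mpr (hfn 0 h0)
  rw [← hc, hf0] at hle
  have e7 : ‖(1 - (‖c‖ : ℂ) ^ 2)‖ = 1 - ‖c‖ ^ 2 := by
    have : (1 - (‖c‖ : ℂ) ^ 2) = ((1 - ‖c‖ ^ 2 : ℝ) : ℂ) := by push_cast; ring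
    rw [this, Complex.norm_real, Real.norm_of_nonneg]; nlinarith
  have e8 : ‖(1 - (‖w‖ : ℂ) ^ 2)‖ = 1 - ‖w‖ ^ 2 := by
    have : (1 - (‖w‖ : ℂ) ^ 2) = ((1 - ‖w‖ ^ 2 : ℝ) : ℂ) := by push_cast; ring
    rw [this, Complex.norm_real, Real.norm_of_nonneg]; nlinarith [norm_nonneg w]
  have e9 : (1 - (starRingEnd ℂ) c * c) = 1 - (‖c‖ : ℂ) ^ 2 := by rw [Complex.conj_mul']
  rw [e9] at hle
  simp only [mul_zero, sub_zero, one_pow, div_one, norm_mul, norm_div, norm_pow, norm_inv, e7, e8,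
    Complex.norm_ofNat] at hle
  set t := ‖c‖ with ht
  have ht2 : 0 < 1 - t ^ 2 := by nlinarith
  rw [← hcw] at hle
  have : (1 - t ^ 2) / (1 - t ^ 2) ^ 2 * ((2 * t)⁻¹ * ((1 - (t ^ 2) ^ 2) * ‖deriv f 0‖))
      = (1 + t ^ 2) / (2 * t) * ‖deriv f 0‖ := by
    field_simp; ring
  rw [this] at hle
  have h10 : 1 < (1 + t ^ 2) / (2 * t) := by
    rw [lt_div_iff₀ (by positivity)]
    nlinarith [sq_pos_of_pos (show (0:ℝ) < 1 - t by linarith)]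
  nlinarith

/-- The Riemann mapping theorem for bounded domains containing `0`. -/
theorem riemann_mapping {U : Set ℂ} (hU : IsOpen U) (hUc : IsSimplyConnected U)
    (h0 : (0 : ℂ) ∈ U) (hb : Bornology.IsBounded U) :
    ∃ f g : ℂ → ℂ, DifferentiableOn ℂ f U ∧ MapsTo f U (ball 0 1) ∧ f 0 = 0 ∧ g 0 = 0 ∧
      DifferentiableOn ℂ g (ball 0 1) ∧ MapsTo g (ball 0 1) U ∧
      (∀ z ∈ U, g (f z) = z) ∧ (∀ w ∈ ball (0 : ℂ) 1, f (g w) = w) ∧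
      deriv g 0 ≠ 0 := by
  have hpc : IsPreconnected U := hUc.isPathConnected.isConnected.isPreconnected
  obtain ⟨M, hM⟩ := hb.subset_ball_lt 0 (0 : ℂ)
  obtain ⟨hM0, hM⟩ := hM
  have hfam : Fam U (fun z => z / M) := by
    have hMc : (M : ℂ) ≠ 0 := by exact_mod_cast hM0.ne'
    have hd : ∀ z, HasDerivAt (fun z : ℂ => z / M) (1 / M) z := fun z => (hasDerivAt_id z).div_const _
    refine ⟨fun z _ => (hd z).differentiableAt.differentiableWithinAt, ?_, ?_, by simp, ?_⟩
    · intro z hz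
      have := hM hz
      rw [mem_ball_zero_iff] at this
      rw [norm_div, Complex.norm_real, Real.norm_of_nonneg hM0.le, div_lt_one hM0]
      exact this
    · intro a _ b _ hab
      simpa [hMc] using hab
    · intro z _
      rw [(hd z).deriv]; exact one_div_ne_zero hMc
  obtain ⟨f, hf, hmax⟩ := exists_extremal hU hpc h0 ⟨_, hfam⟩
  have hsurj := fun w (hw : ‖w‖ < 1) => extremal_surj hU hUc h0 hf hmax hw
  obtain ⟨hfd, hfb, hfi, hf0, hfn⟩ := hf
  have hex : ∀ w : ℂ, ∃ z, ‖w‖ < 1 → z ∈ U ∧ f z = w := by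
    intro w
    by_cases hw : ‖w‖ < 1
    · obtain ⟨z, hz, hz'⟩ := hsurj w hw
      exact ⟨z, fun _ => ⟨hz, hz'⟩⟩
    · exact ⟨0, fun h => absurd h hw⟩
  choose g hg using hex
  have hgf : ∀ z ∈ U, g (f z) = z := fun z hz => hfi (hg _ (hfb z hz)).1 hz (hg _ (hfb z hz)).2
  have hder : ∀ w, ‖w‖ < 1 → HasDerivAt g (deriv f (g w))⁻¹ w := by
    intro w hw
    have hgw := hg w hw
    have hst : HasStrictDerivAt f (deriv f (g w)) (g w) :=
      ((hfd.analyticAt (hU.mem_nhds hgw.1)).hasStrictDerivAt)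
    have hloc := hst.to_localInverse (hfn _ hgw.1)
    have h1 : ∀ᶠ y in 𝓝 (f (g w)), f (hst.localInverse _ _ _ (hfn _ hgw.1) y) = y :=
      hst.eventually_right_inverse (hfn _ hgw.1)
    have h2 : ∀ᶠ y in 𝓝 (f (g w)), hst.localInverse _ _ _ (hfn _ hgw.1) y ∈ U := by
      have hc := hloc.hasDerivAt.continuousAt
      apply hc.eventually
      have h3 : hst.localInverse _ _ _ (hfn _ hgw.1) (f (g w)) = g w :=
        (hst.eventually_left_inverse (hfn _ hgw.1)).self_of_nhds
      rw [h3]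
      exact hU.mem_nhds hgw.1
    have hthis := hloc.hasDerivAt
    generalize hst.localInverse _ _ _ (hfn _ hgw.1) = L at h1 h2 hthis
    rw [hgw.2] at hthis h1 h2
    refine hthis.congr_of_eventuallyEq ?_
    filter_upwards [h1, h2] with y hy1 hy2
    have := hgf _ hy2
    rw [hy1] at this
    exact this
  have hg0 : g 0 = 0 := by
    have := hgf 0 h0
    rwa [hf0] at this
  refine ⟨f, g, hfd, fun z hz => by simpa using hfb z hz, hf0, hg0, ?_, ?_, hgf, ?_, ?_⟩
  · intro w hw
    exact (hder w (by simpa using hw)).differentiableAt.differentiableWithinAt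
  · intro w hw
    exact (hg w (by simpa using hw)).1
  · intro w hw
    exact (hg w (by simpa using hw)).2
  · rw [(hder 0 (by simp)).deriv]
    apply inv_ne_zero
    exact hfn _ (hg 0 (by simp)).1

end RMT

end

section

open Set Filter Topology Metric MeasureTheory

namespace Car

lemma det_mul (c : ℂ) :
    (((ContinuousLinearMap.toSpanSingleton ℂ c).restrictScalars ℝ : ℂ →L[ℝ] ℂ)).det = ‖c‖ ^ 2 := by
  simp [ContinuousLinearMap.det, LinearMap.det_restrictScalars, Algebra.norm_complex_apply,
    Complex.normSq_eq_norm_sq]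

lemma slice_small {F : ℂ → ℂ} {Ω : Set ℂ} (hΩ : IsOpen Ω) (hF : DifferentiableOn ℂ F Ω)
    (hinj : InjOn F Ω) (hA : volume (F '' Ω) ≠ ⊤) {η : ℝ} (hη : 0 < η) (b : ℝ) :
    ∃ u < b, ∫⁻ v : ℝ, Ω.indicator (fun w => ENNReal.ofReal (‖deriv F w‖ ^ 2)) (⟨u, v⟩ : ℂ)
      ≤ ENNReal.ofReal (η ^ 2) := by
  have hmeas : Measurable (Ω.indicator (fun w => ENNReal.ofReal (‖deriv F w‖ ^ 2))) :=
    Measurable.indicator (by have := measurable_deriv F; fun_prop) hΩ.measurableSet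
  set h := Ω.indicator (fun w => ENNReal.ofReal (‖deriv F w‖ ^ 2)) with hh
  have h1 : ∫⁻ w, h w = volume (F '' Ω) := by
    rw [hh, lintegral_indicator hΩ.measurableSet]
    rw [← lintegral_abs_det_fderiv_eq_addHaar_image volume hΩ.measurableSet
      (f' := fun w => (ContinuousLinearMap.toSpanSingleton ℂ (deriv F w)).restrictScalars ℝ) _ hinj]
    · refine lintegral_congr fun w => ?_
      rw [det_mul, abs_of_nonneg (by positivity)]
    · intro w hw
      have := (hF.differentiableAt (hΩ.mem_nhds hw)).hasDerivAt.hasFDerivAt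
      exact (this.restrictScalars ℝ).hasFDerivWithinAt
  have h2 : ∫⁻ w, h w = ∫⁻ u : ℝ, ∫⁻ v : ℝ, h ⟨u, v⟩ := by
    rw [← (Complex.volume_preserving_equiv_real_prod.symm).lintegral_comp hmeas]
    rw [Measure.volume_eq_prod, lintegral_prod]
    · rfl
    · exact (hmeas.comp Complex.measurableEquivRealProd.symm.measurable).aemeasurable
  by_contra! hcon
  set A := volume (F '' Ω) with hAdef
  have h3 : ∀ n : ℝ, 0 < n → ENNReal.ofReal (η ^ 2 * n) ≤ A := by
    intro n hn
    rw [← h1, h2]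
    calc ENNReal.ofReal (η ^ 2 * n) = ∫⁻ u in Ioo (b - n) b, ENNReal.ofReal (η ^ 2) := by
          rw [setLIntegral_const, Real.volume_Ioo, ← ENNReal.ofReal_mul (by positivity)]
          congr 2; ring
      _ ≤ ∫⁻ u in Ioo (b - n) b, ∫⁻ v : ℝ, h ⟨u, v⟩ := by
          refine setLIntegral_mono' measurableSet_Ioo fun u hu => (hcon u hu.2).le
      _ ≤ _ := setLIntegral_le_lintegral _ _
  have h4 := h3 ((A.toReal + 1) / η ^ 2) (by positivity)
  rw [mul_div_cancel₀ _ (by positivity)] at h4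
  rw [ENNReal.ofReal_le_iff_le_toReal hA] at h4
  linarith

lemma slice_bound {F : ℂ → ℂ} {Ω : Set ℂ} (hΩ : IsOpen Ω) (hF : DifferentiableOn ℂ F Ω)
    {η u : ℝ} (hη : 0 < η)
    (hu : ∫⁻ v : ℝ, Ω.indicator (fun w => ENNReal.ofReal (‖deriv F w‖ ^ 2)) (⟨u, v⟩ : ℂ)
      ≤ ENNReal.ofReal (η ^ 2)) {v₁ v₂ : ℝ} (h12 : v₁ ≤ v₂) (hπ : v₂ - v₁ ≤ Real.pi)
    (hv : ∀ v ∈ Icc v₁ v₂, (⟨u, v⟩ : ℂ) ∈ Ω) :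
    ‖F ⟨u, v₂⟩ - F ⟨u, v₁⟩‖ ≤ 3 * η := by
  have hdc : ContinuousOn (deriv F) Ω := (hF.deriv hΩ).continuousOn
  have hline : ∀ v : ℝ, HasDerivAt (fun v : ℝ => (⟨u, v⟩ : ℂ)) Complex.I v := by
    intro v
    have : (fun v : ℝ => (⟨u, v⟩ : ℂ)) = fun v : ℝ => (u : ℂ) + v * Complex.I := by
      funext v; apply Complex.ext <;> simp
    rw [this]
    simpa using ((Complex.ofRealCLM.hasDerivAt (x := v)).mul_const Complex.I).const_add (u : ℂ)
  have hlc : Continuous (fun v : ℝ => (⟨u, v⟩ : ℂ)) :=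
    continuous_iff_continuousAt.mpr fun v => (hline v).continuousAt
  have hder : ∀ v ∈ uIcc v₁ v₂, HasDerivAt (fun v : ℝ => F ⟨u, v⟩) (deriv F ⟨u, v⟩ * Complex.I) v := by
    intro v hv'
    rw [uIcc_of_le h12] at hv'
    have := (hF.differentiableAt (hΩ.mem_nhds (hv v hv'))).hasDerivAt
    exact this.comp (𝕜 := ℝ) v (hline v)
  have hcd : ContinuousOn (fun v : ℝ => deriv F ⟨u, v⟩) (Icc v₁ v₂) :=
    hdc.comp hlc.continuousOn hv
  have hcd' : ContinuousOn (fun v : ℝ => deriv F ⟨u, v⟩ * Complex.I) (uIcc v₁ v₂) := by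
    rw [uIcc_of_le h12]; exact hcd.mul continuousOn_const
  have hintg := intervalIntegral.integral_eq_sub_of_hasDerivAt hder hcd'.intervalIntegrable
  rw [← hintg]
  have hsq : ContinuousOn (fun v : ℝ => ‖deriv F ⟨u, v⟩‖ ^ 2) (uIcc v₁ v₂) := by
    rw [uIcc_of_le h12]; exact hcd.norm.pow 2
  have hI : ∫ v in v₁..v₂, ‖deriv F ⟨u, v⟩‖ ^ 2 ≤ η ^ 2 := by
    rw [intervalIntegral.integral_of_le h12,
      integral_eq_lintegral_of_nonneg_ae (Eventually.of_forall fun _ => by positivity)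
      (hsq.intervalIntegrable.1.aestronglyMeasurable)]
    apply ENNReal.toReal_le_of_le_ofReal (by positivity)
    refine le_trans ?_ hu
    rw [← lintegral_indicator measurableSet_Ioc]
    refine lintegral_mono fun v => ?_
    by_cases h : v ∈ Ioc v₁ v₂
    · rw [indicator_of_mem h, indicator_of_mem (hv v (Ioc_subset_Icc_self h))]
    · rw [indicator_of_notMem h]; exact zero_le
  calc ‖∫ v in v₁..v₂, deriv F ⟨u, v⟩ * Complex.I‖
      ≤ ∫ v in v₁..v₂, (η / 2 + (1 / (2 * η)) * ‖deriv F ⟨u, v⟩‖ ^ 2) := by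
        refine intervalIntegral.norm_integral_le_of_norm_le h12 (Eventually.of_forall fun v _ => ?_)
          ((continuousOn_const.add (continuousOn_const.mul hsq)).intervalIntegrable)
        rw [norm_mul, Complex.norm_I, mul_one]
        set x := ‖deriv F ⟨u, v⟩‖
        have : η / 2 + (1 / (2 * η)) * x ^ 2 - x = (η - x) ^ 2 / (2 * η) := by
          field_simp; ring
        have h2 : 0 ≤ (η - x) ^ 2 / (2 * η) := by positivity
        linarith
    _ = (v₂ - v₁) * (η / 2) + (1 / (2 * η)) * ∫ v in v₁..v₂, ‖deriv F ⟨u, v⟩‖ ^ 2 := by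
        have hi : IntervalIntegrable (fun v : ℝ => 1 / (2 * η) * ‖deriv F ⟨u, v⟩‖ ^ 2) volume v₁ v₂ :=
          (continuousOn_const.mul hsq).intervalIntegrable
        rw [intervalIntegral.integral_add (by simp) hi, intervalIntegral.integral_const,
          intervalIntegral.integral_const_mul, smul_eq_mul]
    _ ≤ Real.pi * (η / 2) + (1 / (2 * η)) * η ^ 2 := by gcongr
    _ ≤ 3 * η := by
        have := Real.pi_lt_four
        have e : (1 / (2 * η)) * η ^ 2 = η / 2 := by field_simp
        rw [e]; nlinarith

/-- Length-area: small crosscuts. -/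
lemma crosscut {R : ℂ → ℂ} (hR : DifferentiableOn ℂ R (ball 0 1)) (hinj : InjOn R (ball 0 1))
    (hb : Bornology.IsBounded (R '' ball 0 1)) {ζ : ℂ} (hζ : ‖ζ‖ = 1) {η r₀ : ℝ} (hη : 0 < η)
    (hr : 0 < r₀) : ∃ ρ, 0 < ρ ∧ ρ < r₀ ∧ ∀ z ∈ ball (0 : ℂ) 1, ∀ z' ∈ ball (0 : ℂ) 1,
      dist z ζ = ρ → dist z' ζ = ρ → dist (R z) (R z') ≤ η := by
  have hζ0 : ζ ≠ 0 := by rintro rfl; simp at hζ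
  set T : ℂ → ℂ := fun w => ζ * (1 - Complex.exp w) with hT
  have hTd : Differentiable ℂ T := by
    rw [hT]; fun_prop
  set Ω : Set ℂ := {w | -(Real.pi / 2) < w.im ∧ w.im < Real.pi / 2 ∧ T w ∈ ball (0 : ℂ) 1} with hΩd
  have hΩ : IsOpen Ω := by
    refine (isOpen_lt continuous_const Complex.continuous_im).inter
      ((isOpen_lt Complex.continuous_im continuous_const).inter
      (isOpen_ball.preimage hTd.continuous))
  have hF : DifferentiableOn ℂ (R ∘ T) Ω :=
    hR.comp hTd.differentiableOn fun w hw => hw.2.2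
  have hFi : InjOn (R ∘ T) Ω := by
    intro a ha b hb hab
    have h1 := hinj ha.2.2 hb.2.2 hab
    have h2 : Complex.exp a = Complex.exp b := by
      simpa [hT, hζ0] using h1
    have := Real.pi_pos
    exact Complex.exp_inj_of_neg_pi_lt_of_le_pi (by linarith [ha.1]) (by linarith [ha.2.1])
      (by linarith [hb.1]) (by linarith [hb.2.1]) h2
  have hA : volume ((R ∘ T) '' Ω) ≠ ⊤ := by
    refine ne_top_of_le_ne_top hb.measure_lt_top.ne (measure_mono ?_)
    rintro _ ⟨w, hw, rfl⟩
    exact ⟨T w, hw.2.2, rfl⟩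
  have hη3 : 0 < η / 3 := by positivity
  obtain ⟨u, hu, hu'⟩ := slice_small hΩ hF hFi hA hη3 (Real.log r₀)
  have hnormT : ∀ v : ℝ, T ⟨u, v⟩ ∈ ball (0 : ℂ) 1 ↔ Real.exp u < 2 * Real.cos v := by
    intro v
    rw [mem_ball_zero_iff, hT]
    simp only [norm_mul, hζ, one_mul]
    have : ‖1 - Complex.exp ⟨u, v⟩‖ ^ 2 = 1 - 2 * Real.exp u * Real.cos v + Real.exp u ^ 2 := by
      rw [← Complex.normSq_eq_norm_sq, Complex.normSq_apply]
      simp only [Complex.sub_re, Complex.one_re, Complex.exp_re, Complex.sub_im, Complex.one_im,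
        Complex.exp_im]
      have := Real.sin_sq_add_cos_sq v
      nlinarith
    have he := Real.exp_pos u
    have hn := norm_nonneg (1 - Complex.exp ⟨u, v⟩)
    constructor
    · intro h
      have : Real.exp u * Real.exp u < Real.exp u * (2 * Real.cos v) := by nlinarith
      exact lt_of_mul_lt_mul_left this he.le
    · intro h
      nlinarith
  have hrep : ∀ z ∈ ball (0 : ℂ) 1, dist z ζ = Real.exp u → ∃ v : ℝ, (⟨u, v⟩ : ℂ) ∈ Ω ∧ T ⟨u, v⟩ = z := by
    intro z hz hd
    have h1 : ‖1 - z / ζ‖ = Real.exp u := by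
      rw [← hd, dist_comm, dist_eq_norm, ← mul_one ‖1 - z / ζ‖, ← hζ, ← norm_mul]
      congr 1; field_simp
    have hne : 1 - z / ζ ≠ 0 := by
      rw [← norm_pos_iff, h1]; exact Real.exp_pos u
    refine ⟨(1 - z / ζ).arg, ?_⟩
    have h2 : Complex.exp ⟨u, (1 - z / ζ).arg⟩ = 1 - z / ζ := by
      rw [← Complex.exp_log hne]
      congr 1
      apply Complex.ext
      · rw [Complex.log_re, Complex.exp_log hne, h1, Real.log_exp]
      · rw [Complex.log_im, Complex.exp_log hne]
    have h3 : T ⟨u, (1 - z / ζ).arg⟩ = z := by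
      simp only [hT, h2]; field_simp; ring
    refine ⟨?_, h3⟩
    have h4 := (hnormT _).mp (h3 ▸ hz)
    have h5 : 0 < Real.cos (1 - z / ζ).arg := by linarith [Real.exp_pos u]
    rw [Complex.cos_arg hne] at h5
    have h6 : 0 < (1 - z / ζ).re := by
      rcases div_pos_iff.mp h5 with h | h
      · exact h.1
      · exact absurd h.2 (not_lt.mpr (norm_nonneg _))
    have h7 := Complex.abs_arg_lt_pi_div_two_iff.mpr (Or.inl h6)
    rw [abs_lt] at h7
    exact ⟨h7.1, h7.2, h3.symm ▸ hz⟩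
  refine ⟨Real.exp u, Real.exp_pos u, by rwa [← Real.lt_log_iff_exp_lt hr], ?_⟩
  have key : ∀ v₁ v₂ : ℝ, v₁ ≤ v₂ → (⟨u, v₁⟩ : ℂ) ∈ Ω → (⟨u, v₂⟩ : ℂ) ∈ Ω →
      dist (R (T ⟨u, v₂⟩)) (R (T ⟨u, v₁⟩)) ≤ η := by
    intro v₁ v₂ h12 h1 h2
    have h1' := h1; have h2' := h2
    obtain ⟨a1, a2, a3⟩ := h1'
    obtain ⟨b1, b2, b3⟩ := h2'
    simp only at a1 a2 b1 b2
    have := slice_bound hΩ hF hη3 hu' h12 (by linarith) (by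
      intro v hv
      refine ⟨by simp only; linarith [hv.1], by simp only; linarith [hv.2], ?_⟩
      rw [hnormT] at a3 b3 ⊢
      rcases le_total 0 v with h | h
      · have : Real.cos v₂ ≤ Real.cos v := Real.cos_le_cos_of_nonneg_of_le_pi h (by linarith [Real.pi_pos]) hv.2
        linarith
      · have : Real.cos v₁ ≤ Real.cos v := by
          rw [← Real.cos_neg v₁, ← Real.cos_neg v]
          exact Real.cos_le_cos_of_nonneg_of_le_pi (by linarith) (by linarith [Real.pi_pos]) (by linarith [hv.1])
        linarith)
    rw [dist_eq_norm]
    simp only [Function.comp] at this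
    linarith
  intro z hz z' hz' hd hd'
  obtain ⟨v₁, h1, rfl⟩ := hrep z hz hd
  obtain ⟨v₂, h2, rfl⟩ := hrep z' hz' hd'
  rcases le_total v₁ v₂ with h | h
  · rw [dist_comm]; exact key _ _ h h1 h2
  · exact key _ _ h h2 h1

end Car

end

section

open Set Filter Topology Metric MeasureTheory

namespace Car

/-- Data: `g` is a self-homeomorphism of the open disc (inverse `k`) such that `Φ ∘ g` is holomorphic. -/
structure Data (Φ : ℂ ≃ₜ ℂ) (g k : ℂ → ℂ) : Prop where
  gm : MapsTo g (ball 0 1) (ball 0 1)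
  km : MapsTo k (ball 0 1) (ball 0 1)
  gc : ContinuousOn g (ball 0 1)
  kc : ContinuousOn k (ball 0 1)
  gk : ∀ z ∈ ball (0 : ℂ) 1, g (k z) = z
  kg : ∀ z ∈ ball (0 : ℂ) 1, k (g z) = z
  g0 : g 0 = 0
  hol : DifferentiableOn ℂ (fun z => Φ (g z)) (ball 0 1)

variable {Φ : ℂ ≃ₜ ℂ} {g k : ℂ → ℂ}

lemma Data.gi (h : Data Φ g k) : InjOn g (ball 0 1) := fun a ha b hb hab => by
  rw [← h.kg a ha, ← h.kg b hb, hab]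

lemma Data.k0 (h : Data Φ g k) : k 0 = 0 := by
  have := h.kg 0 (by simp)
  rwa [h.g0] at this

lemma Data.proper (h : Data Φ g k) {s : ℝ} (hs : s < 1) {ζ : ℂ} (hζ : ‖ζ‖ = 1) :
    ∃ r, 0 < r ∧ ∀ z ∈ ball (0 : ℂ) 1, dist z ζ < r → s < ‖g z‖ := by
  have hK : IsCompact (k '' closedBall 0 s) :=
    (isCompact_closedBall _ _).image_of_continuousOn (h.kc.mono (closedBall_subset_ball hs))
  have hζn : ζ ∈ (k '' closedBall 0 s)ᶜ := by
    rintro ⟨w, hw, rfl⟩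
    have := h.km (closedBall_subset_ball hs hw)
    rw [mem_ball_zero_iff] at this
    linarith
  obtain ⟨r, hr, hr'⟩ := Metric.isOpen_iff.mp hK.isClosed.isOpen_compl ζ hζn
  refine ⟨r, hr, fun z hz hd => ?_⟩
  by_contra! hcon
  apply hr' (mem_ball.mpr hd)
  exact ⟨g z, by simpa using hcon, h.kg z hz⟩

lemma dir_close {w : ℂ} {s : ℝ} (hw : s < ‖w‖) (hw1 : ‖w‖ ≤ 1) (hs : 0 ≤ s) :
    ‖w / ‖w‖ - w‖ ≤ 1 - s := by
  have hp : 0 < ‖w‖ := by linarith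
  have hpc : (‖w‖ : ℂ) ≠ 0 := by exact_mod_cast hp.ne'
  have : w / ‖w‖ - w = (w / ‖w‖) * ((1 - ‖w‖ : ℝ) : ℂ) := by
    push_cast; field_simp
  rw [this, norm_mul, norm_div, Complex.norm_real, Complex.norm_real, norm_norm,
    div_self hp.ne', one_mul, Real.norm_of_nonneg (by linarith)]
  linarith

lemma Data.osc (h : Data Φ g k) {ζ : ℂ} (hζ : ‖ζ‖ = 1) {ε : ℝ} (hε : 0 < ε) (hε1 : ε < 1) :
    ∃ ρ, 0 < ρ ∧ ∀ z ∈ ball (0 : ℂ) 1, ∀ z' ∈ ball (0 : ℂ) 1, dist z ζ < ρ → dist z' ζ < ρ →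
      dist (g z) (g z') ≤ 8 * ε := by
  have hcomp : IsCompact (Φ '' closedBall 0 1) := (isCompact_closedBall _ _).image Φ.continuous
  have huc : UniformContinuousOn Φ.symm (Φ '' closedBall 0 1) :=
    hcomp.uniformContinuousOn_of_continuous Φ.symm.continuous.continuousOn
  rw [Metric.uniformContinuousOn_iff] at huc
  obtain ⟨η, hη, hηε⟩ := huc ε hε
  obtain ⟨r, hr, hrp⟩ := h.proper (s := 1 - ε) (by linarith) hζ
  have hΦgi : InjOn (fun z => Φ (g z)) (ball 0 1) := fun a ha b hb hab =>
    h.gi ha hb (Φ.injective hab)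
  have hbd : Bornology.IsBounded ((fun z => Φ (g z)) '' ball 0 1) := by
    refine hcomp.isBounded.subset ?_
    rintro _ ⟨z, hz, rfl⟩
    exact ⟨g z, ball_subset_closedBall (h.gm hz), rfl⟩
  obtain ⟨ρ, hρ, hρr, harc⟩ := crosscut h.hol hΦgi hbd hζ (half_pos hη) (lt_min hr one_pos)
  have hρ1 : ρ < 1 := hρr.trans_le (min_le_right _ _)
  have hρr' : ρ < r := hρr.trans_le (min_le_left _ _)
  have harc' : ∀ z ∈ ball (0 : ℂ) 1, ∀ z' ∈ ball (0 : ℂ) 1, dist z ζ = ρ → dist z' ζ = ρ →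
      dist (g z) (g z') < ε := by
    intro z hz z' hz' hd hd'
    have := hηε (Φ (g z)) ⟨g z, ball_subset_closedBall (h.gm hz), rfl⟩ (Φ (g z'))
      ⟨g z', ball_subset_closedBall (h.gm hz'), rfl⟩ (by linarith [harc z hz z' hz' hd hd'])
    simpa using this
  -- a point on the arc
  have hz₀ : ((1 - ρ : ℝ) : ℂ) * ζ ∈ ball (0 : ℂ) 1 := by
    rw [mem_ball_zero_iff, norm_mul, hζ, Complex.norm_real, Real.norm_of_nonneg (by linarith)]
    linarith
  have hd₀ : dist (((1 - ρ : ℝ) : ℂ) * ζ) ζ = ρ := by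
    rw [dist_eq_norm]
    have : ((1 - ρ : ℝ) : ℂ) * ζ - ζ = (-ρ : ℝ) * ζ := by push_cast; ring
    rw [this, norm_mul, hζ, Complex.norm_real]
    simp [abs_of_pos hρ]
  set z₀ := ((1 - ρ : ℝ) : ℂ) * ζ with hz₀d
  set w₀ := g z₀ with hw₀
  set u₀ := w₀ / ‖w₀‖ with hu₀
  set P : Set ℂ := {w | w ∈ ball (0 : ℂ) 1 ∧ 1 - ε < ‖w‖ ∧ ‖w / ‖w‖ - u₀‖ ≤ 3 * ε} with hP
  have hQ : StarConvex ℝ 0 (ball (0 : ℂ) 1 \ P) := by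
    intro w hw a b ha hb hab
    rw [smul_zero, zero_add]
    have hbn : ‖b • w‖ ≤ ‖w‖ := by
      rw [norm_smul, Real.norm_of_nonneg hb]
      nlinarith [norm_nonneg w]
    refine ⟨by rw [mem_ball_zero_iff]; have := mem_ball_zero_iff.mp hw.1; linarith, ?_⟩
    rintro ⟨-, h2, h3⟩
    apply hw.2
    refine ⟨hw.1, by linarith, ?_⟩
    rcases hb.eq_or_lt with rfl | hb
    · simp at h2; linarith
    · convert h3 using 3
      have : (b : ℂ) ≠ 0 := by exact_mod_cast hb.ne'
      rw [norm_smul, Real.norm_of_nonneg hb.le, Complex.real_smul]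
      push_cast
      rw [mul_div_mul_left _ _ this]
  have h0Q : (0 : ℂ) ∈ ball (0 : ℂ) 1 \ P := by
    refine ⟨by simp, ?_⟩
    rintro ⟨-, h2, -⟩
    simp at h2; linarith
  have hQc : IsPreconnected (k '' (ball (0 : ℂ) 1 \ P)) :=
    (hQ.isPathConnected h0Q).isConnected.isPreconnected.image _ (h.kc.mono sdiff_subset)
  have key : ∀ z ∈ ball (0 : ℂ) 1, dist z ζ < ρ → g z ∈ P := by
    intro z hz hd
    by_contra hcon
    have hc2 := hQc.image (fun z => dist z ζ) (by fun_prop)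
    have h1 : dist z ζ ∈ (fun z => dist z ζ) '' (k '' (ball (0 : ℂ) 1 \ P)) :=
      ⟨z, ⟨g z, ⟨h.gm hz, hcon⟩, h.kg z hz⟩, rfl⟩
    have h2 : (1 : ℝ) ∈ (fun z => dist z ζ) '' (k '' (ball (0 : ℂ) 1 \ P)) :=
      ⟨0, ⟨0, h0Q, h.k0⟩, by simp [hζ]⟩
    obtain ⟨_, ⟨w, hw, rfl⟩, hwd⟩ := hc2.ordConnected.out h1 h2 ⟨hd.le, hρ1.le⟩
    apply hw.2
    have hkw := h.km hw.1
    have e1 := harc' (k w) hkw z₀ hz₀ hwd hd₀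
    rw [h.gk w hw.1] at e1
    have e2 := hrp (k w) hkw (by simp only at hwd; rw [hwd]; exact hρr')
    rw [h.gk w hw.1] at e2
    have e3 := hrp z₀ hz₀ (by rw [hd₀]; exact hρr')
    refine ⟨hw.1, e2, ?_⟩
    have f1 := dir_close e2 (mem_ball_zero_iff.mp hw.1).le (by linarith)
    have f2 := dir_close e3 (mem_ball_zero_iff.mp (h.gm hz₀)).le (by linarith)
    rw [dist_eq_norm] at e1
    calc ‖w / ‖w‖ - u₀‖ = ‖(w / ‖w‖ - w) + (w - g z₀) - (u₀ - g z₀)‖ := by congr 1; ring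
      _ ≤ ‖w / ‖w‖ - w‖ + ‖w - g z₀‖ + ‖u₀ - g z₀‖ := (norm_sub_le _ _).trans (by gcongr; exact norm_add_le _ _)
      _ ≤ 3 * ε := by linarith
  have key2 : ∀ z ∈ ball (0 : ℂ) 1, dist z ζ < ρ → ‖g z - u₀‖ ≤ 4 * ε := by
    intro z hz hd
    obtain ⟨h1, h2, h3⟩ := key z hz hd
    have f1 := dir_close h2 (mem_ball_zero_iff.mp h1).le (by linarith)
    calc ‖g z - u₀‖ = ‖(g z / ‖g z‖ - u₀) - (g z / ‖g z‖ - g z)‖ := by congr 1; ring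
      _ ≤ _ := norm_sub_le _ _
      _ ≤ 4 * ε := by linarith
  refine ⟨ρ, hρ, fun z hz z' hz' hd hd' => ?_⟩
  have e1 := key2 z hz hd
  have e2 := key2 z' hz' hd'
  rw [dist_eq_norm]
  calc ‖g z - g z'‖ = ‖(g z - u₀) - (g z' - u₀)‖ := by congr 1; ring
    _ ≤ _ := norm_sub_le _ _
    _ ≤ 8 * ε := by linarith

lemma Data.lim (h : Data Φ g k) {ζ : ℂ} (hζ : ζ ∈ closedBall (0 : ℂ) 1) :
    ∃ y, Tendsto g (𝓝[ball 0 1] ζ) (𝓝 y) := by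
  rcases (mem_closedBall_zero_iff.mp hζ).lt_or_eq with h1 | h1
  · exact ⟨g ζ, h.gc ζ (by simpa using h1)⟩
  · have hne : (𝓝[ball (0 : ℂ) 1] ζ).NeBot := by
      rw [← mem_closure_iff_nhdsWithin_neBot, closure_ball _ one_ne_zero]; exact hζ
    have hc : Cauchy (map g (𝓝[ball (0 : ℂ) 1] ζ)) := by
      rw [Metric.cauchy_iff]
      refine ⟨inferInstance, fun ε hε => ?_⟩
      have hm : 0 < min (ε / 9) (1 / 2) := by positivity
      obtain ⟨ρ, hρ, hh⟩ := h.osc h1 hm ((min_le_right _ _).trans_lt (by norm_num))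
      refine ⟨g '' (ball 0 1 ∩ ball ζ ρ), image_mem_map (inter_mem self_mem_nhdsWithin
        (mem_nhdsWithin_of_mem_nhds (ball_mem_nhds _ hρ))), ?_⟩
      rintro _ ⟨z, hz, rfl⟩ _ ⟨z', hz', rfl⟩
      have := hh z hz.1 z' hz'.1 hz.2 hz'.2
      have h2 : min (ε / 9) (1 / 2) ≤ ε / 9 := min_le_left _ _
      linarith
    obtain ⟨y, hy⟩ := CompleteSpace.complete hc
    exact ⟨y, hy⟩

/-- continuous extension to the closed disc -/
noncomputable def ext (g : ℂ → ℂ) : ℂ → ℂ := extendFrom (ball 0 1) g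

lemma Data.ext_cont (h : Data Φ g k) : ContinuousOn (ext g) (closedBall 0 1) :=
  continuousOn_extendFrom (by rw [closure_ball _ one_ne_zero]) fun _ hx => h.lim hx

lemma Data.ext_eq (h : Data Φ g k) {z : ℂ} (hz : z ∈ ball (0 : ℂ) 1) : ext g z = g z :=
  extendFrom_eq (subset_closure hz) (h.gc z hz)

lemma Data.ext_tendsto (h : Data Φ g k) {z : ℂ} (hz : z ∈ closedBall (0 : ℂ) 1) :
    Tendsto g (𝓝[ball 0 1] z) (𝓝 (ext g z)) := tendsto_extendFrom (h.lim hz)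

lemma neBot_ball {z : ℂ} (hz : z ∈ closedBall (0 : ℂ) 1) : (𝓝[ball (0 : ℂ) 1] z).NeBot := by
  rw [← mem_closure_iff_nhdsWithin_neBot, closure_ball _ one_ne_zero]; exact hz

lemma Data.ext_maps (h : Data Φ g k) : MapsTo (ext g) (closedBall 0 1) (closedBall 0 1) := by
  intro z hz
  have := neBot_ball hz
  refine isClosed_closedBall.mem_of_tendsto (h.ext_tendsto hz) ?_
  filter_upwards [self_mem_nhdsWithin] with w hw using ball_subset_closedBall (h.gm hw)

lemma Data.ext_sphere (h : Data Φ g k) {z : ℂ} (hz : ‖z‖ = 1) : ‖ext g z‖ = 1 := by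
  have hz' : z ∈ closedBall (0 : ℂ) 1 := by simp [hz]
  have := neBot_ball hz'
  apply le_antisymm (mem_closedBall_zero_iff.mp (h.ext_maps hz'))
  apply le_of_forall_lt
  intro s hs
  obtain ⟨s', hs1, hs2⟩ := exists_between hs
  obtain ⟨r, hr, hrp⟩ := h.proper hs2 hz
  refine lt_of_lt_of_le hs1 (ge_of_tendsto (h.ext_tendsto hz').norm ?_)
  filter_upwards [self_mem_nhdsWithin, mem_nhdsWithin_of_mem_nhds (ball_mem_nhds z hr)] with w h1 h2
  exact (hrp w h1 h2).le

lemma Data.ext_surj (h : Data Φ g k) : SurjOn (ext g) (closedBall 0 1) (closedBall 0 1) := by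
  have hK : IsCompact (ext g '' closedBall 0 1) :=
    (isCompact_closedBall _ _).image_of_continuousOn h.ext_cont
  have : ball (0 : ℂ) 1 ⊆ ext g '' closedBall 0 1 := fun w hw =>
    ⟨k w, ball_subset_closedBall (h.km hw), by rw [h.ext_eq (h.km hw), h.gk w hw]⟩
  have h2 := closure_minimal this hK.isClosed
  rwa [closure_ball _ one_ne_zero] at h2

end Car

end

section

open Set Filter Topology Metric MeasureTheory

namespace Car

variable {Φ : ℂ ≃ₜ ℂ} {g k : ℂ → ℂ}

lemma polar_rep {z : ℂ} (hz : z ≠ 0) (α : ℝ) :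
    ∃ θ ∈ Ico α (α + 2 * Real.pi), z = Complex.exp ⟨Real.log ‖z‖, θ⟩ := by
  refine ⟨toIcoMod Real.two_pi_pos α z.arg, toIcoMod_mem_Ico _ _ _, ?_⟩
  nth_rewrite 1 [← Complex.exp_log hz]
  rw [Complex.exp_eq_exp_iff_exists_int]
  refine ⟨toIcoDiv Real.two_pi_pos α z.arg, ?_⟩
  rw [toIcoMod]
  apply Complex.ext
  · simp [Complex.log_re]
  · simp [Complex.log_im]

lemma exp_inj' {w w' : ℂ} (h : Complex.exp w = Complex.exp w') (h1 : w.im - w'.im < 2 * Real.pi)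
    (h2 : w'.im - w.im < 2 * Real.pi) : w = w' := by
  rw [Complex.exp_eq_exp_iff_exists_int] at h
  obtain ⟨n, hn⟩ := h
  have him : w.im = w'.im + n * (2 * Real.pi) := by
    rw [hn]; simp
  have hp := Real.pi_pos
  have n1 : (n : ℝ) < 1 := by nlinarith
  have n2 : (-1 : ℝ) < n := by nlinarith
  have n1' : n < 1 := by exact_mod_cast n1
  have n2' : -1 < n := by exact_mod_cast n2
  have : n = 0 := by omega
  rw [hn, this]; simp

lemma Data.arc_const (h : Data Φ g k) {α β : ℝ} (hαβ : α < β) (q : ℂ)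
    (hq : ∀ θ ∈ Ioo α β, ext g (Complex.exp ⟨0, θ⟩) = q) : False := by
  set δ := (β - α) / 2 with hδ
  have hδ0 : 0 < δ := by rw [hδ]; linarith
  set N := ⌊2 * Real.pi / δ⌋₊ + 2 with hN
  set Rb : ℂ → ℂ := fun z => Φ (ext g z) with hRb
  have hRc : ContinuousOn Rb (closedBall 0 1) := Φ.continuous.comp_continuousOn h.ext_cont
  have hRd : DifferentiableOn ℂ Rb (ball 0 1) :=
    h.hol.congr fun z hz => by rw [hRb]; simp only [h.ext_eq hz]
  have hRi : ∀ a ∈ ball (0 : ℂ) 1, ∀ b ∈ ball (0 : ℂ) 1, Rb a = Rb b → a = b := by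
    intro a ha b hb hab
    have := Φ.injective hab
    rw [h.ext_eq ha, h.ext_eq hb] at this
    exact h.gi ha hb this
  have hrot : ∀ (j : ℕ) (z : ℂ), ‖Complex.exp ⟨0, j * δ⟩ * z‖ = ‖z‖ := by
    intro j z; rw [norm_mul, Complex.norm_exp]; simp
  set f : ℂ → ℂ := fun z => ∏ j ∈ Finset.range N, (Rb (Complex.exp ⟨0, j * δ⟩ * z) - Φ q) with hf
  have hfc : DiffContOnCl ℂ f (ball 0 1) := by
    refine ⟨?_, ?_⟩
    · rw [hf]
      apply DifferentiableOn.fun_finsetProd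
      intro j _
      apply DifferentiableOn.sub_const
      refine hRd.comp (by fun_prop) fun z hz => ?_
      rw [mem_ball_zero_iff] at hz ⊢; rwa [hrot]
    · rw [closure_ball _ one_ne_zero, hf]
      apply continuousOn_finsetProd
      intro j _
      apply ContinuousOn.sub _ continuousOn_const
      refine hRc.comp (by fun_prop) fun z hz => ?_
      rw [mem_closedBall_zero_iff] at hz ⊢; rwa [hrot]
  have hf0 : EqOn f 0 (frontier (ball 0 1)) := by
    intro z hz
    rw [frontier_ball _ one_ne_zero, mem_sphere_zero_iff_norm] at hz
    have hz0 : z ≠ 0 := by rintro rfl; simp at hz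
    obtain ⟨θ, hθ, hzθ⟩ := polar_rep hz0 (α - 2 * Real.pi)
    rw [hz, Real.log_one] at hzθ
    rw [hf]
    have hx : 0 ≤ (α - θ) / δ := div_nonneg (by linarith [hθ.2]) hδ0.le
    set j := ⌊(α - θ) / δ⌋₊ + 1 with hj
    refine Finset.prod_eq_zero (i := j) ?_ ?_
    · rw [Finset.mem_range, hj, hN]
      have : ⌊(α - θ) / δ⌋₊ ≤ ⌊2 * Real.pi / δ⌋₊ := by
        apply Nat.floor_le_floor
        gcongr; linarith [hθ.1]
      omega
    · have e1 : (α - θ) / δ < j := by rw [hj]; push_cast; exact Nat.lt_floor_add_one _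
      have e2 : (j : ℝ) ≤ (α - θ) / δ + 1 := by
        rw [hj]; push_cast; linarith [Nat.floor_le hx]
      rw [div_lt_iff₀ hδ0] at e1
      have e3 : j * δ ≤ (α - θ) + δ := by
        calc j * δ ≤ ((α - θ) / δ + 1) * δ := by gcongr
          _ = _ := by field_simp
      rw [hzθ, ← Complex.exp_add]
      have : (⟨0, j * δ⟩ + ⟨0, θ⟩ : ℂ) = ⟨0, j * δ + θ⟩ := by
        apply Complex.ext <;> simp
      rw [this, hRb]
      simp only
      rw [hq _ ⟨by linarith, by rw [hδ] at e3 ⊢; linarith⟩, sub_self]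
  have hz := Complex.eqOn_of_eqOn_frontier isBounded_ball hfc
    (diffContOnCl_const (c := (0 : ℂ))) hf0
  have hall : ∀ z ∈ ball (0 : ℂ) 1, ∃ j : ℕ, Rb (Complex.exp ⟨0, j * δ⟩ * z) = Φ q := by
    intro z hz'
    have := hz hz'
    rw [hf] at this
    obtain ⟨j, -, hj⟩ := Finset.prod_eq_zero_iff.mp this
    exact ⟨j, sub_eq_zero.mp hj⟩
  obtain ⟨i, hi⟩ := hall 0 (by simp)
  have hhalf : (1 / 2 : ℂ) ∈ ball (0 : ℂ) 1 := by
    rw [mem_ball_zero_iff]; norm_num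
  obtain ⟨j, hj⟩ := hall (1 / 2) hhalf
  rw [← hj] at hi
  have := hRi _ (by simp) _ (by rw [mem_ball_zero_iff, hrot]; exact mem_ball_zero_iff.mp hhalf) hi
  rw [mul_zero] at this
  have h2 := congrArg norm this
  rw [hrot] at h2
  norm_num at h2

lemma convex_box (a b c d : ℝ) : Convex ℝ {w : ℂ | a < w.re ∧ w.re < b ∧ c < w.im ∧ w.im < d} := by
  have h1 : Convex ℝ {w : ℂ | a < w.re} := convex_halfSpace_re_gt a
  have h2 : Convex ℝ {w : ℂ | w.re < b} := convex_halfSpace_re_lt b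
  have h3 : Convex ℝ {w : ℂ | c < w.im} := convex_halfSpace_im_gt c
  have h4 : Convex ℝ {w : ℂ | w.im < d} := convex_halfSpace_im_lt d
  exact h1.inter (h2.inter (h3.inter h4))

lemma open_box (a b c d : ℝ) : IsOpen {w : ℂ | a < w.re ∧ w.re < b ∧ c < w.im ∧ w.im < d} :=
  (isOpen_lt continuous_const Complex.continuous_re).inter
    ((isOpen_lt Complex.continuous_re continuous_const).inter
    ((isOpen_lt continuous_const Complex.continuous_im).inter
    (isOpen_lt Complex.continuous_im continuous_const)))

lemma open_sector (c d : ℝ) : IsOpen {w : ℂ | c < w.im ∧ w.im < d} :=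
  ((isOpen_lt continuous_const Complex.continuous_im).inter
    (isOpen_lt Complex.continuous_im continuous_const))

lemma Data.inj_sphere (h : Data Φ g k) {a b : ℂ} (ha : ‖a‖ = 1) (hb : ‖b‖ = 1)
    (hab : ext g a = ext g b) : a = b := by
  by_contra hne
  have ha0 : a ≠ 0 := by rintro rfl; simp at ha
  have hb0 : b ≠ 0 := by rintro rfl; simp at hb
  obtain ⟨α, -, haα⟩ := polar_rep ha0 0
  obtain ⟨β, hβ, hbβ⟩ := polar_rep hb0 α
  rw [ha, Real.log_one] at haα
  rw [hb, Real.log_one] at hbβ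
  have hαβ : α < β := by
    rcases hβ.1.lt_or_eq with h1 | h1
    · exact h1
    · exfalso; apply hne; rw [haα, hbβ, h1]
  set q := ext g a with hq
  have hqn : ‖q‖ = 1 := h.ext_sphere ha
  have hq0 : q ≠ 0 := by rintro hh; rw [hh] at hqn; simp at hqn
  have harc : ∀ c d : ℝ, c < d → ∃ θ ∈ Ioo c d, ∃ τ ∈ Ioo 0 (2 * Real.pi),
      ext g (Complex.exp ⟨0, θ⟩) = q * Complex.exp ⟨0, τ⟩ := by
    intro c d hcd
    by_contra! hcon
    refine h.arc_const hcd q fun θ hθ => ?_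
    by_contra hne'
    have hn : ‖ext g (Complex.exp ⟨0, θ⟩)‖ = 1 := h.ext_sphere (by rw [Complex.norm_exp]; simp)
    have hr0 : ext g (Complex.exp ⟨0, θ⟩) / q ≠ 0 := by
      rw [← norm_pos_iff, norm_div, hn, hqn]; norm_num
    obtain ⟨τ, hτ, hτe⟩ := polar_rep hr0 0
    rw [norm_div, hn, hqn, div_one, Real.log_one, div_eq_iff hq0] at hτe
    rw [zero_add] at hτ
    rcases hτ.1.eq_or_lt with h0 | h0
    · apply hne'; rw [hτe, ← h0]
      have : (⟨0, 0⟩ : ℂ) = 0 := rfl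
      rw [this]; simp
    · exact hcon θ hθ τ ⟨h0, hτ.2⟩ (by rw [hτe]; ring)
  obtain ⟨θ₁, hθ₁, τ₁, hτ₁, he₁⟩ := harc α β hαβ
  obtain ⟨θ₂, hθ₂, τ₂, hτ₂, he₂⟩ := harc β (α + 2 * Real.pi) hβ.2
  obtain ⟨t₀, ht₀, ht₁⟩ : ∃ t₀, 0 < t₀ ∧ t₀ < min (min τ₁ τ₂) (min (2 * Real.pi - τ₁) (2 * Real.pi - τ₂)) := by
    apply exists_between
    simp only [lt_min_iff]
    exact ⟨⟨hτ₁.1, hτ₂.1⟩, by linarith [hτ₁.2], by linarith [hτ₂.2]⟩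
  simp only [lt_min_iff] at ht₁
  obtain ⟨⟨m1, m2⟩, m3, m4⟩ := ht₁
  -- compact sets
  set T : Set ℂ := ext g '' ((fun s : ℝ => (s : ℂ) * a) '' Icc 0 1 ∪ (fun s : ℝ => (s : ℂ) * b) '' Icc 0 1) with hT
  have hsub : ∀ c : ℂ, ‖c‖ = 1 → (fun s : ℝ => (s : ℂ) * c) '' Icc 0 1 ⊆ closedBall (0 : ℂ) 1 := by
    rintro c hc _ ⟨s, hs, rfl⟩
    simp only [mem_closedBall_zero_iff, norm_mul, hc, Complex.norm_real, Real.norm_of_nonneg hs.1]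
    linarith [hs.2]
  have hTc : IsCompact T := by
    apply IsCompact.image_of_continuousOn
    · exact (isCompact_Icc.image (by fun_prop)).union (isCompact_Icc.image (by fun_prop))
    · exact h.ext_cont.mono (union_subset (hsub a ha) (hsub b hb))
  set K : Set ℂ := (fun p : ℝ × ℝ => (p.1 : ℂ) * (q * Complex.exp (p.2 * Complex.I))) ''
    (Icc 0 1 ×ˢ Icc t₀ (2 * Real.pi - t₀)) with hK
  have hKc : IsCompact K := (isCompact_Icc.prod isCompact_Icc).image (by fun_prop)
  have hqK : q ∉ K := by
    rintro ⟨⟨s, t⟩, ⟨hs, ht⟩, hst⟩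
    simp only at hs ht hst
    have h1 := congrArg norm hst
    rw [norm_mul, norm_mul, hqn, Complex.norm_exp_ofReal_mul_I, Complex.norm_real,
      Real.norm_of_nonneg hs.1] at h1
    have h2 : s = 1 := by linarith
    rw [h2] at hst
    have h3 : Complex.exp (t * Complex.I) = Complex.exp 0 := by
      rw [Complex.exp_zero]
      apply mul_left_cancel₀ hq0
      simpa using hst
    have h4 := exp_inj' h3 (by simp; linarith [ht.2]) (by simp; linarith [ht.1, Real.pi_pos])
    have h5 := congrArg Complex.im h4
    simp at h5
    linarith [ht.1]
  have hTK : T ∩ K ⊆ ball 0 1 := by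
    have aux : ∀ c : ℂ, ‖c‖ = 1 → ext g c = q → ∀ s ∈ Icc (0 : ℝ) 1, ext g ((s : ℂ) * c) ∈ K →
        ext g ((s : ℂ) * c) ∈ ball (0 : ℂ) 1 := by
      intro c hc hcq s hs hmem
      rcases hs.2.lt_or_eq with h1 | h1
      · have : (s : ℂ) * c ∈ ball (0 : ℂ) 1 := by
          rw [mem_ball_zero_iff, norm_mul, hc, Complex.norm_real, Real.norm_of_nonneg hs.1]
          linarith
        rw [h.ext_eq this]; exact h.gm this
      · rw [h1] at hmem
        simp only [Complex.ofReal_one, one_mul, hcq] at hmem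
        exact absurd hmem hqK
    rintro w ⟨⟨z, hz, rfl⟩, hw⟩
    rcases hz with ⟨s, hs, rfl⟩ | ⟨s, hs, rfl⟩
    · exact aux a ha hq.symm s hs hw
    · exact aux b hb hab.symm s hs hw
  obtain ⟨s₀, hs₀, hs₀'⟩ := _root_.exists_lt_subset_ball (hTc.inter hKc).isClosed hTK
  set s₁ := max s₀ (1 / 2) with hs₁
  have hs₁1 : s₁ < 1 := max_lt hs₀ (by norm_num)
  have hs₁0 : 0 < s₁ := lt_of_lt_of_le (by norm_num) (le_max_right _ _)
  set N : Set ℂ := (fun w => q * Complex.exp w) ''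
    {w : ℂ | Real.log s₁ < w.re ∧ w.re < 0 ∧ t₀ < w.im ∧ w.im < 2 * Real.pi - t₀} with hN
  set N' : Set ℂ := (fun w => q * Complex.exp w) ''
    {w : ℂ | Real.log s₁ < w.re ∧ w.re < 1 ∧ t₀ < w.im ∧ w.im < 2 * Real.pi - t₀} with hN'
  have hNo : IsOpen N' :=
    ((Homeomorph.mulLeft₀ q hq0).isOpenMap.comp Complex.isOpenMap_exp) _ (open_box _ _ _ _)
  have hNn : ∀ w : ℂ, ‖q * Complex.exp w‖ = Real.exp w.re := by
    intro w; rw [norm_mul, hqn, one_mul, Complex.norm_exp]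
  have hNN : ∀ w ∈ N', w ∈ ball (0 : ℂ) 1 → w ∈ N := by
    rintro _ ⟨w, hw, rfl⟩ hb
    rw [mem_ball_zero_iff, hNn, Real.exp_lt_one_iff] at hb
    exact ⟨w, ⟨hw.1, hb, hw.2.2⟩, rfl⟩
  have hNb : N ⊆ ball 0 1 := by
    rintro _ ⟨w, hw, rfl⟩
    rw [mem_ball_zero_iff, hNn, Real.exp_lt_one_iff]; exact hw.2.1
  have hNc : IsPreconnected (k '' N) := by
    apply IsPreconnected.image _ _ (h.kc.mono hNb)
    exact (convex_box _ _ _ _).isPreconnected.image _ (by fun_prop)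
  have hNs : ∀ w ∈ N, s₁ < ‖w‖ := by
    rintro _ ⟨w, hw, rfl⟩
    rw [hNn]; exact (Real.log_lt_iff_lt_exp hs₁0).mp hw.1
  have hNT : ∀ w ∈ N, w ∉ T := by
    intro w hw hwT
    have hwK : w ∈ K := by
      have hw' := hw
      obtain ⟨v, hv, rfl⟩ := hw'
      refine ⟨(Real.exp v.re, v.im), ⟨⟨(Real.exp_pos _).le, ?_⟩, hv.2.2.1.le, hv.2.2.2.le⟩, ?_⟩
      · rw [Real.exp_le_one_iff]; exact hv.2.1.le
      · simp only
        rw [Complex.ofReal_exp, mul_left_comm, ← Complex.exp_add, Complex.re_add_im]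
    have h1 := hs₀' ⟨hwT, hwK⟩
    rw [mem_ball_zero_iff] at h1
    have h2 := hNs w hw
    have h3 : s₀ ≤ s₁ := le_max_left _ _
    linarith
  -- sectors
  set S₁ : Set ℂ := Complex.exp '' {w : ℂ | α < w.im ∧ w.im < β} with hS₁
  set S₂ : Set ℂ := Complex.exp '' {w : ℂ | β < w.im ∧ w.im < α + 2 * Real.pi} with hS₂
  have hS₁o : IsOpen S₁ := Complex.isOpenMap_exp _ (open_sector _ _)
  have hS₂o : IsOpen S₂ := Complex.isOpenMap_exp _ (open_sector _ _)
  have hcover : k '' N ⊆ S₁ ∪ S₂ := by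
    rintro _ ⟨w, hw, rfl⟩
    have hwb := hNb hw
    have hkw := h.km hwb
    have hk0 : k w ≠ 0 := by
      intro h0
      have := h.gk w hwb
      rw [h0, h.g0] at this
      have h2 := hNs w hw
      rw [← this, norm_zero] at h2
      linarith
    obtain ⟨θ, hθ, hz⟩ := polar_rep hk0 α
    have hn : ‖k w‖ ∈ Icc (0 : ℝ) 1 := ⟨norm_nonneg _, (mem_ball_zero_iff.mp hkw).le⟩
    have hform : k w = (‖k w‖ : ℂ) * Complex.exp ⟨0, θ⟩ := by
      nth_rewrite 1 [hz]
      have : (⟨Real.log ‖k w‖, θ⟩ : ℂ) = ((Real.log ‖k w‖ : ℝ) : ℂ) + ⟨0, θ⟩ := by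
        apply Complex.ext <;> simp
      rw [this, Complex.exp_add, ← Complex.ofReal_exp, Real.exp_log (norm_pos_iff.mpr hk0)]
    have hgw : ext g (k w) = w := by rw [h.ext_eq hkw, h.gk w hwb]
    rcases hθ.1.eq_or_lt with h1 | h1
    · exfalso
      apply hNT w hw
      refine ⟨k w, Or.inl ⟨‖k w‖, hn, ?_⟩, hgw⟩
      rw [← h1, ← haα] at hform; exact hform.symm
    · rcases lt_trichotomy θ β with h2 | h2 | h2
      · left; rw [hz]; exact ⟨_, ⟨h1, h2⟩, rfl⟩
      · exfalso
        apply hNT w hw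
        refine ⟨k w, Or.inr ⟨‖k w‖, hn, ?_⟩, hgw⟩
        rw [h2, ← hbβ] at hform; exact hform.symm
      · right; rw [hz]; exact ⟨_, ⟨h2, hθ.2⟩, rfl⟩
  have hmeet : ∀ (θ τ : ℝ) (S : Set ℂ), IsOpen S → Complex.exp ⟨0, θ⟩ ∈ S → t₀ < τ → τ < 2 * Real.pi - t₀ →
      ext g (Complex.exp ⟨0, θ⟩) = q * Complex.exp ⟨0, τ⟩ → (k '' N ∩ S).Nonempty := by
    intro θ τ S hS hθ h1 h2 he
    have hcl : Complex.exp ⟨0, θ⟩ ∈ closedBall (0 : ℂ) 1 := by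
      rw [mem_closedBall_zero_iff, Complex.norm_exp]; simp
    have := neBot_ball hcl
    have ht := h.ext_tendsto hcl
    have hmem : N' ∈ 𝓝 (ext g (Complex.exp ⟨0, θ⟩)) := by
      apply hNo.mem_nhds
      rw [he]
      exact ⟨_, ⟨Real.log_neg hs₁0 hs₁1, one_pos, h1, h2⟩, rfl⟩
    have ev1 : ∀ᶠ z in 𝓝[ball (0 : ℂ) 1] (Complex.exp ⟨0, θ⟩), g z ∈ N' := ht hmem
    have ev2 : ∀ᶠ z in 𝓝[ball (0 : ℂ) 1] (Complex.exp ⟨0, θ⟩), z ∈ S :=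
      mem_nhdsWithin_of_mem_nhds (hS.mem_nhds hθ)
    have ev3 : ∀ᶠ z in 𝓝[ball (0 : ℂ) 1] (Complex.exp ⟨0, θ⟩), z ∈ ball (0 : ℂ) 1 :=
      self_mem_nhdsWithin
    obtain ⟨z, hz1, hz2, hz3⟩ := (ev1.and (ev2.and ev3)).exists
    exact ⟨z, ⟨g z, hNN _ hz1 (h.gm hz3), h.kg z hz3⟩, hz2⟩
  have hm1 := hmeet θ₁ τ₁ S₁ hS₁o ⟨_, ⟨hθ₁.1, hθ₁.2⟩, rfl⟩ m1 (by linarith) he₁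
  have hm2 := hmeet θ₂ τ₂ S₂ hS₂o ⟨_, ⟨hθ₂.1, hθ₂.2⟩, rfl⟩ m2 (by linarith) he₂
  obtain ⟨z, -, ⟨w, hw, hwz⟩, ⟨w', hw', hwz'⟩⟩ := hNc S₁ S₂ hS₁o hS₂o hcover hm1 hm2
  have heq := exp_inj' (hwz.trans hwz'.symm) (by linarith [hw.1, hw.2, hw'.1, hw'.2])
    (by linarith [hw.1, hw.2, hw'.1, hw'.2])
  have := hw.2
  have := hw'.1
  rw [heq] at *
  linarith

theorem Data.inj (h : Data Φ g k) : InjOn (ext g) (closedBall 0 1) := by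
  intro a ha b hb hab
  rw [mem_closedBall_zero_iff] at ha hb
  have hlt : ∀ c : ℂ, ‖c‖ < 1 → ‖ext g c‖ < 1 := by
    intro c hc
    have hc' : c ∈ ball (0 : ℂ) 1 := by simpa using hc
    rw [h.ext_eq hc']
    simpa using h.gm hc'
  rcases ha.lt_or_eq with h1 | h1 <;> rcases hb.lt_or_eq with h2 | h2
  · have h1' : a ∈ ball (0 : ℂ) 1 := by simpa using h1
    have h2' : b ∈ ball (0 : ℂ) 1 := by simpa using h2
    rw [h.ext_eq h1', h.ext_eq h2'] at hab
    exact h.gi h1' h2' hab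
  · have := hlt a h1
    rw [hab, h.ext_sphere h2] at this
    exact absurd this (lt_irrefl _)
  · have := hlt b h2
    rw [← hab, h.ext_sphere h1] at this
    exact absurd this (lt_irrefl _)
  · exact h.inj_sphere h1 h2 hab

end Car

end

section

open Set Filter Topology Metric MeasureTheory

namespace TT

/-- integer vector -/
noncomputable def iv (m n : ℤ) : ℝ × ℝ := ((m : ℝ), (n : ℝ))

@[simp] lemma iv_fst (m n : ℤ) : (iv m n).1 = m := rfl
@[simp] lemma iv_snd (m n : ℤ) : (iv m n).2 = n := rfl
@[simp] lemma iv_zero : iv 0 0 = 0 := by simp [iv]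
lemma iv_add (m n m' n' : ℤ) : iv m n + iv m' n' = iv (m + m') (n + n') := by simp [iv]
lemma iv_neg (m n : ℤ) : - iv m n = iv (-m) (-n) := by simp [iv]
lemma iv_inj {m n m' n' : ℤ} (h : iv m n = iv m' n') : m = m' ∧ n = n' := by
  simpa [iv] using h

lemma coe_eq_iff (x y : ℝ) : (x : AddCircle (1 : ℝ)) = y ↔ ∃ m : ℤ, y = x + m := by
  rw [← sub_eq_zero, ← AddCircle.coe_sub, AddCircle.coe_eq_zero_iff]
  constructor
  · rintro ⟨n, hn⟩
    refine ⟨-n, ?_⟩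
    simp at hn; push_cast; linarith
  · rintro ⟨n, hn⟩
    refine ⟨-n, ?_⟩
    simp [hn]

lemma proj_eq_iff (p p' : ℝ × ℝ) : torusProj p = torusProj p' ↔ ∃ m n : ℤ, p' = p + iv m n := by
  simp only [torusProj, coe_eq_iff, Prod.ext_iff, Prod.fst_add, Prod.snd_add, iv_fst,
    iv_snd]
  constructor
  · rintro ⟨⟨m, hm⟩, n, hn⟩; exact ⟨m, n, hm, hn⟩
  · rintro ⟨m, n, hm, hn⟩; exact ⟨⟨m, hm⟩, n, hn⟩

@[simp] lemma proj_add_iv (p : ℝ × ℝ) (m n : ℤ) : torusProj (p + iv m n) = torusProj p :=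
  ((proj_eq_iff _ _).mpr ⟨m, n, rfl⟩).symm

lemma proj_surj : Function.Surjective torusProj := by
  rintro ⟨a, b⟩
  obtain ⟨x, rfl⟩ := QuotientAddGroup.mk_surjective a
  obtain ⟨y, rfl⟩ := QuotientAddGroup.mk_surjective b
  exact ⟨(x, y), rfl⟩

lemma proj_openQuot : IsOpenQuotientMap torusProj := by
  have h : IsOpenQuotientMap ((↑) : ℝ → AddCircle (1 : ℝ)) := QuotientAddGroup.isOpenQuotientMap_mk
  exact h.prodMap h

lemma proj_cont : Continuous torusProj := proj_openQuot.continuous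

lemma exists_lift {A : Type*} [TopologicalSpace A] [SimplyConnectedSpace A]
    [LocallyPathConnectedSpace A] [Nonempty A] {φ : A → T2} (hφ : Continuous φ) :
    ∃ Ψ : A → ℝ × ℝ, Continuous Ψ ∧ ∀ a, torusProj (Ψ a) = φ a := by
  have key : ∀ ψ : C(A, AddCircle (1 : ℝ)), ∃ Ψ : C(A, ℝ), ∀ a, ((Ψ a : ℝ) : AddCircle (1 : ℝ)) = ψ a := by
    intro ψ
    obtain ⟨a₀⟩ := ‹Nonempty A›
    obtain ⟨e₀, he₀⟩ := QuotientAddGroup.mk_surjective (ψ a₀)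
    obtain ⟨Ψ, ⟨-, h⟩, -⟩ := (AddCircle.isCoveringMap_coe (1 : ℝ)).existsUnique_continuousMap_lifts ψ a₀ e₀ he₀
    exact ⟨Ψ, fun a => congrFun h a⟩
  obtain ⟨Ψ₁, h1⟩ := key ⟨fun a => (φ a).1, by fun_prop⟩
  obtain ⟨Ψ₂, h2⟩ := key ⟨fun a => (φ a).2, by fun_prop⟩
  exact ⟨fun a => (Ψ₁ a, Ψ₂ a), by fun_prop, fun a => Prod.ext (h1 a) (h2 a)⟩

lemma const_int {A : Type*} [TopologicalSpace A] [PreconnectedSpace A] [Nonempty A]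
    {f g : A → ℝ × ℝ} (hf : Continuous f) (hg : Continuous g)
    (h : ∀ a, torusProj (f a) = torusProj (g a)) : ∃ m n : ℤ, ∀ a, f a = g a + iv m n := by
  obtain ⟨a₀⟩ := ‹Nonempty A›
  have hcov := AddCircle.isCoveringMap_coe (1 : ℝ)
  obtain ⟨m, n, hmn⟩ := (proj_eq_iff _ _).mp (h a₀).symm
  refine ⟨m, n, fun a => ?_⟩
  have h1 := hcov.eq_of_comp_eq (g₁ := fun a => (f a).1) (g₂ := fun a => (g a + iv m n).1)
    (by fun_prop) (by fun_prop) (by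
      funext a
      have := congrArg Prod.fst ((h a).trans (proj_add_iv (g a) m n).symm)
      exact this) a₀ (by simp only [hmn])
  have h2 := hcov.eq_of_comp_eq (g₁ := fun a => (f a).2) (g₂ := fun a => (g a + iv m n).2)
    (by fun_prop) (by fun_prop) (by
      funext a
      have := congrArg Prod.snd ((h a).trans (proj_add_iv (g a) m n).symm)
      exact this) a₀ (by simp only [hmn])
  exact Prod.ext (congrFun h1 a) (congrFun h2 a)

/-- commuting with integer translations -/
def Comm (F : ℝ × ℝ → ℝ × ℝ) : Prop := ∀ p m n, F (p + iv m n) = F p + iv m n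

/-- having a lift commuting with integer translations -/
def Triv (f : T2 → T2) : Prop := ∃ F, IsLift f F ∧ Comm F

lemma exists_isLift {f : T2 → T2} (hf : Continuous f) : ∃ F, IsLift f F := by
  obtain ⟨F, h1, h2⟩ := exists_lift (hf.comp proj_cont)
  exact ⟨F, h1, h2⟩

lemma IsLift.comp {f g : T2 → T2} {F G : ℝ × ℝ → ℝ × ℝ} (hF : IsLift f F) (hG : IsLift g G) :
    IsLift (f ∘ g) (F ∘ G) :=
  ⟨hF.1.comp hG.1, fun p => by simp [hF.2, hG.2]⟩

lemma lift_homeo {f : T2 ≃ₜ T2} {F : ℝ × ℝ → ℝ × ℝ} (hF : IsLift f F) (hc : Comm F) :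
    ∃ E : (ℝ × ℝ) ≃ₜ (ℝ × ℝ), ⇑E = F ∧ IsLift f.symm E.symm ∧ Comm E.symm := by
  obtain ⟨F', hF'⟩ := exists_isLift f.symm.continuous
  obtain ⟨m, n, h1⟩ := const_int (A := ℝ × ℝ) (f := F ∘ F') (g := id) (hF.1.comp hF'.1) continuous_id
    (fun a => by simp [hF.2, hF'.2])
  set G : ℝ × ℝ → ℝ × ℝ := fun p => F' (p + iv (-m) (-n)) with hG
  have hGc : Continuous G := hF'.1.comp (by fun_prop)
  have hFG : ∀ p, F (G p) = p := by
    intro p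
    have := h1 (p + iv (-m) (-n))
    simp only [Function.comp, id] at this
    rw [hG]; simp only
    rw [this, add_assoc, iv_add]; simp
  have hGl : IsLift f.symm G := ⟨hGc, fun p => by
    rw [hG]; simp only; rw [hF'.2]; simp⟩
  obtain ⟨m', n', h2⟩ := const_int (A := ℝ × ℝ) (f := G ∘ F) (g := id) (hGc.comp hF.1) continuous_id
    (fun a => by simp [hF.2, hGl.2])
  have hGF : ∀ p, G (F p) = p := by
    intro p
    have h3 := h2 p
    simp only [Function.comp, id] at h3
    have h4 := congrArg F h3
    rw [hFG, hc] at h4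
    have h5 : iv m' n' = 0 := by simpa using h4.symm
    rw [h3, h5, add_zero]
  refine ⟨⟨⟨F, G, hGF, hFG⟩, hF.1, hGc⟩, rfl, hGl, ?_⟩
  intro p m n
  change G (p + iv m n) = G p + iv m n
  rw [← hGF (G p + iv m n), hc, hFG]

/-- clamp to the unit interval -/
noncomputable def clamp (t : ℝ) : ℝ := max 0 (min 1 t)
lemma clamp_cont : Continuous clamp := by unfold clamp; fun_prop
lemma clamp_mem (t : ℝ) : clamp t ∈ Icc (0 : ℝ) 1 := by
  unfold clamp; constructor
  · exact le_max_left _ _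
  · exact max_le zero_le_one (min_le_left _ _)
@[simp] lemma clamp_zero : clamp 0 = 0 := by simp [clamp]
@[simp] lemma clamp_one : clamp 1 = 1 := by simp [clamp]
lemma clamp_of_mem {t : ℝ} (h : t ∈ Icc (0 : ℝ) 1) : clamp t = t := by
  simp [clamp, h.1, h.2]

lemma iso_mk {F : ℝ → T2 → T2} (hc : Continuous fun q : ℝ × T2 => F q.1 q.2)
    (hb : ∀ t ∈ Icc (0 : ℝ) 1, Function.Bijective (F t)) (h0 : F 0 = id) : IsotopicToId (F 1) := by
  refine ⟨fun t => F (clamp t), hc.comp ((clamp_cont.comp continuous_fst).prodMk continuous_snd), fun t => ?_, by simp [h0], by simp, by simp⟩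
  rw [isHomeomorph_iff_continuous_bijective]
  exact ⟨hc.comp (by fun_prop : Continuous fun x : T2 => (clamp t, x)), hb _ (clamp_mem t)⟩

/-- The subgroup of homeomorphisms isotopic to the identity. -/
def Iso : Subgroup (T2 ≃ₜ T2) where
  carrier := {f | IsotopicToId (⇑f)}
  mul_mem' := by
    rintro a b ⟨F, hF, hFh, hF0, hF1, -⟩ ⟨G, hG, hGh, hG0, hG1, -⟩
    refine ⟨fun t => F t ∘ G t, ?_, fun t => (hFh t).comp (hGh t), by simp [hF0, hG0], ?_, by simp⟩
    · exact hF.comp (continuous_fst.prodMk hG)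
    · funext x; simp only [Function.comp, hF1, hG1]; rfl
  one_mem' := ⟨fun _ => id, continuous_snd, fun _ => IsHomeomorph.id, rfl, rfl, by simp⟩
  inv_mem' := by
    rintro a ⟨F, hF, hFh, hF0, hF1, -⟩
    refine ⟨fun t => F (1 - t) ∘ a.symm, ?_, fun t => (hFh _).comp a.symm.isHomeomorph, ?_, ?_, by simp⟩
    · exact hF.comp ((continuous_const.sub continuous_fst).prodMk (a.symm.continuous.comp continuous_snd))
    · funext x; simp [hF1]
    · funext x; simp [hF0]

instance : Iso.Normal where
  conj_mem := by
    rintro a ⟨F, hF, hFh, hF0, hF1, -⟩ h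
    refine ⟨fun t => h ∘ F t ∘ h.symm, ?_, fun t => h.isHomeomorph.comp ((hFh t).comp h.symm.isHomeomorph), ?_, ?_, by simp⟩
    · exact h.continuous.comp (hF.comp (continuous_fst.prodMk (h.symm.continuous.comp continuous_snd)))
    · funext x; simp [hF0]
    · funext x; simp only [Function.comp, hF1]; rfl

lemma mem_Iso {f : T2 ≃ₜ T2} : f ∈ Iso ↔ IsotopicToId (⇑f) := Iff.rfl

/-- descending equivariant isotopies -/
lemma descend {F : ℝ → ℝ × ℝ → ℝ × ℝ} (hc : Continuous fun q : ℝ × (ℝ × ℝ) => F q.1 q.2)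
    (hb : ∀ t ∈ Icc (0 : ℝ) 1, Function.Bijective (F t)) (h0 : F 0 = id)
    (heq : ∀ t, Comm (F t)) :
    ∃ h ∈ Iso, IsLift h (F 1) := by
  have hex : ∀ (t : ℝ) (x : T2), ∃ y, ∀ p, torusProj p = x → torusProj (F t p) = y := by
    intro t x
    obtain ⟨p, rfl⟩ := proj_surj x
    refine ⟨torusProj (F t p), fun p' hp' => ?_⟩
    obtain ⟨m, n, rfl⟩ := (proj_eq_iff _ _).mp hp'.symm
    rw [heq]; simp
  choose f hf using hex
  have hf' : ∀ t p, torusProj (F t p) = f t (torusProj p) := fun t p => hf t _ p rfl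
  have hcf : Continuous fun q : ℝ × T2 => f q.1 q.2 := by
    have hq : IsOpenQuotientMap (Prod.map id torusProj : ℝ × (ℝ × ℝ) → ℝ × T2) :=
      IsOpenQuotientMap.id.prodMap proj_openQuot
    rw [hq.isQuotientMap.continuous_iff]
    have : (fun q : ℝ × T2 => f q.1 q.2) ∘ (Prod.map id torusProj : ℝ × (ℝ × ℝ) → ℝ × T2)
        = fun q => torusProj (F q.1 q.2) := by
      funext q; simp [hf']
    rw [this]
    exact proj_cont.comp hc
  have hbf : ∀ t ∈ Icc (0 : ℝ) 1, Function.Bijective (f t) := by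
    intro t ht
    constructor
    · intro x y hxy
      obtain ⟨p, rfl⟩ := proj_surj x
      obtain ⟨p', rfl⟩ := proj_surj y
      rw [← hf', ← hf', proj_eq_iff] at hxy
      obtain ⟨m, n, h⟩ := hxy
      rw [← heq] at h
      rw [(hb t ht).1 h]; simp
    · intro y
      obtain ⟨p, rfl⟩ := proj_surj y
      obtain ⟨p', hp'⟩ := (hb t ht).2 p
      exact ⟨torusProj p', by rw [← hf', hp']⟩
  have h0f : f 0 = id := by
    funext x
    obtain ⟨p, rfl⟩ := proj_surj x
    rw [← hf', h0]; rfl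
  have hiso := iso_mk hcf hbf h0f
  have hh : IsHomeomorph (f 1) := by
    rw [isHomeomorph_iff_continuous_bijective]
    exact ⟨hcf.comp (by fun_prop : Continuous fun x : T2 => ((1 : ℝ), x)), hbf 1 (by simp)⟩
  refine ⟨hh.homeomorph, ?_, ?_, ?_⟩
  · exact hiso
  · exact hc.comp (by fun_prop : Continuous fun p : ℝ × ℝ => ((1 : ℝ), p))
  · exact fun p => hf' 1 p

end TT

end

section

open Set Filter Topology Metric MeasureTheory

namespace TT

/-- the covering `ℝ² → ℂ*` -/
noncomputable def ex (p : ℝ × ℝ) : ℂ := Complex.exp ⟨2 * Real.pi * p.1, 2 * Real.pi * p.2⟩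

/-- the multiplier -/
noncomputable def lam : ℝ := Real.exp (2 * Real.pi)

lemma lam_pos : 0 < lam := Real.exp_pos _
lemma lam_gt : 1 < lam := by
  unfold lam; rw [Real.one_lt_exp_iff]; exact Real.two_pi_pos
lemma lamc_ne : (lam : ℂ) ≠ 0 := by exact_mod_cast lam_pos.ne'

lemma toC_cont : Continuous fun p : ℝ × ℝ => (⟨2 * Real.pi * p.1, 2 * Real.pi * p.2⟩ : ℂ) := by
  have : (fun p : ℝ × ℝ => (⟨2 * Real.pi * p.1, 2 * Real.pi * p.2⟩ : ℂ)) =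
      fun p : ℝ × ℝ => ((2 * Real.pi * p.1 : ℝ) : ℂ) + ((2 * Real.pi * p.2 : ℝ) : ℂ) * Complex.I := by
    funext p; apply Complex.ext <;> simp
  rw [this]; fun_prop

lemma ex_cont : Continuous ex := Complex.continuous_exp.comp toC_cont

/-- `ℝ² ≃ ℂ` rescaled -/
noncomputable def toC : (ℝ × ℝ) ≃ₜ ℂ where
  toFun p := ⟨2 * Real.pi * p.1, 2 * Real.pi * p.2⟩
  invFun z := (z.re / (2 * Real.pi), z.im / (2 * Real.pi))
  left_inv p := by
    have := Real.two_pi_pos.ne'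
    ext <;> simp <;> field_simp
  right_inv z := by
    have := Real.two_pi_pos.ne'
    apply Complex.ext <;> simp <;> field_simp
  continuous_toFun := toC_cont
  continuous_invFun := by fun_prop

lemma ex_open : IsOpenMap ex := Complex.isOpenMap_exp.comp toC.isOpenMap

lemma ex_ne (p : ℝ × ℝ) : ex p ≠ 0 := Complex.exp_ne_zero _

lemma ex_norm (p : ℝ × ℝ) : ‖ex p‖ = Real.exp (2 * Real.pi * p.1) := by
  rw [ex, Complex.norm_exp]

lemma ex_surj {z : ℂ} (hz : z ≠ 0) : ∃ p, ex p = z := by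
  refine ⟨toC.symm (Complex.log z), ?_⟩
  change Complex.exp (toC (toC.symm (Complex.log z))) = z
  rw [Homeomorph.apply_symm_apply, Complex.exp_log hz]

lemma ex_eq_iff (p p' : ℝ × ℝ) : ex p = ex p' ↔ ∃ n : ℤ, p' = p + iv 0 n := by
  have hp := Real.pi_pos.ne'
  rw [eq_comm, ex, ex, Complex.exp_eq_exp_iff_exists_int]
  constructor
  · rintro ⟨n, hn⟩
    refine ⟨n, ?_⟩
    have h1 := congrArg Complex.re hn
    have h2 := congrArg Complex.im hn
    simp at h1 h2
    ext
    · simp [h1]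
    · simp only [Prod.snd_add, iv_snd]
      have : 2 * Real.pi * p'.2 = 2 * Real.pi * (p.2 + n) := by rw [h2]; ring
      exact mul_left_cancel₀ (by positivity) this
  · rintro ⟨n, rfl⟩
    refine ⟨n, ?_⟩
    apply Complex.ext <;> simp
    ring

lemma ex_add_iv (p : ℝ × ℝ) (m n : ℤ) : ex (p + iv m n) = (lam : ℂ) ^ m * ex p := by
  have h1 : ex (p + iv m n) = ex (p + iv m 0) := by
    rw [eq_comm, ex_eq_iff]; exact ⟨n, by rw [add_assoc, iv_add]; simp⟩
  rw [h1, ex, ex, lam, Complex.ofReal_exp, ← Complex.exp_int_mul, ← Complex.exp_add]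
  congr 1
  apply Complex.ext <;> simp
  ring

/-- the projection `ℂ* → T²` -/
noncomputable def P (z : ℂ) : T2 := torusProj (toC.symm (Complex.log z))

lemma P_ex (p : ℝ × ℝ) : P (ex p) = torusProj p := by
  have h : ex (toC.symm (Complex.log (ex p))) = ex p := by
    change Complex.exp (toC (toC.symm (Complex.log (ex p)))) = ex p
    rw [Homeomorph.apply_symm_apply, Complex.exp_log (ex_ne p)]
  obtain ⟨n, hn⟩ := (ex_eq_iff _ _).mp h.symm
  rw [P, hn]; simp

lemma continuousAt_of_ex {Y : Type*} [TopologicalSpace Y] {k : ℂ → Y} (h : Continuous (k ∘ ex)) {z : ℂ}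
    (hz : z ≠ 0) : ContinuousAt k z := by
  obtain ⟨p, rfl⟩ := ex_surj hz
  have h1 := h.continuousAt (x := p)
  have h2 : 𝓝 (ex p) ≤ map ex (𝓝 p) := ex_open.nhds_le p
  exact (tendsto_map'_iff.mpr h1).mono_left h2

lemma P_contAt {z : ℂ} (hz : z ≠ 0) : ContinuousAt P z := by
  apply continuousAt_of_ex _ hz
  have : P ∘ ex = torusProj := funext P_ex
  rw [this]; exact proj_cont

lemma P_open {V : Set ℂ} (hV : IsOpen V) (h0 : (0 : ℂ) ∉ V) : IsOpen (P '' V) := by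
  have : P '' V = torusProj '' (ex ⁻¹' V) := by
    ext x; constructor
    · rintro ⟨z, hz, rfl⟩
      obtain ⟨p, rfl⟩ := ex_surj (fun h => h0 (h ▸ hz))
      exact ⟨p, hz, (P_ex p).symm⟩
    · rintro ⟨p, hp, rfl⟩
      exact ⟨ex p, hp, P_ex p⟩
  rw [this]
  exact proj_openQuot.isOpenMap _ (hV.preimage ex_cont)

lemma P_eq_iff {z z' : ℂ} (hz : z ≠ 0) (hz' : z' ≠ 0) : P z = P z' ↔ ∃ m : ℤ, z' = (lam : ℂ) ^ m * z := by
  obtain ⟨p, rfl⟩ := ex_surj hz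
  obtain ⟨p', rfl⟩ := ex_surj hz'
  rw [P_ex, P_ex, proj_eq_iff]
  constructor
  · rintro ⟨m, n, rfl⟩; exact ⟨m, ex_add_iv _ _ _⟩
  · rintro ⟨m, hm⟩
    rw [← ex_add_iv p m 0, eq_comm, ex_eq_iff] at hm
    obtain ⟨n, hn⟩ := hm
    exact ⟨m, 0 + n, by rw [hn, add_assoc, iv_add]; simp⟩

/-- The displacement of an equivariant map is bounded. -/
lemma disp_bdd {F : ℝ × ℝ → ℝ × ℝ} (hF : Continuous F) (hc : Comm F) :
    ∃ C, ∀ p, ‖F p - p‖ ≤ C := by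
  have hK : IsCompact (Icc (0 : ℝ) 1 ×ˢ Icc (0 : ℝ) 1) := isCompact_Icc.prod isCompact_Icc
  obtain ⟨C, hC⟩ := (hK.image (by fun_prop : Continuous fun p => F p - p)).isBounded.exists_norm_le
  refine ⟨C, fun p => ?_⟩
  have h := hc (Int.fract p.1, Int.fract p.2) ⌊p.1⌋ ⌊p.2⌋
  have h1 : ((Int.fract p.1, Int.fract p.2) + iv ⌊p.1⌋ ⌊p.2⌋ : ℝ × ℝ) = p := by
    ext <;> simp
  have h2 : F p - p = F (Int.fract p.1, Int.fract p.2) - (Int.fract p.1, Int.fract p.2) := by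
    nth_rewrite 2 [← h1]
    rw [h1] at h
    rw [h]; abel
  rw [h2]
  apply hC
  refine ⟨(Int.fract p.1, Int.fract p.2), ⟨⟨Int.fract_nonneg _, (Int.fract_lt_one _).le⟩,
    Int.fract_nonneg _, (Int.fract_lt_one _).le⟩, rfl⟩

/-- the induced map on `ℂ` -/
noncomputable def ind (F : ℝ × ℝ → ℝ × ℝ) (z : ℂ) : ℂ :=
  if z = 0 then 0 else ex (F (toC.symm (Complex.log z)))

lemma ind_zero (F : ℝ × ℝ → ℝ × ℝ) : ind F 0 = 0 := by simp [ind]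

lemma ind_ex {F : ℝ × ℝ → ℝ × ℝ} (hc : Comm F) (p : ℝ × ℝ) : ind F (ex p) = ex (F p) := by
  rw [ind, if_neg (ex_ne p)]
  have h : ex (toC.symm (Complex.log (ex p))) = ex p := by
    change Complex.exp (toC (toC.symm (Complex.log (ex p)))) = ex p
    rw [Homeomorph.apply_symm_apply, Complex.exp_log (ex_ne p)]
  obtain ⟨n, hn⟩ := (ex_eq_iff _ _).mp h.symm
  rw [hn, hc, ex_add_iv]; simp

lemma ind_cont {F : ℝ × ℝ → ℝ × ℝ} (hF : Continuous F) (hc : Comm F) : Continuous (ind F) := by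
  rw [continuous_iff_continuousAt]
  intro z
  by_cases hz : z = 0
  · subst hz
    obtain ⟨C, hC⟩ := disp_bdd hF hc
    have hb : ∀ z, ‖ind F z‖ ≤ Real.exp (2 * Real.pi * C) * ‖z‖ := by
      intro z
      by_cases h0 : z = 0
      · simp [h0, ind_zero]
      · obtain ⟨p, rfl⟩ := ex_surj h0
        rw [ind_ex hc, ex_norm, ex_norm, ← Real.exp_add, Real.exp_le_exp]
        have h1 : (F p).1 - p.1 ≤ C := (le_abs_self _).trans ((norm_fst_le (F p - p)).trans (hC p))
        have := Real.two_pi_pos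
        nlinarith
    rw [ContinuousAt, ind_zero]
    apply squeeze_zero_norm hb
    have : Tendsto (fun z : ℂ => Real.exp (2 * Real.pi * C) * ‖z‖) (𝓝 0) (𝓝 (Real.exp (2 * Real.pi * C) * ‖(0 : ℂ)‖)) :=
      (by fun_prop : Continuous fun z : ℂ => Real.exp (2 * Real.pi * C) * ‖z‖).tendsto 0
    simpa using this
  · apply continuousAt_of_ex _ hz
    have : ind F ∘ ex = ex ∘ F := funext (ind_ex hc)
    rw [this]; exact ex_cont.comp hF

/-- the induced homeomorphism of `ℂ` -/
lemma exists_Phi {f : T2 ≃ₜ T2} (hf : Triv f) : ∃ Φ : ℂ ≃ₜ ℂ, Φ 0 = 0 ∧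
    (∀ z : ℂ, Φ (lam * z) = lam * Φ z) ∧ ∀ z ≠ 0, P (Φ z) = f (P z) := by
  obtain ⟨F, hF, hc⟩ := hf
  obtain ⟨E, rfl, hE, hEc⟩ := lift_homeo hF hc
  have inv1 : ∀ (A B : ℝ × ℝ → ℝ × ℝ), Comm A → Comm B → (∀ p, A (B p) = p) → ∀ z, ind A (ind B z) = z := by
    intro A B hA hB hAB z
    by_cases h0 : z = 0
    · simp [h0, ind_zero]
    · obtain ⟨p, rfl⟩ := ex_surj h0
      rw [ind_ex hB, ind_ex hA, hAB]
  refine ⟨⟨⟨ind E, ind E.symm, inv1 _ _ hEc hc (by simp), inv1 _ _ hc hEc (by simp)⟩,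
    ind_cont E.continuous hc, ind_cont E.symm.continuous hEc⟩, ind_zero _, ?_, ?_⟩
  · intro z
    change ind E _ = _ * ind E _
    by_cases h0 : z = 0
    · simp [h0, ind_zero]
    · obtain ⟨p, rfl⟩ := ex_surj h0
      have h1 : (lam : ℂ) * ex p = ex (p + iv 1 0) := by rw [ex_add_iv]; simp
      rw [h1, ind_ex hc, ind_ex hc, hc, ex_add_iv]; simp
  · intro z h0
    change P (ind E _) = _
    obtain ⟨p, rfl⟩ := ex_surj h0
    rw [ind_ex hc, P_ex, P_ex, hF.2]

/-- the standard essential circle -/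
def ell : Set T2 := {x | x.1 = 0}

lemma ell_eq : ell = P '' sphere 0 1 := by
  ext x; constructor
  · intro hx
    obtain ⟨⟨a, b⟩, rfl⟩ := proj_surj x
    have h : torusProj (a, b) = torusProj (0, b) := Prod.ext hx rfl
    refine ⟨ex (0, b), ?_, by rw [P_ex, h]⟩
    rw [mem_sphere_zero_iff_norm, ex_norm]; simp
  · rintro ⟨z, hz, rfl⟩
    rw [mem_sphere_zero_iff_norm] at hz
    obtain ⟨p, rfl⟩ := ex_surj (z := z) (by rintro rfl; simp at hz)
    rw [ex_norm, Real.exp_eq_one_iff] at hz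
    rw [P_ex]
    have := Real.two_pi_pos.ne'
    have h : p.1 = 0 := by simpa using hz
    change ((p.1 : ℝ) : AddCircle (1 : ℝ)) = 0
    rw [h]; rfl

lemma ell_eq' : ell = torusProj '' {p | p.1 = 0} := by
  ext x; constructor
  · intro hx
    obtain ⟨⟨a, b⟩, rfl⟩ := proj_surj x
    exact ⟨(0, b), rfl, Prod.ext (Eq.symm hx) rfl⟩
  · rintro ⟨p, hp, rfl⟩
    change ((p.1 : ℝ) : AddCircle (1 : ℝ)) = 0
    have h : p.1 = 0 := hp
    rw [h]; rfl

end TT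

end

section

open Set Filter Topology Metric MeasureTheory

namespace TT

/-- conical extension of a self-map of the closed disc -/
noncomputable def cone (G : ℂ → ℂ) (z : ℂ) : ℂ := (max 1 ‖z‖ : ℝ) • G ((max 1 ‖z‖ : ℝ)⁻¹ • z)

lemma cone_of_le (G : ℂ → ℂ) {z : ℂ} (hz : ‖z‖ ≤ 1) : cone G z = G z := by
  simp [cone, max_eq_left hz]

lemma cone_mem (z : ℂ) : (max 1 ‖z‖ : ℝ)⁻¹ • z ∈ closedBall (0 : ℂ) 1 := by
  have h : 0 < max 1 ‖z‖ := by positivity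
  rw [mem_closedBall_zero_iff, norm_smul, norm_inv, Real.norm_of_nonneg h.le, inv_mul_le_iff₀ h, mul_one]
  exact le_max_right _ _

lemma cone_cont {G : ℂ → ℂ} (hG : ContinuousOn G (closedBall 0 1)) : Continuous (cone G) := by
  have h1 : Continuous fun z : ℂ => (max 1 ‖z‖ : ℝ)⁻¹ • z := by
    have : ∀ z : ℂ, max 1 ‖z‖ ≠ 0 := fun z => by positivity
    fun_prop (disch := assumption)
  have h2 : Continuous fun z : ℂ => G ((max 1 ‖z‖ : ℝ)⁻¹ • z) :=
    hG.comp_continuous h1 cone_mem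
  exact (by fun_prop : Continuous fun z : ℂ => max 1 ‖z‖).smul h2

lemma cone_inv {G γ : ℂ → ℂ} (hm : MapsTo G (closedBall 0 1) (closedBall 0 1))
    (h1 : ∀ z, ‖z‖ = 1 → ‖G z‖ = 1) (h : ∀ z ∈ closedBall (0 : ℂ) 1, γ (G z) = z) (z : ℂ) :
    cone γ (cone G z) = z := by
  rcases le_or_gt ‖z‖ 1 with hz | hz
  · have hz' : z ∈ closedBall (0 : ℂ) 1 := by simpa using hz
    rw [cone_of_le G hz, cone_of_le γ (by simpa using hm hz'), h z hz']
  · have hr : 0 < ‖z‖ := by linarith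
    have hm1 : max 1 ‖z‖ = ‖z‖ := max_eq_right hz.le
    have hn : ‖(‖z‖⁻¹ • z : ℂ)‖ = 1 := by
      rw [norm_smul, norm_inv, norm_norm, inv_mul_cancel₀ hr.ne']
    have hg : ‖cone G z‖ = ‖z‖ := by
      rw [cone, hm1, norm_smul, norm_norm, h1 _ hn, mul_one]
    rw [cone, hg, hm1, cone, hm1, inv_smul_smul₀ hr.ne', h _ (by rw [mem_closedBall_zero_iff, hn]),
      smul_inv_smul₀ hr.ne']

lemma exists_E (Φ : ℂ ≃ₜ ℂ) (h0 : Φ 0 = 0) (hl : ∀ z : ℂ, Φ (lam * z) = lam * Φ z) :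
    ∃ (E : ℂ ≃ₜ ℂ) (κ : ℝ), 0 < κ ∧ κ < 1 ∧ E 0 = 0 ∧ E '' sphere 0 1 = Φ '' sphere 0 1 ∧
      DifferentiableOn ℂ E (ball 0 1) ∧ deriv E 0 ≠ 0 ∧
      ∀ z, ‖z‖ ≤ 1 → ‖E.symm ((lam : ℂ)⁻¹ * E z)‖ ≤ κ * ‖z‖ := by
  have hl' : ∀ z : ℂ, (lam : ℂ)⁻¹ * Φ z = Φ ((lam : ℂ)⁻¹ * z) := by
    intro z
    have := hl ((lam : ℂ)⁻¹ * z)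
    rw [mul_inv_cancel_left₀ lamc_ne] at this
    rw [this, inv_mul_cancel_left₀ lamc_ne]
  have hUo : IsOpen (Φ '' ball 0 1) := Φ.isOpenMap _ isOpen_ball
  have hUs : IsSimplyConnected (Φ '' ball 0 1) := by
    have hb : IsSimplyConnected (ball (0 : ℂ) 1) :=
      have := (convex_ball (0 : ℂ) 1).contractibleSpace ⟨0, by simp⟩
      inferInstanceAs (SimplyConnectedSpace (ball (0 : ℂ) 1))
    exact Φ.isSimplyConnected_image.mpr hb
  have hUb : Bornology.IsBounded (Φ '' ball 0 1) :=
    ((isCompact_closedBall (0 : ℂ) 1).image Φ.continuous).isBounded.subset (image_mono ball_subset_closedBall)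
  obtain ⟨S, R, hS, hSm, hS0, hR0, hR, hRm, hRS, hSR, hRd⟩ :=
    RMT.riemann_mapping hUo hUs ⟨0, by simp, h0⟩ hUb
  have hRsymm : ∀ z ∈ ball (0 : ℂ) 1, Φ.symm (R z) ∈ ball (0 : ℂ) 1 := by
    intro z hz
    obtain ⟨w, hw, hw'⟩ := hRm hz
    rw [← hw']; simpa using hw
  have D : Car.Data Φ (fun z => Φ.symm (R z)) (fun z => S (Φ z)) :=
    { gm := hRsymm
      km := fun z hz => hSm ⟨z, hz, rfl⟩
      gc := Φ.symm.continuous.comp_continuousOn hR.continuousOn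
      kc := hS.continuousOn.comp Φ.continuous.continuousOn (fun z hz => ⟨z, hz, rfl⟩)
      gk := fun z hz => by rw [hRS _ ⟨z, hz, rfl⟩]; simp
      kg := fun z hz => by simp [hSR z hz]
      g0 := by rw [hR0, Φ.symm_apply_eq, h0]
      hol := by simpa using hR }
  set G := Car.ext (fun z => Φ.symm (R z)) with hG
  set γ := Function.invFunOn G (closedBall 0 1) with hγ
  have hγG : ∀ z ∈ closedBall (0 : ℂ) 1, γ (G z) = z := fun z hz => D.inj.leftInvOn_invFunOn hz
  have hGγ : ∀ z ∈ closedBall (0 : ℂ) 1, G (γ z) = z := fun z hz =>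
    Function.invFunOn_eq (D.ext_surj hz)
  have hγm : MapsTo γ (closedBall 0 1) (closedBall 0 1) := fun z hz =>
    Function.invFunOn_mem (D.ext_surj hz)
  have hγ1 : ∀ z, ‖z‖ = 1 → ‖γ z‖ = 1 := by
    intro z hz
    have hz' : z ∈ closedBall (0 : ℂ) 1 := by simp [hz]
    by_contra hne
    have h1 : γ z ∈ ball (0 : ℂ) 1 := by
      rw [mem_ball_zero_iff]
      exact lt_of_le_of_ne (by simpa using hγm hz') hne
    have h2 := D.gm h1
    have h3 := D.ext_eq h1
    rw [← hG, hGγ z hz'] at h3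
    rw [← h3, mem_ball_zero_iff, hz] at h2
    exact lt_irrefl _ h2
  have hγc : ContinuousOn γ (closedBall 0 1) := by
    rw [continuousOn_iff_isClosed]
    intro t ht
    refine ⟨G '' (t ∩ closedBall 0 1), ?_, ?_⟩
    · exact (((isCompact_closedBall (0 : ℂ) 1).inter_left ht).image_of_continuousOn
        (D.ext_cont.mono inter_subset_right)).isClosed
    · ext z; constructor
      · rintro ⟨hz, hz'⟩
        exact ⟨⟨γ z, ⟨hz, hγm hz'⟩, hGγ z hz'⟩, hz'⟩
      · rintro ⟨⟨w, ⟨hw, hw'⟩, rfl⟩, hz'⟩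
        refine ⟨?_, hz'⟩
        change γ (G w) ∈ t
        rwa [hγG w hw']
  have hG1 : ∀ z, ‖z‖ = 1 → ‖G z‖ = 1 := fun z hz => D.ext_sphere hz
  let B : ℂ ≃ₜ ℂ :=
    { toFun := cone G
      invFun := cone γ
      left_inv := cone_inv D.ext_maps hG1 hγG
      right_inv := cone_inv hγm hγ1 hGγ
      continuous_toFun := cone_cont D.ext_cont
      continuous_invFun := cone_cont hγc }
  have hB : ∀ z, B z = cone G z := fun _ => rfl
  have hB' : ∀ z, B.symm z = cone γ z := fun _ => rfl
  let E := B.trans Φ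
  have hE : ∀ z, E z = Φ (B z) := fun _ => rfl
  have hER : ∀ z ∈ ball (0 : ℂ) 1, E z = R z := by
    intro z hz
    rw [hE, hB, cone_of_le G (by simpa using (mem_ball_zero_iff.mp hz).le), hG, D.ext_eq hz]; simp
  have hBs : ∀ z, ‖z‖ = 1 → ‖B z‖ = 1 := fun z hz => by rw [hB, cone_of_le G hz.le, hG1 z hz]
  have hBs' : ∀ z, ‖z‖ = 1 → ‖B.symm z‖ = 1 := fun z hz => by rw [hB', cone_of_le γ hz.le, hγ1 z hz]
  have hEb : ∀ w ∈ ball (0 : ℂ) 1, E.symm (Φ w) = S (Φ w) := by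
    intro w hw
    rw [E.symm_apply_eq, hER _ (hSm ⟨w, hw, rfl⟩), hRS _ ⟨w, hw, rfl⟩]
  have hlam : ‖(lam : ℂ)⁻¹‖ < 1 := by
    rw [norm_inv, Complex.norm_real, Real.norm_of_nonneg lam_pos.le]
    exact inv_lt_one_of_one_lt₀ lam_gt
  have hK : IsClosed ((fun z => E.symm (Φ z)) '' closedBall 0 ‖(lam : ℂ)⁻¹‖) :=
    ((isCompact_closedBall _ _).image (E.symm.continuous.comp Φ.continuous)).isClosed
  have hKs : ((fun z => E.symm (Φ z)) '' closedBall 0 ‖(lam : ℂ)⁻¹‖) ⊆ ball 0 1 := by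
    rintro _ ⟨w, hw, rfl⟩
    have hw' : w ∈ ball (0 : ℂ) 1 := by
      rw [mem_ball_zero_iff]; exact (mem_closedBall_zero_iff.mp hw).trans_lt hlam
    simp only [hEb w hw']
    exact hSm ⟨w, hw', rfl⟩
  obtain ⟨κ, hκ1, hκ⟩ := _root_.exists_lt_subset_ball hK hKs
  have hE0 : E 0 = 0 := by rw [hER 0 (by simp), hR0]
  have hκ0 : 0 < κ := by
    have := hκ ⟨0, by simp, rfl⟩
    exact pos_of_mem_ball this
  have hσ : ∀ z ∈ ball (0 : ℂ) 1, ∃ w ∈ closedBall (0 : ℂ) ‖(lam : ℂ)⁻¹‖, (lam : ℂ)⁻¹ * E z = Φ w := by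
    intro z hz
    refine ⟨(lam : ℂ)⁻¹ * Φ.symm (R z), ?_, ?_⟩
    · rw [mem_closedBall_zero_iff, norm_mul]
      have := mem_ball_zero_iff.mp (hRsymm z hz)
      exact mul_le_of_le_one_right (norm_nonneg _) this.le
    · rw [← hl', hER z hz]; simp
  have hcl : ∀ w ∈ closedBall (0 : ℂ) ‖(lam : ℂ)⁻¹‖, w ∈ ball (0 : ℂ) 1 := fun w hw => by
    rw [mem_ball_zero_iff]; exact (mem_closedBall_zero_iff.mp hw).trans_lt hlam
  refine ⟨E, κ, hκ0, hκ1, hE0, ?_, hR.congr hER, ?_, ?_⟩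
  · ext x; constructor
    · rintro ⟨z, hz, rfl⟩
      exact ⟨B z, by simpa using hBs z (by simpa using hz), rfl⟩
    · rintro ⟨z, hz, rfl⟩
      exact ⟨B.symm z, by simpa using hBs' z (by simpa using hz), by rw [hE]; simp⟩
  · have : E =ᶠ[𝓝 0] R := by
      filter_upwards [ball_mem_nhds (0 : ℂ) one_pos] with z hz using hER z hz
    rw [this.deriv_eq]; exact hRd
  · have hball : ∀ z ∈ ball (0 : ℂ) 1, ‖E.symm ((lam : ℂ)⁻¹ * E z)‖ ≤ κ * ‖z‖ := by
      intro z hz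
      have hd : DifferentiableOn ℂ (fun z => E.symm ((lam : ℂ)⁻¹ * E z)) (ball 0 1) := by
        have : DifferentiableOn ℂ (fun z => S ((lam : ℂ)⁻¹ * R z)) (ball 0 1) := by
          refine hS.comp (hR.const_mul _) ?_
          intro z hz
          obtain ⟨w, hw, hw'⟩ := hσ z hz
          rw [hER z hz] at hw'
          simp only [hw']
          exact ⟨w, hcl w hw, rfl⟩
        refine this.congr fun z hz => ?_
        obtain ⟨w, hw, hw'⟩ := hσ z hz
        rw [← hER z hz, hw', hEb w (hcl w hw)]
      have hz0 : E.symm ((lam : ℂ)⁻¹ * E 0) = 0 := by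
        rw [hE0, mul_zero, E.symm_apply_eq, hE0]
      have hm : MapsTo (fun z => E.symm ((lam : ℂ)⁻¹ * E z)) (ball 0 1)
          (closedBall (E.symm ((lam : ℂ)⁻¹ * E 0)) κ) := by
        intro z hz
        obtain ⟨w, hw, hw'⟩ := hσ z hz
        rw [hz0]
        simp only [hw']
        exact ball_subset_closedBall (hκ ⟨w, hw, rfl⟩)
      have := Complex.dist_le_div_mul_dist_of_mapsTo_ball hd hm hz
      rw [hz0] at this
      simpa using this
    intro z hz
    have hcl : IsClosed {z : ℂ | ‖E.symm ((lam : ℂ)⁻¹ * E z)‖ ≤ κ * ‖z‖} := by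
      have h1 := E.continuous
      have h2 := E.symm.continuous
      apply isClosed_le <;> fun_prop
    have h3 : closure (ball (0 : ℂ) 1) ⊆ {z : ℂ | ‖E.symm ((lam : ℂ)⁻¹ * E z)‖ ≤ κ * ‖z‖} :=
      closure_minimal hball hcl
    rw [closure_ball _ one_ne_zero] at h3
    exact h3 (by simpa using hz)

end TT

end

section

open Set Filter Topology Metric MeasureTheory

namespace TT

lemma ext_iso {e : ℂ → T2} {U K : Set ℂ} (hU : IsOpen U) (hec : ContinuousOn e U)
    (heo : ∀ V ⊆ U, IsOpen V → IsOpen (e '' V)) (hei : InjOn e U) (hK : IsCompact K) (hKU : K ⊆ U)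
    {ρ : ℝ → ℂ → ℂ} (hρc : Continuous fun q : ℝ × ℂ => ρ q.1 q.2)
    (hρb : ∀ t, Function.Bijective (ρ t)) (hρK : ∀ t z, z ∉ K → ρ t z = z) (hρ0 : ∀ z, ρ 0 z = z) :
    ∃ h ∈ Iso, ∀ z ∈ U, h (e z) = e (ρ 1 z) := by
  have hρU : ∀ t z, z ∈ U → ρ t z ∈ U := by
    intro t z hz
    by_contra hn
    have h1 : ρ t (ρ t z) = ρ t z := hρK t _ (fun h => hn (hKU h))
    have h2 := (hρb t).1 h1
    rw [h2] at hn; exact hn hz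
  have hρU' : ∀ t z, z ∈ U → ∃ w ∈ U, ρ t w = z := by
    intro t z hz
    obtain ⟨w, hw⟩ := (hρb t).2 z
    by_cases hwU : w ∈ U
    · exact ⟨w, hwU, hw⟩
    · rw [hρK t w (fun h => hwU (hKU h))] at hw
      exact absurd (hw ▸ hz) hwU
  classical
  have hex : ∀ (t : ℝ) (x : T2), ∃ y, (∀ z ∈ U, e z = x → y = e (ρ t z)) ∧ (x ∉ e '' U → y = x) := by
    intro t x
    by_cases hx : x ∈ e '' U
    · obtain ⟨z, hz, rfl⟩ := hx
      refine ⟨e (ρ t z), fun z' hz' h => by rw [hei hz' hz h], fun h => absurd ⟨z, hz, rfl⟩ h⟩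
    · exact ⟨x, fun z hz h => absurd ⟨z, hz, h⟩ hx, fun _ => rfl⟩
  choose F hF1 hF2 using hex
  have hFe : ∀ t, ∀ z ∈ U, F t (e z) = e (ρ t z) := fun t z hz => hF1 t _ z hz rfl
  have hFK : ∀ t x, x ∉ e '' K → F t x = x := by
    intro t x hx
    by_cases hxU : x ∈ e '' U
    · obtain ⟨z, hz, rfl⟩ := hxU
      rw [hFe t z hz, hρK t z (fun h => hx ⟨z, h, rfl⟩)]
    · exact hF2 t x hxU
  have hFc : Continuous fun q : ℝ × T2 => F q.1 q.2 := by
    rw [continuous_iff_continuousAt]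
    rintro ⟨t, x⟩
    by_cases hx : x ∈ e '' K
    · obtain ⟨z, hz, rfl⟩ := hx
      have hzU := hKU hz
      have h1 : 𝓝 (t, e z) ≤ map (Prod.map id e : ℝ × ℂ → ℝ × T2) (𝓝 (t, z)) := by
        have h5 : 𝓝 (t, z) = 𝓝 t ×ˢ 𝓝 z := nhds_prod_eq
        have h6 : 𝓝 (t, e z) = 𝓝 t ×ˢ 𝓝 (e z) := nhds_prod_eq
        have h7 := prod_map_map_eq (f₁ := 𝓝 t) (f₂ := 𝓝 z) (m₁ := id) (m₂ := e)
        rw [h5, h6]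
        refine le_trans ?_ h7.le
        rw [map_id]
        refine Filter.prod_mono le_rfl ?_
        intro s hs
        rw [mem_map] at hs
        obtain ⟨V, hV, hVo, hzV⟩ := _root_.mem_nhds_iff.mp (inter_mem hs (hU.mem_nhds hzU))
        refine mem_of_superset ((heo V (hV.trans inter_subset_right) hVo).mem_nhds ⟨z, hzV, rfl⟩) ?_
        rintro _ ⟨w, hw, rfl⟩
        exact (hV hw).1
      refine Tendsto.mono_left ?_ h1
      rw [tendsto_map'_iff]
      have h2 : ContinuousAt (fun q : ℝ × ℂ => e (ρ q.1 q.2)) (t, z) :=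
        ContinuousAt.comp (f := fun q : ℝ × ℂ => ρ q.1 q.2) (hec.continuousAt (hU.mem_nhds (hρU t z hzU))) hρc.continuousAt
      have h3 : (fun q : ℝ × ℂ => e (ρ q.1 q.2)) =ᶠ[𝓝 (t, z)]
          (fun q : ℝ × T2 => F q.1 q.2) ∘ (Prod.map id e) := by
        have : ∀ᶠ q : ℝ × ℂ in 𝓝 (t, z), q.2 ∈ U := continuousAt_snd (hU.mem_nhds hzU)
        filter_upwards [this] with q hq
        simp [hFe q.1 q.2 hq]
      have h4 := h2.tendsto.congr' h3
      simpa [hFe t z hzU] using h4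
    · have hcl : IsClosed (e '' K) := (hK.image_of_continuousOn (hec.mono hKU)).isClosed
      have : ∀ᶠ q : ℝ × T2 in 𝓝 (t, x), q.2 ∈ (e '' K)ᶜ := continuousAt_snd (hcl.isOpen_compl.mem_nhds hx)
      refine ContinuousAt.congr (f := fun q : ℝ × T2 => q.2) continuousAt_snd ?_
      filter_upwards [this] with q hq
      rw [hFK _ _ hq]
  have hFb : ∀ t, Function.Bijective (F t) := by
    intro t
    have hin : ∀ x, x ∈ e '' U ↔ F t x ∈ e '' U := by
      intro x
      by_cases hx : x ∈ e '' U
      · simp only [hx, true_iff]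
        obtain ⟨z, hz, rfl⟩ := hx
        rw [hFe t z hz]; exact ⟨_, hρU t z hz, rfl⟩
      · simp [hF2 t x hx]
    constructor
    · intro x y hxy
      by_cases hx : x ∈ e '' U
      · have hy : y ∈ e '' U := by rw [hin, ← hxy, ← hin]; exact hx
        obtain ⟨z, hz, rfl⟩ := hx
        obtain ⟨w, hw, rfl⟩ := hy
        rw [hFe t z hz, hFe t w hw] at hxy
        rw [(hρb t).1 (hei (hρU t z hz) (hρU t w hw) hxy)]
      · have hy : y ∉ e '' U := by rw [hin, ← hxy, ← hin]; exact hx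
        rwa [hF2 t x hx, hF2 t y hy] at hxy
    · intro y
      by_cases hy : y ∈ e '' U
      · obtain ⟨z, hz, rfl⟩ := hy
        obtain ⟨w, hw, rfl⟩ := hρU' t z hz
        exact ⟨e w, hFe t w hw⟩
      · exact ⟨y, hF2 t y hy⟩
  have hF0 : F 0 = id := by
    funext x
    by_cases hx : x ∈ e '' U
    · obtain ⟨z, hz, rfl⟩ := hx
      rw [hFe 0 z hz, hρ0]; rfl
    · rw [hF2 0 x hx]; rfl
  have hh : IsHomeomorph (F 1) := by
    rw [isHomeomorph_iff_continuous_bijective]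
    exact ⟨hFc.comp (by fun_prop : Continuous fun x : T2 => ((1 : ℝ), x)), hFb 1⟩
  exact ⟨hh.homeomorph, iso_mk hFc (fun t _ => hFb t) hF0, fun z hz => hFe 1 z hz⟩

lemma radial_norm {k : ℝ → ℝ} (hk : ∀ x, 0 ≤ x → 0 < k x) (z : ℂ) :
    ‖(k ‖z‖ : ℝ) • z‖ = k ‖z‖ * ‖z‖ := by
  rw [norm_smul, Real.norm_of_nonneg (hk _ (norm_nonneg _)).le]

lemma radial_bij {k : ℝ → ℝ} (hk : ∀ x, 0 ≤ x → 0 < k x)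
    (hm : StrictMonoOn (fun x => k x * x) (Ici 0)) (hc : Continuous k)
    {b : ℝ} (hb : ∀ x, b ≤ x → k x = 1) : Function.Bijective fun z : ℂ => (k ‖z‖ : ℝ) • z := by
  constructor
  · intro z w h
    simp only at h
    have h1 := congrArg norm h
    rw [radial_norm hk, radial_norm hk] at h1
    have h2 := hm.injOn (norm_nonneg z) (norm_nonneg w) h1
    rw [h2] at h
    exact smul_right_injective ℂ (hk _ (norm_nonneg w)).ne' h
  · intro w
    have h1 : ‖w‖ ∈ (fun x => k x * x) '' Icc 0 (max b ‖w‖) := by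
      apply intermediate_value_Icc (by positivity) (by fun_prop)
      simp [hb _ (le_max_left _ _)]
    obtain ⟨x, hx, hxw⟩ := h1
    simp only at hxw
    by_cases hw : w = 0
    · exact ⟨0, by simp [hw]⟩
    · have hw' : ‖w‖ ≠ 0 := by simpa using hw
      refine ⟨(x / ‖w‖ : ℝ) • w, ?_⟩
      have h2 : ‖(x / ‖w‖ : ℝ) • w‖ = x := by
        rw [norm_smul, Real.norm_of_nonneg (div_nonneg hx.1 (norm_nonneg _))]; field_simp
      simp only [h2]
      rw [smul_smul, mul_div_assoc', hxw, div_self hw', one_smul]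

/-- the bump used for the radial push -/
noncomputable def bmp (a s b x : ℝ) : ℝ := max 0 (min ((x - a) / (s - a)) ((b - x) / (b - s)))

lemma radial_push {a s' s b : ℝ} (ha : 0 < a) (has : a < s') (hs : s' ≤ s) (hb : s < b) :
    ∃ ρ : ℝ → ℂ → ℂ, (Continuous fun q : ℝ × ℂ => ρ q.1 q.2) ∧ (∀ t, Function.Bijective (ρ t)) ∧
      (∀ t z, (‖z‖ ≤ a ∨ b ≤ ‖z‖) → ρ t z = z) ∧ (∀ z, ρ 0 z = z) ∧ ρ 1 '' sphere 0 s = sphere 0 s' := by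
  have hsa : 0 < s - a := by linarith
  have hbs : 0 < b - s := by linarith
  have hφ0 : ∀ x, 0 ≤ bmp a s b x := fun x => le_max_left _ _
  have hφa : ∀ x, x ≤ a → bmp a s b x = 0 := fun x hx => by
    apply max_eq_left
    exact (min_le_left _ _).trans (div_nonpos_of_nonpos_of_nonneg (by linarith) hsa.le)
  have hφb : ∀ x, b ≤ x → bmp a s b x = 0 := fun x hx => by
    apply max_eq_left
    exact (min_le_right _ _).trans (div_nonpos_of_nonpos_of_nonneg (by linarith) hbs.le)
  have hφs : bmp a s b s = 1 := by simp [bmp, div_self hsa.ne', div_self hbs.ne']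
  have hφl : ∀ x y, x ≤ y → bmp a s b y ≤ bmp a s b x + (y - x) / (s - a) := by
    intro x y hxy
    have hd : 0 ≤ (y - x) / (s - a) := div_nonneg (by linarith) hsa.le
    apply max_le
    · exact add_nonneg (hφ0 x) hd
    · have h1 : min ((x - a) / (s - a)) ((b - x) / (b - s)) ≤ bmp a s b x := le_max_right _ _
      refine le_trans ?_ (add_le_add_left h1 _)
      rw [← min_add_add_right]
      apply min_le_min
      · rw [← add_div]; apply le_of_eq; congr 1; ring
      · have : (b - y) / (b - s) ≤ (b - x) / (b - s) := by gcongr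
        linarith
  have hφc : Continuous (bmp a s b) := by unfold bmp; fun_prop
  set c := s - s' with hc
  have hc0 : 0 ≤ c := by linarith
  have hcs : c < s - a := by linarith
  set k : ℝ → ℝ → ℝ := fun t x => 1 - clamp t * c * bmp a s b x / max x a with hk
  have hkx : ∀ t x, k t x * x = x - clamp t * c * bmp a s b x := by
    intro t x
    rcases le_or_gt x a with h | h
    · simp [hk, hφa x h]
    · have : x ≠ 0 := by linarith
      simp only [hk, max_eq_left h.le]
      field_simp
  have hkey : ∀ t x y, x < y → clamp t * c * bmp a s b y < clamp t * c * bmp a s b x + (y - x) := by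
    intro t x y hxy
    obtain ⟨h0, h1⟩ := clamp_mem t
    have h2 : clamp t * c < s - a := lt_of_le_of_lt (mul_le_of_le_one_left hc0 h1) hcs
    have h3 : 0 ≤ clamp t * c := mul_nonneg h0 hc0
    have h4 := mul_le_mul_of_nonneg_left (hφl x y hxy.le) h3
    have h5 : clamp t * c * ((y - x) / (s - a)) < y - x := by
      rw [← mul_div_assoc, div_lt_iff₀ hsa, mul_comm]
      exact mul_lt_mul_of_pos_left h2 (by linarith)
    rw [mul_add] at h4
    linarith
  have hkpos : ∀ t x, 0 ≤ x → 0 < k t x := by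
    intro t x hx
    have hm : 0 < max x a := lt_max_of_lt_right ha
    simp only [hk, sub_pos]
    rw [div_lt_one hm]
    rcases le_or_gt x a with h | h
    · rw [hφa x h, mul_zero]; exact hm
    · have := hkey t 0 x (by linarith)
      rw [hφa 0 ha.le] at this
      rw [max_eq_left h.le]; linarith
  have hmono : ∀ t, StrictMonoOn (fun x => k t x * x) (Ici 0) := by
    intro t x _ y _ hxy
    simp only [hkx]
    have := hkey t x y hxy
    linarith
  have hcc := clamp_cont
  have hkc : Continuous fun q : ℝ × ℝ => k q.1 q.2 := by
    have : ∀ q : ℝ × ℝ, max q.2 a ≠ 0 := fun q => (lt_max_of_lt_right ha).ne'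
    simp only [hk]
    fun_prop (disch := assumption)
  have hbij : ∀ t, Function.Bijective fun z : ℂ => (k t ‖z‖ : ℝ) • z := fun t =>
    radial_bij (hkpos t) (hmono t) (hkc.comp (by fun_prop : Continuous fun x : ℝ => (t, x))) (b := b)
      (fun x hx => by simp [hk, hφb x hx])
  have h1s : k 1 s * s = s' := by rw [hkx, hφs, clamp_one]; linarith
  refine ⟨fun t z => (k t ‖z‖ : ℝ) • z, ?_, hbij, ?_, ?_, ?_⟩
  · exact (hkc.comp (by fun_prop : Continuous fun q : ℝ × ℂ => (q.1, ‖q.2‖))).smul continuous_snd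
  · rintro t z (h | h)
    · simp [hk, hφa _ h]
    · simp [hk, hφb _ h]
  · intro z; simp [hk]
  · ext w; constructor
    · rintro ⟨z, hz, rfl⟩
      rw [mem_sphere_zero_iff_norm] at hz ⊢
      rw [radial_norm (hkpos 1), hz, h1s]
    · intro hw
      rw [mem_sphere_zero_iff_norm] at hw
      obtain ⟨z, hz⟩ := (hbij 1).2 w
      refine ⟨z, ?_, hz⟩
      simp only at hz
      rw [← hz, radial_norm (hkpos 1), ← h1s] at hw
      rw [mem_sphere_zero_iff_norm]
      exact (hmono 1).injOn (norm_nonneg z) (by simp; linarith) hw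

lemma push {E : ℂ ≃ₜ ℂ} {κ : ℝ} (hκ0 : 0 < κ) (hκ1 : κ < 1) (hE0 : E 0 = 0)
    (hσ : ∀ z, ‖z‖ ≤ 1 → ‖E.symm ((lam : ℂ)⁻¹ * E z)‖ ≤ κ * ‖z‖) {s s' : ℝ} (hs1 : s ≤ 1) (hs0 : 0 < s)
    (hs' : s' ≤ s) (hκs : κ * s < s') :
    ∃ h ∈ Iso, h '' ((fun z => P (E z)) '' sphere 0 s) = (fun z => P (E z)) '' sphere 0 s' := by
  obtain ⟨a, ha1, ha2⟩ := exists_between hκs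
  have ha0 : 0 < a := lt_trans (by positivity) ha1
  obtain ⟨a', haa', ha's⟩ := exists_between ha2
  have ho : IsOpen {z : ℂ | ‖E.symm ((lam : ℂ)⁻¹ * E z)‖ < a} := by
    have h1 := E.continuous
    have h2 := E.symm.continuous
    apply isOpen_lt <;> fun_prop
  have hsub : closedBall (0 : ℂ) s ⊆ {z : ℂ | ‖E.symm ((lam : ℂ)⁻¹ * E z)‖ < a} := by
    intro z hz
    rw [mem_closedBall_zero_iff] at hz
    refine (hσ z (hz.trans hs1)).trans_lt (lt_of_le_of_lt ?_ ha1)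
    gcongr
  obtain ⟨δ, hδ, hδs⟩ := (isCompact_closedBall (0 : ℂ) s).exists_thickening_subset_open ho hsub
  rw [thickening_closedBall hδ hs0.le] at hδs
  set b := δ + s with hb
  have hn0 : ∀ z, z ≠ 0 → E z ≠ 0 := fun z hz h => hz (E.injective (h.trans hE0.symm))
  have hiter : ∀ (n : ℕ) (z : ℂ), ‖z‖ < b → ‖E.symm (((lam : ℂ)⁻¹) ^ (n + 1) * E z)‖ < a := by
    intro n z hz
    induction n with
    | zero => simpa using hδs (mem_ball_zero_iff.mpr hz)
    | succ n ih =>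
      have h1 := hσ _ (ih.le.trans (by linarith : a ≤ 1))
      rw [E.apply_symm_apply, ← mul_assoc, ← pow_succ'] at h1
      refine h1.trans_lt (lt_of_le_of_lt ?_ ih)
      exact mul_le_of_le_one_left (norm_nonneg _) hκ1.le
  have hinj0 : ∀ (n : ℕ) (z w : ℂ), a < ‖w‖ → ‖z‖ < b → E w = ((lam : ℂ)⁻¹) ^ (n + 1) * E z → False := by
    intro n z w hw hz h
    have := hiter n z hz
    rw [← h, E.symm_apply_apply] at this
    linarith
  obtain ⟨b', hb1, hb2⟩ := exists_between (by linarith : s < b)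
  obtain ⟨ρ, hρc, hρb, hρK, hρ0, hρs⟩ := radial_push (ha0.trans haa') ha's hs' hb1
  have hU0 : ∀ z ∈ {z : ℂ | a < ‖z‖ ∧ ‖z‖ < b}, z ≠ 0 := by
    rintro z hz rfl
    have := hz.1
    rw [norm_zero] at this; linarith
  have key : ∃ h ∈ Iso, ∀ z ∈ {z : ℂ | a < ‖z‖ ∧ ‖z‖ < b}, h (P (E z)) = P (E (ρ 1 z)) := by
    refine ext_iso (e := fun z => P (E z)) (U := {z : ℂ | a < ‖z‖ ∧ ‖z‖ < b})
      (K := {z : ℂ | a' ≤ ‖z‖ ∧ ‖z‖ ≤ b'}) ?_ ?_ ?_ ?_ ?_ ?_ hρc hρb ?_ hρ0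
    · exact (isOpen_lt continuous_const continuous_norm).inter (isOpen_lt continuous_norm continuous_const)
    · intro z hz
      exact (ContinuousAt.comp (f := E) (P_contAt (hn0 z (hU0 z hz))) E.continuous.continuousAt).continuousWithinAt
    · intro V hV hVo
      rw [← image_image P E]
      apply P_open (E.isOpenMap V hVo)
      rintro ⟨z, hz, h⟩
      exact hn0 z (hU0 z (hV hz)) h
    · intro z hz w hw hzw
      obtain ⟨m, hm⟩ := (P_eq_iff (hn0 z (hU0 z hz)) (hn0 w (hU0 w hw))).mp hzw
      rcases lt_trichotomy m 0 with h | h | h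
      · obtain ⟨n, rfl⟩ : ∃ n : ℕ, m = -((n + 1 : ℕ) : ℤ) := ⟨(-m - 1).toNat, by omega⟩
        rw [zpow_neg, zpow_natCast, ← inv_pow] at hm
        exact (hinj0 n z w hw.1 hz.2 hm).elim
      · rw [h, zpow_zero, one_mul] at hm
        exact E.injective hm.symm
      · obtain ⟨n, rfl⟩ : ∃ n : ℕ, m = ((n + 1 : ℕ) : ℤ) := ⟨(m - 1).toNat, by omega⟩
        rw [zpow_natCast] at hm
        refine (hinj0 n w z hz.1 hw.2 ?_).elim
        rw [hm, ← mul_assoc, ← mul_pow, inv_mul_cancel₀ lamc_ne, one_pow, one_mul]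
    · refine (isCompact_closedBall (0 : ℂ) b').of_isClosed_subset ?_ ?_
      · exact (isClosed_le continuous_const continuous_norm).inter (isClosed_le continuous_norm continuous_const)
      · intro z hz; simpa using hz.2
    · intro z hz
      exact ⟨haa'.trans_le hz.1, hz.2.trans_lt hb2⟩
    · intro t z hz
      apply hρK
      by_contra! hcon
      exact hz ⟨hcon.1.le, hcon.2.le⟩
  obtain ⟨h, hh, hhe⟩ := key
  refine ⟨h, hh, ?_⟩
  rw [image_image, ← hρs, image_image]
  apply image_congr
  intro z hz
  rw [mem_sphere_zero_iff_norm] at hz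
  exact hhe z ⟨by linarith, by linarith⟩

lemma push_pow {E : ℂ ≃ₜ ℂ} {κ : ℝ} (hκ0 : 0 < κ) (hκ1 : κ < 1) (hE0 : E 0 = 0)
    (hσ : ∀ z, ‖z‖ ≤ 1 → ‖E.symm ((lam : ℂ)⁻¹ * E z)‖ ≤ κ * ‖z‖) (n : ℕ) :
    ∃ h ∈ Iso, h '' ((fun z => P (E z)) '' sphere 0 1) = (fun z => P (E z)) '' sphere 0 (((1 + κ) / 2) ^ n) := by
  induction n with
  | zero => exact ⟨1, one_mem _, by rw [pow_zero]; exact image_id _⟩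
  | succ n ih =>
    obtain ⟨h, hh, he⟩ := ih
    have hq : 0 < ((1 + κ) / 2) ^ n := by positivity
    obtain ⟨h', hh', he'⟩ := push hκ0 hκ1 hE0 hσ (s := ((1 + κ) / 2) ^ n) (s' := ((1 + κ) / 2) ^ (n + 1))
      (pow_le_one₀ (by linarith) (by linarith)) hq
      (by rw [pow_succ]; nlinarith) (by rw [pow_succ]; nlinarith)
    refine ⟨h' * h, mul_mem hh' hh, ?_⟩
    rw [← he', ← he]
    exact image_comp h' h _

end TT

end

section

open Set Filter Topology Metric MeasureTheory

namespace TT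

lemma circ_surj {u : ℝ → ℝ} (hc : Continuous u) (hm : Monotone u) (h1 : ∀ y, u (y + 1) = u y + 1) :
    Function.Surjective u :=
  (CircleDeg1Lift.continuous_iff_surjective ⟨⟨u, hm⟩, h1⟩).mp hc

lemma exp_lip (s : ℝ) (hs : 0 < s) (y y' : ℝ) :
    ‖ex (Real.log s / (2 * Real.pi), y) - ex (Real.log s / (2 * Real.pi), y')‖ ≤ s * (2 * Real.pi * |y - y'|) := by
  have hp := Real.two_pi_pos
  have h1 : ex (Real.log s / (2 * Real.pi), y) - ex (Real.log s / (2 * Real.pi), y') =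
      ex (Real.log s / (2 * Real.pi), y') * (Complex.exp (Complex.I * ((2 * Real.pi * (y - y') : ℝ) : ℂ)) - 1) := by
    rw [mul_sub, mul_one, ex, ex, ← Complex.exp_add]
    congr 2
    apply Complex.ext <;> simp; ring
  rw [h1, norm_mul, ex_norm]
  have h2 : Real.exp (2 * Real.pi * (Real.log s / (2 * Real.pi))) = s := by
    rw [mul_div_cancel₀ _ hp.ne', Real.exp_log hs]
  simp only [h2]
  gcongr
  refine Real.norm_exp_I_mul_ofReal_sub_one_le.trans ?_
  rw [Real.norm_eq_abs, abs_mul, abs_of_pos hp]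

lemma ex_log_norm (s : ℝ) (hs : 0 < s) (y : ℝ) : ‖ex (Real.log s / (2 * Real.pi), y)‖ = s := by
  rw [ex_norm, mul_div_cancel₀ _ Real.two_pi_pos.ne', Real.exp_log hs]

lemma small_circle {E : ℂ → ℂ} (hE0 : E 0 = 0) (hd : DifferentiableOn ℂ E (ball 0 1))
    (hd0 : deriv E 0 ≠ 0) : ∃ r > 0, ∀ s, 0 < s → s < r →
      ∃ h ∈ Iso, h '' ell = (fun z => P (E z)) '' sphere 0 s := by
  have hp := Real.two_pi_pos
  have han : AnalyticAt ℂ (dslope E 0) 0 :=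
    ((Complex.differentiableOn_dslope (ball_mem_nhds (0 : ℂ) one_pos)).mpr hd).analyticAt
      (ball_mem_nhds (0 : ℂ) one_pos)
  set d := deriv E 0 with hdd
  have hds0 : dslope E 0 0 = d := dslope_same _ _
  set q : ℂ → ℂ := fun z => Complex.log d + Complex.log (dslope E 0 z / d) with hq
  have hqa : AnalyticAt ℂ q 0 := by
    apply AnalyticAt.add analyticAt_const
    apply AnalyticAt.clog (han.div analyticAt_const hd0)
    change dslope E 0 0 / d ∈ _
    rw [hds0, div_self hd0]; exact Complex.one_mem_slitPlane
  obtain ⟨L, V, hV, hL⟩ := hqa.hasStrictFDerivAt.exists_lipschitzOnWith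
  have hne : ∀ᶠ z in 𝓝 (0 : ℂ), dslope E 0 z ≠ 0 :=
    han.continuousAt.eventually_ne (by rw [hds0]; exact hd0)
  obtain ⟨r, hr, hrs⟩ := Metric.mem_nhds_iff.mp (inter_mem hV hne)
  have hqE : ∀ z ∈ ball (0 : ℂ) r, E z = z * Complex.exp (q z) := by
    intro z hz
    have h1 : dslope E 0 z ≠ 0 := (hrs hz).2
    rw [hq, Complex.exp_add, Complex.exp_log hd0, Complex.exp_log (div_ne_zero h1 hd0),
      mul_div_cancel₀ _ hd0]
    have := sub_smul_dslope E 0 z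
    rw [hE0] at this
    simpa using this.symm
  refine ⟨min r (1 / (L + 1)), by positivity, fun s hs hsr => ?_⟩
  have hsr1 : s < r := hsr.trans_le (min_le_left _ _)
  have hsL : s * L < 1 := by
    have h1 : s < 1 / (L + 1) := hsr.trans_le (min_le_right _ _)
    have h2 : (0 : ℝ) ≤ L := L.2
    rw [lt_div_iff₀ (by positivity)] at h1
    nlinarith
  set ζ : ℝ → ℂ := fun y => ex (Real.log s / (2 * Real.pi), y) with hζ
  have hζn : ∀ y, ‖ζ y‖ = s := ex_log_norm s hs
  have hζb : ∀ y, ζ y ∈ ball (0 : ℂ) r := fun y => by rw [mem_ball_zero_iff, hζn]; exact hsr1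
  have hζc : Continuous ζ := ex_cont.comp (by fun_prop)
  set Q : ℝ → ℂ := fun y => (Real.log s + q (ζ y)) / (2 * Real.pi) with hQ
  have hqc : Continuous fun y => q (ζ y) :=
    (hL.continuousOn).comp_continuous hζc (fun y => (hrs (hζb y)).1)
  have hQc : Continuous Q := (continuous_const.add hqc).div_const _
  have hζper : ∀ y (n : ℤ), ζ (y + n) = ζ y := by
    intro y n
    have := ex_add_iv (Real.log s / (2 * Real.pi), y) 0 n
    rw [zpow_zero, one_mul] at this
    rw [hζ]; simp only
    rw [← this]; congr 1; ext <;> simp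
  have hQper : ∀ y (n : ℤ), Q (y + n) = Q y := fun y n => by simp only [hQ, hζper]
  have hQlip : ∀ y y', y ≠ y' → |(Q y).im - (Q y').im| < |y - y'| := by
    intro y y' hne
    have h1 : ‖Q y - Q y'‖ ≤ (L * (s * (2 * Real.pi * |y - y'|))) / (2 * Real.pi) := by
      have h2 : Q y - Q y' = (q (ζ y) - q (ζ y')) / ((2 * Real.pi : ℝ) : ℂ) := by
        simp only [hQ]; push_cast; ring
      rw [h2, norm_div, Complex.norm_real, Real.norm_of_nonneg hp.le]
      gcongr
      have h3 := hL.norm_sub_le (hrs (hζb y)).1 (hrs (hζb y')).1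
      refine h3.trans ?_
      gcongr
      exact exp_lip s hs y y'
    have h4 : (L * (s * (2 * Real.pi * |y - y'|))) / (2 * Real.pi) = (s * L) * |y - y'| := by
      field_simp
    have h5 : |(Q y).im - (Q y').im| ≤ ‖Q y - Q y'‖ := by
      rw [← Complex.sub_im]; exact Complex.abs_im_le_norm _
    have h6 : 0 < |y - y'| := abs_pos.mpr (sub_ne_zero.mpr hne)
    rw [h4] at h1
    nlinarith
  set F : ℝ → ℝ × ℝ → ℝ × ℝ := fun t p => (p.1 + clamp t * (Q p.2).re, p.2 + clamp t * (Q p.2).im) with hF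
  have hcc := clamp_cont
  have hmono : ∀ t, StrictMono fun y => y + clamp t * (Q y).im := by
    intro t y y' hlt
    obtain ⟨h0, h1⟩ := clamp_mem t
    have h2 := hQlip y y' hlt.ne
    have h3 : |clamp t * ((Q y).im - (Q y').im)| < |y - y'| := by
      rw [abs_mul, abs_of_nonneg h0]
      exact lt_of_le_of_lt (mul_le_of_le_one_left (abs_nonneg _) h1) h2
    rw [abs_of_neg (by linarith : y - y' < 0)] at h3
    have := le_abs_self (clamp t * ((Q y).im - (Q y').im))
    simp only
    linarith
  have hQim : Continuous fun y => (Q y).im := Complex.continuous_im.comp hQc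
  have hQre : Continuous fun y => (Q y).re := Complex.continuous_re.comp hQc
  have hFc : Continuous fun x : ℝ × (ℝ × ℝ) => F x.1 x.2 := by
    simp only [hF]
    fun_prop
  have hsurj : ∀ t, Function.Surjective fun y => y + clamp t * (Q y).im := by
    intro t
    apply circ_surj (by fun_prop) (hmono t).monotone
    intro y
    have := hQper y 1
    simp only [Int.cast_one] at this
    rw [this]; ring
  have key : ∃ h ∈ Iso, IsLift h (F 1) := by
    refine descend (F := F) hFc ?_ ?_ ?_
    · intro t _
      constructor
      · rintro ⟨x, y⟩ ⟨x', y'⟩ h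
        simp only [hF, Prod.mk.injEq] at h
        have := (hmono t).injective h.2
        subst this
        have h1 := h.1
        ext
        · simpa using h1
        · rfl
      · rintro ⟨x, y⟩
        obtain ⟨y', hy'⟩ := hsurj t y
        refine ⟨(x - clamp t * (Q y').re, y'), ?_⟩
        simp only at hy'
        simp [hF, hy']
    · funext p; simp [hF]
    · intro t p m n
      ext <;> simp [hF, hQper] <;> ring
  obtain ⟨h, hh, hlift⟩ := key
  refine ⟨h, hh, ?_⟩
  have hkey : ∀ y, h (torusProj (0, y)) = P (E (ζ y)) := by
    intro y
    rw [← hlift.2, ← P_ex, hqE _ (hζb y)]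
    congr 1
    change ex (F 1 (0, y)) = ex (Real.log s / (2 * Real.pi), y) * _
    rw [ex, ex, ← Complex.exp_add, hF]
    simp only [clamp_one, one_mul, zero_add]
    congr 1
    have h7 : q (ζ y) = 2 * Real.pi * Q y - Real.log s := by
      have : (2 * Real.pi : ℂ) ≠ 0 := by exact_mod_cast hp.ne'
      simp only [hQ]; field_simp; ring
    rw [hζ] at h7; simp only at h7
    rw [h7]
    apply Complex.ext
    · simp; field_simp; ring
    · simp; ring
  rw [ell_eq']
  ext x; constructor
  · rintro ⟨_, ⟨⟨a, y⟩, ha, rfl⟩, rfl⟩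
    have ha' : a = 0 := ha
    subst ha'
    exact ⟨ζ y, by simp [hζn], (hkey y).symm⟩
  · rintro ⟨z, hz, rfl⟩
    rw [mem_sphere_zero_iff_norm] at hz
    obtain ⟨p, rfl⟩ := ex_surj (z := z) (by rintro rfl; simp at hz; linarith)
    have hp1 : p = (Real.log s / (2 * Real.pi), p.2) := by
      ext
      · simp only
        rw [ex_norm] at hz
        rw [← hz, Real.log_exp]; field_simp
      · rfl
    refine ⟨torusProj (0, p.2), ⟨(0, p.2), rfl, rfl⟩, ?_⟩
    rw [hkey, hζ]; simp only; rw [← hp1]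

/-- any homeomorphism acting trivially can be isotoped so that it preserves the standard circle -/
theorem straighten {f : T2 ≃ₜ T2} (hf : Triv f) : ∃ h ∈ Iso, h '' (f '' ell) = ell := by
  obtain ⟨Φ, h0, hl, hP⟩ := exists_Phi hf
  obtain ⟨E, κ, hκ0, hκ1, hE0, hEs, hEd, hEd0, hσ⟩ := exists_E Φ h0 hl
  obtain ⟨r, hr, hsmall⟩ := small_circle hE0 hEd hEd0
  obtain ⟨n, hn⟩ := exists_pow_lt_of_lt_one hr (by linarith : (1 + κ) / 2 < 1)
  obtain ⟨h1, hh1, e1⟩ := push_pow hκ0 hκ1 hE0 hσ n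
  obtain ⟨h2, hh2, e2⟩ := hsmall _ (by positivity) hn
  refine ⟨h2⁻¹ * h1, mul_mem (inv_mem hh2) hh1, ?_⟩
  have h3 : f '' ell = (fun z => P (E z)) '' sphere 0 1 := by
    rw [ell_eq, ← image_image P E, hEs, image_image, image_image]
    apply image_congr
    intro z hz
    exact (hP z (by rintro rfl; simp at hz)).symm
  have h4 : ∀ A : Set T2, (h2⁻¹ * h1 : T2 ≃ₜ T2) '' A = h2.symm '' (h1 '' A) := fun A => image_comp h2.symm h1 A
  rw [h4, h3, e1, ← e2, image_image]
  simp

end TT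

end

section

open Set Filter Topology Metric MeasureTheory

namespace TT

lemma Comm.comp {F G : ℝ × ℝ → ℝ × ℝ} (hF : Comm F) (hG : Comm G) : Comm (F ∘ G) := fun p m n => by
  simp only [Function.comp]; rw [hG, hF]

/-- homeomorphisms acting trivially on the fundamental group -/
def TrivG : Subgroup (T2 ≃ₜ T2) where
  carrier := {f | Triv f}
  mul_mem' := by
    rintro a b ⟨F, hF, hFc⟩ ⟨G, hG, hGc⟩
    have h := TT.IsLift.comp hF hG
    exact ⟨F ∘ G, h, hFc.comp hGc⟩
  one_mem' := ⟨id, ⟨continuous_id, fun p => rfl⟩, fun p m n => rfl⟩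
  inv_mem' := by
    rintro a ⟨F, hF, hFc⟩
    obtain ⟨E, -, h1, h2⟩ := lift_homeo hF hFc
    exact ⟨E.symm, h1, h2⟩

lemma mem_TrivG {f : T2 ≃ₜ T2} : f ∈ TrivG ↔ Triv f := Iff.rfl

lemma Iso_le : Iso ≤ TrivG := by
  rintro f ⟨F, hF, -, hF0, hF1, -⟩
  obtain ⟨Ψ, hΨ, hΨp⟩ := exists_lift (A := ℝ × (ℝ × ℝ)) (φ := fun q => F q.1 (torusProj q.2))
    (hF.comp (continuous_fst.prodMk (proj_cont.comp continuous_snd)))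
  obtain ⟨m0, n0, h0⟩ := const_int (A := ℝ × ℝ) (f := fun p => Ψ (0, p)) (g := id)
    (hΨ.comp (by fun_prop)) continuous_id (fun p => by rw [hΨp]; simp [hF0])
  refine ⟨fun p => Ψ (1, p), ⟨hΨ.comp (by fun_prop), fun p => by rw [hΨp]; simp [hF1]⟩, ?_⟩
  intro p m n
  obtain ⟨m', n', h⟩ := const_int (A := ℝ × (ℝ × ℝ)) (f := fun q => Ψ (q.1, q.2 + iv m n)) (g := Ψ)
    (hΨ.comp (by fun_prop)) hΨ (fun q => by rw [hΨp, hΨp]; simp)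
  have h1 := h (0, 0)
  simp only at h1
  have h2 := h0 (0 + iv m n)
  have h3 := h0 0
  simp only [id] at h2 h3
  rw [h2, h3] at h1
  have h4 : iv m n = iv m' n' := by
    simp only [zero_add] at h1
    rw [add_comm] at h1
    exact add_left_cancel h1
  exact (h (1, p)).trans (by rw [h4])

end TT

end

section

open Set Filter Topology Metric MeasureTheory
open scoped commutatorElement

namespace TT

lemma mul_apply (f g : T2 ≃ₜ T2) (x : T2) : (f * g) x = f (g x) := rfl
lemma inv_apply (f : T2 ≃ₜ T2) (x : T2) : f⁻¹ x = f.symm x := rfl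

lemma mem_ell (p : ℝ × ℝ) : torusProj p ∈ ell ↔ ∃ m : ℤ, p.1 = m := by
  change ((p.1 : ℝ) : AddCircle (1 : ℝ)) = 0 ↔ _
  have : (0 : AddCircle (1 : ℝ)) = ((0 : ℝ) : AddCircle (1 : ℝ)) := rfl
  rw [this, eq_comm, coe_eq_iff]
  simp

/-- step 1: get a lift preserving the vertical axis -/
lemma exists_axis {f : T2 ≃ₜ T2} (hf : Triv f) : ∃ h ∈ Iso, ∃ F, IsLift (h * f : T2 ≃ₜ T2) F ∧ Comm F ∧
    ∀ y, (F (0, y)).1 = 0 := by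
  obtain ⟨h, hh, he⟩ := straighten hf
  have htriv : Triv (h * f : T2 ≃ₜ T2) := TrivG.mul_mem (Iso_le hh) hf
  obtain ⟨F, hF, hc⟩ := htriv
  have h1 : ∀ y, ∃ m : ℤ, (F (0, y)).1 = m := by
    intro y
    rw [← mem_ell, hF.2, mul_apply, ← he]
    exact ⟨_, ⟨_, (mem_ell _).mpr ⟨0, by simp⟩, rfl⟩, rfl⟩
  have hF1 : Continuous fun y => (F (0, y)).1 := continuous_fst.comp (hF.1.comp (by fun_prop))
  obtain ⟨m, n, hmn⟩ := const_int (A := ℝ) (f := fun y => ((F (0, y)).1, 0)) (g := fun _ => 0)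
    (by fun_prop) continuous_const (fun y => by
      obtain ⟨m, hm⟩ := h1 y
      rw [proj_eq_iff]
      exact ⟨-m, 0, by ext <;> simp [hm]⟩)
  refine ⟨h, hh, fun p => F p + iv (-m) 0, ⟨by have := hF.1; fun_prop, fun p => by rw [proj_add_iv, hF.2]⟩, ?_, ?_⟩
  · intro p a b; simp only; rw [hc]; abel
  · intro y
    have := congrArg Prod.fst (hmn y)
    simp at this
    simp [this]

/-- step 2: fix the vertical axis pointwise -/
lemma exists_fix {f : T2 ≃ₜ T2} (hf : Triv f) : ∃ h ∈ Iso, ∃ F, IsLift (h * f : T2 ≃ₜ T2) F ∧ Comm F ∧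
    ∀ y, F (0, y) = (0, y) := by
  obtain ⟨h, hh, F, hF, hc, hax⟩ := exists_axis hf
  obtain ⟨E, rfl, -, -⟩ := lift_homeo hF hc
  set σ : ℝ → ℝ := fun y => (E (0, y)).2 with hσ
  have hEσ : ∀ y, E (0, y) = (0, σ y) := fun y => Prod.ext (hax y) rfl
  have hσc : Continuous σ := continuous_snd.comp (E.continuous.comp (by fun_prop))
  have hσi : Function.Injective σ := by
    intro y y' hyy
    have : E (0, y) = E (0, y') := by rw [hEσ, hEσ, hyy]
    simpa using E.injective this
  have hσ1 : ∀ y (n : ℤ), σ (y + n) = σ y + n := by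
    intro y n
    have := hc (0, y) 0 n
    have h2 : ((0 : ℝ), y) + iv 0 n = (0, y + n) := by ext <;> simp
    rw [h2] at this
    simp only [hσ]; rw [this]; simp
  have hσm : StrictMono σ := by
    rcases hσc.strictMono_of_inj hσi with h | h
    · exact h
    · have h1 := h (zero_lt_one : (0 : ℝ) < 1)
      have h2 := hσ1 0 1
      simp at h2; linarith
  have hcc := clamp_cont
  set K : ℝ → ℝ × ℝ → ℝ × ℝ := fun t p => (p.1, (1 - clamp t) * p.2 + clamp t * σ p.2) with hK
  have hmono : ∀ t, StrictMono fun y => (1 - clamp t) * y + clamp t * σ y := by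
    intro t y y' hlt
    obtain ⟨h0, h1⟩ := clamp_mem t
    have h2 := hσm hlt
    simp only
    rcases h0.eq_or_lt with h3 | h3
    · rw [← h3]; linarith
    · have := mul_lt_mul_of_pos_left h2 h3
      have := mul_le_mul_of_nonneg_left hlt.le (sub_nonneg.mpr h1)
      linarith
  have key : ∃ k ∈ Iso, IsLift k (K 1) := by
    refine descend (F := K) ?_ ?_ ?_ ?_
    · simp only [hK]; fun_prop
    · intro t _
      constructor
      · rintro ⟨x, y⟩ ⟨x', y'⟩ h
        simp only [hK, Prod.mk.injEq] at h
        exact Prod.ext h.1 ((hmono t).injective h.2)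
      · rintro ⟨x, y⟩
        obtain ⟨y', hy'⟩ := circ_surj (u := fun y => (1 - clamp t) * y + clamp t * σ y) (by fun_prop) (hmono t).monotone
          (fun y => by have := hσ1 y 1; simp at this; rw [this]; ring) y
        exact ⟨(x, y'), Prod.ext rfl hy'⟩
    · funext p; simp [hK]
    · intro t p m n
      ext <;> simp [hK, hσ1]; ring
  obtain ⟨k, hk, hkl⟩ := key
  have hKc : Comm (K 1) := by
    intro p m n
    ext <;> simp [hK, hσ1]
  obtain ⟨E', hE', hE'l, hE'c⟩ := lift_homeo hkl hKc
  refine ⟨k⁻¹ * h, mul_mem (inv_mem hk) hh, E'.symm ∘ E, ?_, hE'c.comp hc, ?_⟩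
  · have h9 := TT.IsLift.comp hE'l hF
    exact h9
  · intro y
    simp only [Function.comp]
    rw [hEσ, E'.symm_apply_eq, hE']
    simp [hK]

/-- a lift fixing the vertical axis preserves the strip -/
lemma strip {E : (ℝ × ℝ) ≃ₜ (ℝ × ℝ)} (hc : Comm E) (h0 : ∀ y, E (0, y) = (0, y)) (x y : ℝ) (hx0 : 0 ≤ x) (hx1 : x < 1) :
    0 ≤ (E (x, y)).1 ∧ (E (x, y)).1 < 1 := by
  have hm : ∀ (m : ℤ) (y : ℝ), E ((m : ℝ), y) = ((m : ℝ), y) := by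
    intro m y
    have := hc (0, y) m 0
    have h2 : ((0 : ℝ), y) + iv m 0 = ((m : ℝ), y) := by ext <;> simp
    rwa [h2, h0, h2] at this
  have hE1 : E (1, y) = (1, y) := by simpa using hm 1 y
  have hn : ∀ x, 0 < x → x < 1 → ∀ m : ℤ, (E (x, y)).1 ≠ m := by
    intro x h1 h2 m h
    have h3 : E (x, y) = E (m, (E (x, y)).2) := by rw [hm]; exact Prod.ext h rfl
    have h4 : x = m := congrArg Prod.fst (E.injective h3)
    rw [h4] at h1 h2
    have h5 : 0 < m := by exact_mod_cast h1
    have h6 : m < 1 := by exact_mod_cast h2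
    omega
  have hcont : Continuous fun x => (E (x, y)).1 := continuous_fst.comp (E.continuous.comp (by fun_prop))
  rcases hx0.eq_or_lt with h | hx
  · rw [← h, h0]; simp
  constructor
  · by_contra! hneg
    obtain ⟨u, hu, hu'⟩ := intermediate_value_Icc hx1.le hcont.continuousOn
      (show (0 : ℝ) ∈ Icc ((E (x, y)).1) ((E (1, y)).1) by rw [hE1]; exact ⟨hneg.le, by simp⟩)
    simp only at hu'
    rcases hu.2.eq_or_lt with h | h
    · rw [h, hE1] at hu'; simp at hu'
    · exact hn u (hx.trans_le hu.1) h 0 (by simpa using hu')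
  · by_contra! hge
    obtain ⟨u, hu, hu'⟩ := intermediate_value_Icc hx.le hcont.continuousOn
      (show (1 : ℝ) ∈ Icc ((E (0, y)).1) ((E (x, y)).1) by rw [h0]; exact ⟨by simp, hge⟩)
    simp only at hu'
    rcases hu.1.eq_or_lt with h | h
    · rw [← h, h0] at hu'; simp at hu'
    · exact hn u h (hu.2.trans_lt hx1) 1 (by simpa using hu')

/-- the squeezed map on the strip -/
noncomputable def sq (E : ℝ × ℝ → ℝ × ℝ) (r : ℝ) (x y : ℝ) : ℝ × ℝ :=
  (x + r * ((E (clamp (x / r), y)).1 - clamp (x / r)), (E (clamp (x / r), y)).2)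

/-- the squeezed map, periodic version -/
noncomputable def sqp (E : ℝ × ℝ → ℝ × ℝ) (r : ℝ) (p : ℝ × ℝ) : ℝ × ℝ :=
  sq E r (Int.fract p.1) p.2 + iv ⌊p.1⌋ 0

lemma sq_lt (E : ℝ × ℝ → ℝ × ℝ) {r x : ℝ} (y : ℝ) (hr : 0 < r) (hx : 0 ≤ x) (hxr : x ≤ r) :
    sq E r x y = (r * (E (x / r, y)).1, (E (x / r, y)).2) := by
  have h1 : clamp (x / r) = x / r := clamp_of_mem ⟨by positivity, (div_le_one hr).mpr hxr⟩
  rw [sq, h1]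
  ext
  · simp only; field_simp; ring
  · rfl

lemma sq_ge {E : ℝ × ℝ → ℝ × ℝ} (h1 : ∀ y, E (1, y) = (1, y)) {r x : ℝ} (y : ℝ) (hr : 0 < r) (hxr : r ≤ x) :
    sq E r x y = (x, y) := by
  have h2 : clamp (x / r) = 1 := by
    have : 1 ≤ x / r := (one_le_div hr).mpr hxr
    simp [clamp, min_eq_left this]
  rw [sq, h2, h1]; simp

lemma sq_mem {E : (ℝ × ℝ) ≃ₜ (ℝ × ℝ)} (hc : Comm E) (h0 : ∀ y, E (0, y) = (0, y)) {r : ℝ} (hr : 0 < r) (hr1 : r ≤ 1)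
    {x : ℝ} (hx : 0 ≤ x) (hx1 : x < 1) (y : ℝ) : 0 ≤ (sq E r x y).1 ∧ (sq E r x y).1 < 1 := by
  have h1 : ∀ y, E (1, y) = (1, y) := fun y => by
    have := hc (0, y) 1 0
    have h2 : ((0 : ℝ), y) + iv 1 0 = (1, y) := by ext <;> simp
    rwa [h2, h0, h2] at this
  rcases lt_or_ge x r with h | h
  · rw [sq_lt E y hr hx h.le]
    obtain ⟨a, b⟩ := strip hc h0 (x / r) y (by positivity) ((div_lt_one hr).mpr h)
    simp only
    exact ⟨by positivity, by nlinarith⟩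
  · rw [sq_ge h1 y hr h]; exact ⟨hx, hx1⟩

lemma sq_inv {E : (ℝ × ℝ) ≃ₜ (ℝ × ℝ)} (hc : Comm E) (h0 : ∀ y, E (0, y) = (0, y)) {r : ℝ} (hr : 0 < r)
    {x : ℝ} (hx : 0 ≤ x) (y : ℝ) : sq E.symm r (sq E r x y).1 (sq E r x y).2 = (x, y) := by
  have h1 : ∀ y, E (1, y) = (1, y) := fun y => by
    have := hc (0, y) 1 0
    have h2 : ((0 : ℝ), y) + iv 1 0 = (1, y) := by ext <;> simp
    rwa [h2, h0, h2] at this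
  have h1' : ∀ y, E.symm (1, y) = (1, y) := fun y => by rw [E.symm_apply_eq, h1]
  rcases lt_or_ge x r with h | h
  · rw [sq_lt E y hr hx h.le]
    obtain ⟨a, b⟩ := strip hc h0 (x / r) y (by positivity) ((div_lt_one hr).mpr h)
    simp only
    rw [sq_lt _ _ hr (by positivity) (by nlinarith), mul_div_cancel_left₀ _ hr.ne']
    simp only [Prod.mk.eta, E.symm_apply_apply]
    ext
    · simp only; field_simp
    · rfl
  · rw [sq_ge h1 y hr h, sq_ge h1' y hr h]

lemma sqp_inv {E : (ℝ × ℝ) ≃ₜ (ℝ × ℝ)} (hc : Comm E) (h0 : ∀ y, E (0, y) = (0, y)) {r : ℝ} (hr : 0 < r)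
    (hr1 : r ≤ 1) (p : ℝ × ℝ) : sqp E.symm r (sqp E r p) = p := by
  obtain ⟨a, b⟩ := sq_mem hc h0 hr hr1 (Int.fract_nonneg p.1) (Int.fract_lt_one p.1) p.2
  have h1 : (sqp E r p).1 = (sq E r (Int.fract p.1) p.2).1 + ⌊p.1⌋ := by simp [sqp]
  have h2 : (sqp E r p).2 = (sq E r (Int.fract p.1) p.2).2 := by simp [sqp]
  have h3 : Int.fract (sqp E r p).1 = (sq E r (Int.fract p.1) p.2).1 := by
    rw [h1, Int.fract_add_intCast, Int.fract_eq_self.mpr ⟨a, b⟩]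
  have h4 : ⌊(sqp E r p).1⌋ = ⌊p.1⌋ := by
    rw [h1, Int.floor_add_intCast, Int.floor_eq_zero_iff.mpr ⟨a, b⟩, zero_add]
  rw [sqp, h3, h4, h2, sq_inv hc h0 hr (Int.fract_nonneg _)]
  ext <;> simp

lemma sqp_comm {E : ℝ × ℝ → ℝ × ℝ} (hc : Comm E) (r : ℝ) : Comm (sqp E r) := by
  intro p m n
  have h : ∀ u y, E (u, y + n) = E (u, y) + iv 0 n := by
    intro u y
    rw [← hc]; congr 1; ext <;> simp
  ext
  · simp [sqp, sq, h]; ring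
  · simp [sqp, sq, h]

lemma sqp_one {E : ℝ × ℝ → ℝ × ℝ} (hc : Comm E) (p : ℝ × ℝ) : sqp E 1 p = E p := by
  rw [sqp, sq_lt E _ one_pos (Int.fract_nonneg _) (Int.fract_lt_one _).le]
  simp only [one_mul, div_one, Prod.mk.eta]
  rw [← hc]; congr 1; ext <;> simp

lemma sqp_cont {E : ℝ × ℝ → ℝ × ℝ} (hE : Continuous E) (h0 : ∀ y, E (0, y) = (0, y)) (h1 : ∀ y, E (1, y) = (1, y)) :
    Continuous fun q : ℝ × (ℝ × ℝ) => sqp E (1 - clamp q.1 / 2) q.2 := by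
  have hr : ∀ t, 0 < 1 - clamp t / 2 ∧ 1 - clamp t / 2 ≤ 1 := fun t => by
    obtain ⟨a, b⟩ := clamp_mem t
    constructor <;> linarith
  have hcc := clamp_cont
  have hA : Continuous (Function.uncurry fun (q : ℝ × (ℝ × ℝ)) (u : ℝ) => sq E (1 - clamp q.1 / 2) u q.2.2 - (u, q.2.2)) := by
    have hne : ∀ q : (ℝ × (ℝ × ℝ)) × ℝ, 1 - clamp q.1.1 / 2 ≠ 0 := fun q => (hr q.1.1).1.ne'
    have hcl : Continuous fun q : (ℝ × (ℝ × ℝ)) × ℝ => clamp (q.2 / (1 - clamp q.1.1 / 2)) := by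
      apply hcc.comp
      fun_prop (disch := assumption)
    have hEE : Continuous fun q : (ℝ × (ℝ × ℝ)) × ℝ => E (clamp (q.2 / (1 - clamp q.1.1 / 2)), q.1.2.2) :=
      hE.comp (hcl.prodMk (by fun_prop))
    unfold sq
    simp only [Function.uncurry_def]
    fun_prop
  have hB := ContinuousOn.comp_fract (s := fun q : ℝ × (ℝ × ℝ) => q.2.1) hA.continuousOn (by fun_prop) (by
    intro q
    obtain ⟨a, b⟩ := hr q.1
    rw [sq_lt E _ a le_rfl a.le, sq_ge h1 _ a b]
    simp [h0])
  have : (fun q : ℝ × (ℝ × ℝ) => sqp E (1 - clamp q.1 / 2) q.2) =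
      fun q => (sq E (1 - clamp q.1 / 2) (Int.fract q.2.1) q.2.2 - (Int.fract q.2.1, q.2.2)) + q.2 := by
    funext q
    have h3 : Int.fract q.2.1 + ⌊q.2.1⌋ = q.2.1 := Int.fract_add_floor _
    rw [sqp]
    ext
    · simp; linarith
    · simp
  rw [this]
  exact hB.add (by fun_prop)

/-- step 3: support in a half annulus -/
lemma exists_half {f : T2 ≃ₜ T2} (hf : Triv f) : ∃ h ∈ Iso,
    ∀ p : ℝ × ℝ, 1 / 2 ≤ Int.fract p.1 → (h * f : T2 ≃ₜ T2) (torusProj p) = torusProj p := by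
  obtain ⟨h, hh, F, hF, hc, h0⟩ := exists_fix hf
  obtain ⟨E, rfl, hEs, hEc⟩ := lift_homeo hF hc
  have h1 : ∀ y, E (1, y) = (1, y) := fun y => by
    have := hc (0, y) 1 0
    have h2 : ((0 : ℝ), y) + iv 1 0 = (1, y) := by ext <;> simp
    rwa [h2, h0, h2] at this
  have h0' : ∀ y, E.symm (0, y) = (0, y) := fun y => by rw [E.symm_apply_eq, h0]
  have hr : ∀ t, 0 < 1 - clamp t / 2 ∧ 1 - clamp t / 2 ≤ 1 := fun t => by
    obtain ⟨a, b⟩ := clamp_mem t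
    constructor <;> linarith
  have key : ∃ k ∈ Iso, IsLift k (fun p => sqp E (1 - clamp 1 / 2) (E.symm p)) := by
    refine descend (F := fun t p => sqp E (1 - clamp t / 2) (E.symm p)) ?_ ?_ ?_ ?_
    · exact (sqp_cont E.continuous h0 h1).comp (continuous_fst.prodMk (E.symm.continuous.comp continuous_snd))
    · intro t _
      obtain ⟨a, b⟩ := hr t
      have hb : Function.Bijective (sqp E (1 - clamp t / 2)) := by
        refine Function.bijective_iff_has_inverse.mpr ⟨sqp E.symm (1 - clamp t / 2), sqp_inv hc h0 a b, ?_⟩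
        have := sqp_inv (E := E.symm) hEc h0' a b
        rwa [E.symm_symm] at this
      exact hb.comp E.symm.bijective
    · funext p; simp [sqp_one hc]
    · intro t; exact (sqp_comm hc _).comp hEc
  obtain ⟨k, hk, hkl⟩ := key
  refine ⟨k * h, mul_mem hk hh, fun p hp => ?_⟩
  rw [mul_assoc, mul_apply, ← hF.2, ← hkl.2]
  congr 1
  simp only [E.symm_apply_apply, clamp_one]
  rw [sqp, sq_ge h1 _ (by norm_num) (by linarith)]
  ext <;> simp

/-- half translation -/
lemma exists_half_trans : ∃ τ ∈ Iso, ∀ p : ℝ × ℝ, τ (torusProj p) = torusProj (p + (1 / 2, 0)) := by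
  have hcc := clamp_cont
  have key : ∃ k ∈ Iso, IsLift k (fun p => p + (clamp 1 / 2, 0)) := by
    refine descend (F := fun t p => p + (clamp t / 2, 0)) (by fun_prop) ?_ ?_ ?_
    · intro t _; exact (Equiv.addRight (clamp t / 2, (0:ℝ))).bijective
    · funext p; simp
    · intro t p m n; simp only; abel
  obtain ⟨k, hk, hkl⟩ := key
  exact ⟨k, hk, fun p => by rw [← hkl.2]; simp⟩

theorem comm_mem_Iso {f g : T2 ≃ₜ T2} (hf : Triv f) (hg : Triv g) : ⁅f, g⁆ ∈ Iso := by
  obtain ⟨h, hh, hfix⟩ := exists_half hf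
  obtain ⟨h', hh', hfix'⟩ := exists_half hg
  obtain ⟨τ, hτ, hτp⟩ := exists_half_trans
  set a := h * f with ha
  set b := τ * (h' * g) * τ⁻¹ with hb
  have hbfix : ∀ p : ℝ × ℝ, Int.fract p.1 < 1 / 2 → b (torusProj p) = torusProj p := by
    intro p hp
    obtain ⟨q, hq⟩ : ∃ q : ℝ × ℝ, q = p + (1 / 2, 0) + iv (-1) 0 := ⟨_, rfl⟩
    have h1 : τ (torusProj q) = torusProj p := by
      rw [hτp, hq]
      rw [show p + (1 / 2, 0) + iv (-1) 0 + (1 / 2, 0) = p by ext <;> simp; ring]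
    have h2 : τ⁻¹ (torusProj p) = torusProj q := by
      rw [inv_apply, τ.symm_apply_eq, h1]
    have h3 : 1 / 2 ≤ Int.fract q.1 := by
      have h4 : Int.fract q.1 = Int.fract p.1 + 1 / 2 := by
        rw [Int.fract_eq_iff]
        refine ⟨by have := Int.fract_nonneg p.1; linarith, by linarith, ⌊p.1⌋ - 1, ?_⟩
        have h6 := Int.floor_add_fract p.1
        rw [hq]; simp; linarith
      have := Int.fract_nonneg p.1; linarith
    rw [hb, mul_apply, mul_apply, h2, hfix' q h3, h1]
  have hcomm : a * b = b * a := by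
    apply Homeomorph.ext
    intro x
    rw [mul_apply a, mul_apply b]
    obtain ⟨p, rfl⟩ := proj_surj x
    rcases lt_or_ge (Int.fract p.1) (1 / 2) with hp | hp
    · rw [hbfix p hp]
      obtain ⟨q, hq⟩ := proj_surj (a (torusProj p))
      rcases lt_or_ge (Int.fract q.1) (1 / 2) with hq' | hq'
      · rw [← hq, hbfix q hq']
      · have := hfix q hq'
        rw [hq] at this
        have h5 := a.injective this
        rw [h5, hbfix p hp]
    · rw [hfix p hp]
      obtain ⟨q, hq⟩ := proj_surj (b (torusProj p))
      rcases lt_or_ge (Int.fract q.1) (1 / 2) with hq' | hq'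
      · have := hbfix q hq'
        rw [hq] at this
        have h5 := b.injective this
        rw [h5, hfix p hp]
      · rw [← hq, hfix q hq']
  have hπ : ∀ x : T2 ≃ₜ T2, x ∈ Iso ↔ (QuotientGroup.mk' Iso) x = 1 := fun x => by
    rw [QuotientGroup.mk'_apply, QuotientGroup.eq_one_iff]
  have e1 : (QuotientGroup.mk' Iso) a = QuotientGroup.mk' Iso f := by
    rw [ha, map_mul, (hπ h).mp hh, one_mul]
  have e2 : (QuotientGroup.mk' Iso) b = QuotientGroup.mk' Iso g := by
    rw [hb, map_mul, map_mul, map_mul, map_inv, (hπ τ).mp hτ, (hπ h').mp hh']; simp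
  rw [hπ, map_commutatorElement, ← e1, ← e2, ← map_commutatorElement]
  rw [commutatorElement_eq_one_iff_mul_comm.mpr hcomm, map_one]

end TT

end

section

open Set Filter Topology Metric MeasureTheory
open scoped commutatorElement

namespace SL

/-- a length function, presented by its balls -/
structure Len {H : Type*} [Group H] (B : H → ℝ → Prop) : Prop where
  one : B 1 0
  mul : ∀ g h r s, B g r → B h s → B (g * h) (r + s)
  inv : ∀ g r, B g r → B g⁻¹ r
  ex : ∀ g, ∃ r, 0 ≤ r ∧ B g r
  mono : ∀ g r s, r ≤ s → B g r → B g s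

/-- zero stable length -/
def T {H : Type*} [Group H] (B : H → ℝ → Prop) (g : H) : Prop :=
  ∀ ε > 0, ∃ n : ℕ, 1 ≤ n ∧ B (g ^ n) (ε * n)

section
variable {H : Type*} [Group H] {B : H → ℝ → Prop}

lemma Len.pow (hB : Len B) {g : H} {r : ℝ} (h : B g r) (n : ℕ) : B (g ^ n) (n * r) := by
  induction n with
  | zero => simpa using hB.one
  | succ n ih =>
    have := hB.mul _ _ _ _ ih h
    rw [← pow_succ] at this
    convert this using 1
    push_cast; ring

lemma T.mul (hB : Len B) {g h : H} (hc : Commute g h) (hg : T B g) (hh : T B h) : T B (g * h) := by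
  intro ε hε
  obtain ⟨n, hn, h1⟩ := hg (ε / 2) (by positivity)
  obtain ⟨m, hm, h2⟩ := hh (ε / 2) (by positivity)
  refine ⟨n * m, Nat.mul_pos hn hm, ?_⟩
  have h3 := hB.pow h1 m
  have h4 := hB.pow h2 n
  rw [← pow_mul] at h3 h4
  rw [mul_comm m n] at h4
  have := hB.mul _ _ _ _ h3 h4
  rw [← hc.mul_pow] at this
  convert this using 1
  push_cast; ring

lemma T.inv (hB : Len B) {g : H} (hg : T B g) : T B g⁻¹ := by
  intro ε hε
  obtain ⟨n, hn, h1⟩ := hg ε hε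
  exact ⟨n, hn, by rw [inv_pow]; exact hB.inv _ _ h1⟩

lemma T.one (hB : Len B) : T B 1 := fun ε hε =>
  ⟨1, le_rfl, hB.mono _ _ _ (by positivity) (by simpa using hB.one)⟩

lemma comm_pow {a b c : H} (hc : ∀ x, c * x = x * c) (hab : a * b = c * (b * a)) (m : ℕ) :
    a ^ m * b = c ^ m * (b * a ^ m) := by
  have hcm : ∀ n x, c ^ n * x = x * c ^ n := fun n x => ((show Commute c x from hc x).pow_left n).eq
  induction m with
  | zero => simp
  | succ m ih =>
    calc a ^ (m + 1) * b = a ^ m * (a * b) := by rw [pow_succ, mul_assoc]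
      _ = a ^ m * (c * (b * a)) := by rw [hab]
      _ = c * (a ^ m * b) * a := by simp only [← mul_assoc]; rw [hc (a ^ m)]
      _ = c * (c ^ m * (b * a ^ m)) * a := by rw [ih]
      _ = _ := by simp only [pow_succ', ← mul_assoc]; rw [mul_assoc (_ * b) a, mul_assoc (_ * b), ← pow_succ, ← pow_succ', ← pow_succ']

lemma comm_pow_pow {a b c : H} (hc : ∀ x, c * x = x * c) (hab : a * b = c * (b * a)) (m n : ℕ) :
    a ^ m * b ^ n = c ^ (m * n) * (b ^ n * a ^ m) := by
  have hcm : ∀ n x, c ^ n * x = x * c ^ n := fun n x => ((show Commute c x from hc x).pow_left n).eq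
  have h1 := comm_pow hc hab m
  have h2 : b * a ^ m = (c ^ m)⁻¹ * (a ^ m * b) := by rw [h1]; group
  have hci : ∀ x, (c ^ m)⁻¹ * x = x * (c ^ m)⁻¹ := fun x =>
    (((show Commute c x from hc x).pow_left m).inv_left).eq
  have h3 := comm_pow hci h2 n
  rw [h3, ← mul_assoc, pow_mul, inv_pow]; group

lemma T_comm (hB : Len B) {a b : H} (hc : ∀ x, ⁅a, b⁆ * x = x * ⁅a, b⁆) : T B ⁅a, b⁆ := by
  intro ε hε
  obtain ⟨r, hr, ha⟩ := hB.ex a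
  obtain ⟨s, hs, hb⟩ := hB.ex b
  obtain ⟨m, hm⟩ := exists_nat_ge (2 * (r + s) / ε)
  set M := m + 1 with hM
  have hMm : 2 * (r + s) ≤ ε * M := by
    rw [div_le_iff₀ hε] at hm
    have : (M : ℝ) = m + 1 := by simp [hM]
    rw [this]; nlinarith
  refine ⟨M * M, Nat.mul_pos (Nat.succ_pos m) (Nat.succ_pos m), ?_⟩
  have h1 := comm_pow_pow hc (a := a) (b := b) (by rw [commutatorElement_def]; group) M M
  have h2 : ⁅a, b⁆ ^ (M * M) = a ^ M * b ^ M * (a ^ M)⁻¹ * (b ^ M)⁻¹ := by rw [h1]; group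
  rw [h2]
  have h3 := hB.pow ha M
  have h4 := hB.pow hb M
  have h5 := hB.mul _ _ _ _ (hB.mul _ _ _ _ (hB.mul _ _ _ _ h3 h4) (hB.inv _ _ h3)) (hB.inv _ _ h4)
  refine hB.mono _ _ _ ?_ h5
  push_cast
  have : (0 : ℝ) ≤ M := by positivity
  nlinarith [mul_le_mul_of_nonneg_left hMm this]

lemma Len.quot (hB : Len B) (N : Subgroup H) [N.Normal] :
    Len (fun (q : H ⧸ N) r => ∃ g, QuotientGroup.mk' N g = q ∧ B g r) where
  one := ⟨1, map_one _, hB.one⟩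
  mul := by
    rintro _ _ r s ⟨g, rfl, hg⟩ ⟨h, rfl, hh⟩
    exact ⟨g * h, map_mul _ _ _, hB.mul _ _ _ _ hg hh⟩
  inv := by
    rintro _ r ⟨g, rfl, hg⟩
    exact ⟨g⁻¹, map_inv _ _, hB.inv _ _ hg⟩
  ex := by
    intro q
    obtain ⟨g, rfl⟩ := QuotientGroup.mk'_surjective N q
    obtain ⟨r, h0, h⟩ := hB.ex g
    exact ⟨r, h0, g, rfl, h⟩
  mono := by
    rintro _ r s hrs ⟨g, rfl, hg⟩
    exact ⟨g, rfl, hB.mono _ _ _ hrs hg⟩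

lemma T_of_quot (hB : Len B) (N : Subgroup H) [N.Normal] (hN : N ≤ Subgroup.center H)
    (hT : ∀ z ∈ N, T B z) {g : H}
    (hg : T (fun (q : H ⧸ N) r => ∃ g, QuotientGroup.mk' N g = q ∧ B g r) (QuotientGroup.mk' N g)) :
    T B g := by
  intro ε hε
  obtain ⟨n, hn, x, hx, hxB⟩ := hg (ε / 2) (by positivity)
  have hz : x⁻¹ * g ^ n ∈ N := by
    rw [← QuotientGroup.eq_one_iff, ← QuotientGroup.mk'_apply, map_mul, map_inv, hx, map_pow]; simp
  obtain ⟨z, hzd⟩ : ∃ z, z = x⁻¹ * g ^ n := ⟨_, rfl⟩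
  rw [← hzd] at hz
  have hgz : g ^ n = x * z := by rw [hzd]; group
  obtain ⟨k, hk, hkB⟩ := hT z hz (ε / 2) (by positivity)
  refine ⟨n * k, Nat.mul_pos hn hk, ?_⟩
  have hc : Commute x z := ((Subgroup.mem_center_iff.mp (hN hz)) x)
  rw [pow_mul, hgz, hc.mul_pow]
  refine hB.mono _ _ _ ?_ (hB.mul _ _ _ _ (hB.pow hxB k) hkB)
  push_cast
  have h1 : (1 : ℝ) ≤ n := by exact_mod_cast hn
  have h2 : (0 : ℝ) ≤ k := by positivity
  nlinarith [mul_le_mul_of_nonneg_left h1 h2, mul_nonneg hε.le (mul_nonneg h2 (sub_nonneg.mpr h1))]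

end

theorem T_nilp.{u} (k : ℕ) : ∀ {H : Type u} [Group H] {B : H → ℝ → Prop}, Len B →
    (⊤ : Subgroup H).lowerCentralSeries (k + 1) = ⊥ → ∀ g : H, g ∈ ⁅(⊤ : Subgroup H), (⊤ : Subgroup H)⁆ → T B g := by
  induction k with
  | zero =>
    intro H _ B hB h g hg
    have h1 : g ∈ (⊤ : Subgroup H).lowerCentralSeries (0 + 1) := hg
    rw [h, Subgroup.mem_bot] at h1
    rw [h1]; exact T.one hB
  | succ k ih =>
    intro H _ B hB h g hg
    set N : Subgroup H := (⊤ : Subgroup H).lowerCentralSeries (k + 1) with hN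
    have hNn : N.Normal := by rw [hN]; infer_instance
    have hNc : N ≤ Subgroup.center H := by
      intro z hz
      rw [Subgroup.mem_center_iff]
      intro x
      have h1 : ⁅z, x⁆ ∈ (⊤ : Subgroup H).lowerCentralSeries (k + 1 + 1) :=
        Subgroup.commutator_mem_commutator hz (Subgroup.mem_top x)
      rw [h, Subgroup.mem_bot, commutatorElement_eq_one_iff_mul_comm] at h1
      exact h1.symm
    have hT : ∀ z ∈ N, T B z := by
      intro z hz
      have hz' := hz
      rw [hN, Subgroup.lowerCentralSeries_succ, Subgroup.commutator_def] at hz'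
      have hsub : Subgroup.closure { g | ∃ g₁ ∈ (⊤ : Subgroup H).lowerCentralSeries k, ∃ g₂ ∈ (⊤ : Subgroup H), ⁅g₁, g₂⁆ = g } ≤ N := by
        rw [hN, Subgroup.lowerCentralSeries_succ, Subgroup.commutator_def]
      have hcom : ∀ z ∈ N, ∀ x, z * x = x * z := fun z hz x => (Subgroup.mem_center_iff.mp (hNc hz) x).symm
      induction hz' using Subgroup.closure_induction with
      | mem x hx =>
        obtain ⟨a, ha, b, hb, rfl⟩ := hx
        exact T_comm hB (hcom _ hz)
      | one => exact T.one hB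
      | mul x y hx hy ihx ihy =>
        exact T.mul hB (hcom x (hsub hx) y) (ihx (hsub hx)) (ihy (hsub hy))
      | inv x hx ihx => exact T.inv hB (ihx (hsub hx))
    refine T_of_quot hB N hNc hT (ih (hB.quot N) ?_ _ ?_)
    · have h1 := Subgroup.map_lowerCentralSeries (⊤ : Subgroup H) (QuotientGroup.mk' N) (k + 1)
      rw [Subgroup.map_top_of_surjective _ (QuotientGroup.mk'_surjective N)] at h1
      rw [← h1, ← hN, Subgroup.map_eq_bot_iff, QuotientGroup.ker_mk']
    · have h1 := Subgroup.map_commutator (⊤ : Subgroup H) ⊤ (QuotientGroup.mk' N)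
      rw [Subgroup.map_top_of_surjective _ (QuotientGroup.mk'_surjective N)] at h1
      rw [← h1]
      exact Subgroup.mem_map_of_mem _ hg

theorem T_nilpotent {H : Type*} [Group H] [Group.IsNilpotent H] {B : H → ℝ → Prop} (hB : Len B) (g : H)
    (hg : g ∈ ⁅(⊤ : Subgroup H), (⊤ : Subgroup H)⁆) : T B g := by
  obtain ⟨n, hn⟩ := Subgroup.nilpotent_iff_lowerCentralSeries.mp ‹Group.IsNilpotent H›
  refine T_nilp n hB ?_ g hg
  rw [Subgroup.lowerCentralSeries_succ, hn]
  exact Subgroup.commutator_bot_left _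

end SL

end

section

open Set Filter Topology Metric MeasureTheory
open scoped commutatorElement

namespace TT

/-- pairs (element of K, lift commuting with integer translations) -/
def Lf (K : Subgroup (T2 ≃ₜ T2)) : Subgroup (K × ((ℝ × ℝ) ≃ₜ (ℝ × ℝ))) where
  carrier := {x | IsLift (x.1 : T2 ≃ₜ T2) x.2 ∧ Comm x.2}
  mul_mem' := by
    rintro a b ⟨hF, hFc⟩ ⟨hG, hGc⟩
    have h := TT.IsLift.comp hF hG
    exact ⟨h, hFc.comp hGc⟩
  one_mem' := ⟨⟨continuous_id, fun p => rfl⟩, fun p m n => rfl⟩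
  inv_mem' := by
    rintro a ⟨hF, hFc⟩
    obtain ⟨E, h0, h1, h2⟩ := lift_homeo hF hFc
    have : E = a.2 := Homeomorph.ext fun x => congrFun h0 x
    rw [this] at h1 h2
    exact ⟨h1, h2⟩

lemma disp_fun {F : ℝ × ℝ → ℝ × ℝ} (hF : Continuous F) (hc : Comm F) :
    ∃ g : C(T2, ℝ × ℝ), ∀ p, g (torusProj p) = F p - p := by
  have hq := proj_openQuot.isQuotientMap
  have : ∀ p q, torusProj p = torusProj q → F p - p = F q - q := by
    intro p q h
    obtain ⟨m, n, rfl⟩ := (proj_eq_iff p q).mp h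
    rw [hc]; abel
  refine ⟨⟨Function.surjInv proj_surj |> fun s x => F (s x) - s x, ?_⟩, ?_⟩
  · rw [hq.continuous_iff]
    have h2 : ((fun x => F (Function.surjInv proj_surj x) - Function.surjInv proj_surj x) ∘ torusProj) = fun p => F p - p := by
      funext p
      exact this _ _ (Function.surjInv_eq proj_surj _)
    change Continuous ((fun x => F (Function.surjInv proj_surj x) - Function.surjInv proj_surj x) ∘ torusProj)
    rw [h2]; exact hF.sub continuous_id
  · intro p
    exact this _ _ (Function.surjInv_eq proj_surj _)

def BL (K : Subgroup (T2 ≃ₜ T2)) (x : Lf K) (r : ℝ) : Prop := ∀ p, ‖x.1.2 p - p‖ ≤ r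

lemma BL_len (K : Subgroup (T2 ≃ₜ T2)) : SL.Len (BL K) where
  one := by intro p; change ‖p - p‖ ≤ 0; simp
  mul := by
    intro g h r s hg hh p
    change ‖g.1.2 (h.1.2 p) - p‖ ≤ r + s
    have h1 := hg (h.1.2 p)
    have h2 := hh p
    calc ‖g.1.2 (h.1.2 p) - p‖ = ‖(g.1.2 (h.1.2 p) - h.1.2 p) + (h.1.2 p - p)‖ := by congr 1; abel
      _ ≤ _ := (norm_add_le _ _).trans (add_le_add h1 h2)
  inv := by
    intro g r hg p
    change ‖g.1.2.symm p - p‖ ≤ r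
    have h1 := hg (g.1.2.symm p)
    rw [Homeomorph.apply_symm_apply, norm_sub_rev] at h1
    exact h1
  ex := by
    intro g
    obtain ⟨C, hC⟩ := disp_bdd g.2.1.1 g.2.2
    exact ⟨C, (norm_nonneg _).trans (hC 0), hC⟩
  mono := by
    intro g r s hrs hg p
    exact (hg p).trans hrs

lemma Lf_nilp (K : Subgroup (T2 ≃ₜ T2)) [Group.IsNilpotent K] : Group.IsNilpotent (Lf K) := by
  refine Subgroup.isNilpotent_of_ker_le_center ((MonoidHom.fst K _).comp (Lf K).subtype) ?_
  intro x hx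
  rw [Subgroup.mem_center_iff]
  intro y
  have hx1 : x.1.1 = 1 := hx
  obtain ⟨m, n, h⟩ := const_int (A := ℝ × ℝ) (f := x.1.2) (g := id) x.2.1.1 continuous_id (fun p => by
    rw [x.2.1.2, hx1]; rfl)
  apply Subtype.ext
  apply Prod.ext
  · change y.1.1 * x.1.1 = x.1.1 * y.1.1
    rw [hx1, mul_one, one_mul]
  · apply Homeomorph.ext
    intro p
    change y.1.2 (x.1.2 p) = x.1.2 (y.1.2 p)
    rw [h, h]
    exact y.2.2 p m n

lemma rot_zero {φ : T2 ≃ₜ T2} {E : (ℝ × ℝ) ≃ₜ (ℝ × ℝ)} (hE : IsLift φ E) (hc : Comm E)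
    (hT : ∀ ε > 0, ∃ n : ℕ, 1 ≤ n ∧ ∀ p, ‖E^[n] p - p‖ ≤ ε * n)
    (μ : Measure T2) [IsProbabilityMeasure μ] (hμ : MeasurePreserving φ μ μ) : HasRotVec E μ (0, 0) := by
  obtain ⟨g, hg⟩ := disp_fun hE.1 hc
  refine ⟨g, hg, ?_⟩
  have hit : ∀ (n : ℕ) p, torusProj (E^[n] p) = φ^[n] (torusProj p) := by
    intro n p
    induction n with
    | zero => rfl
    | succ n ih => rw [Function.iterate_succ_apply', Function.iterate_succ_apply', hE.2, ih]
  have hsum : ∀ (n : ℕ) p, ∑ i ∈ Finset.range n, g (φ^[i] (torusProj p)) = E^[n] p - p := by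
    intro n p
    induction n with
    | zero => simp
    | succ n ih =>
      rw [Finset.sum_range_succ, ih, ← hit, hg, Function.iterate_succ_apply']; abel
  have hcont : ∀ i : ℕ, Continuous (fun x => g (φ^[i] x)) := fun i => g.continuous.comp (φ.continuous.iterate i)
  have hintg : ∀ i : ℕ, Integrable (fun x => g (φ^[i] x)) μ := fun i =>
    (hcont i).integrable_of_hasCompactSupport (HasCompactSupport.of_compactSpace _)
  have hinv : ∀ i : ℕ, ∫ x, g (φ^[i] x) ∂μ = ∫ x, g x ∂μ := by
    intro i
    have h1 := hμ.iterate i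
    have h2 := integral_map (μ := μ) (φ := φ^[i]) h1.measurable.aemeasurable (f := g) (by
      rw [h1.map_eq]; exact g.continuous.aestronglyMeasurable)
    rw [h1.map_eq] at h2
    exact h2.symm
  have key : ∀ ε > 0, ‖∫ x, g x ∂μ‖ ≤ ε := by
    intro ε hε
    obtain ⟨n, hn, h⟩ := hT ε hε
    have h1 : ∫ x, ∑ i ∈ Finset.range n, g (φ^[i] x) ∂μ = n • ∫ x, g x ∂μ := by
      rw [integral_finsetSum _ fun i _ => hintg i]
      simp [hinv]
    have h2 : ‖∫ x, ∑ i ∈ Finset.range n, g (φ^[i] x) ∂μ‖ ≤ ε * n * μ.real univ := by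
      apply norm_integral_le_of_norm_le_const
      refine Eventually.of_forall fun x => ?_
      obtain ⟨p, rfl⟩ := proj_surj x
      rw [hsum]; exact h p
    have hn' : (0 : ℝ) < n := by exact_mod_cast hn
    rw [h1, ← Nat.cast_smul_eq_nsmul ℝ, norm_smul] at h2
    simp at h2
    rw [mul_comm] at h2
    exact le_of_mul_le_mul_right h2 hn'
  have : ‖∫ x, g x ∂μ‖ ≤ 0 := le_of_forall_pos_le_add fun ε hε => by simpa using key ε hε
  exact norm_le_zero_iff.mp this

theorem core (K : Subgroup (T2 ≃ₜ T2)) (hn : Group.IsNilpotent K) (hK : ∀ f ∈ K, Triv f) :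
    ∀ ψ ∈ ⁅K, K⁆, IsIrrotational ψ := by
  intro ψ hψ
  constructor
  · rw [← mem_Iso]
    exact Subgroup.commutator_le.mpr (fun a ha b hb => comm_mem_Iso (hK a ha) (hK b hb)) hψ
  have := Lf_nilp K
  have hmap : ⁅K, K⁆ ≤ Subgroup.map (K.subtype.comp ((MonoidHom.fst K _).comp (Lf K).subtype)) ⁅(⊤ : Subgroup (Lf K)), (⊤ : Subgroup (Lf K))⁆ := by
    have hle : K ≤ Subgroup.map (K.subtype.comp ((MonoidHom.fst K _).comp (Lf K).subtype)) ⊤ := by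
      intro f hf
      obtain ⟨F, hF, hc⟩ := hK f hf
      obtain ⟨E, rfl, -, -⟩ := lift_homeo hF hc
      exact ⟨⟨(⟨f, hf⟩, E), hF, hc⟩, Subgroup.mem_top _, rfl⟩
    exact Subgroup.commutator_le_map_commutator hle hle
  obtain ⟨x, hx, rfl⟩ := hmap hψ
  have hT := SL.T_nilpotent (BL_len K) x hx
  refine ⟨x.1.2, x.2.1, fun μ h1 h2 => rot_zero x.2.1 x.2.2 ?_ μ h2⟩
  intro ε hε
  obtain ⟨n, hn, h⟩ := hT ε hε
  refine ⟨n, hn, fun p => ?_⟩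
  have hpow : ∀ (n : ℕ) p, (x ^ n).1.2 p = x.1.2^[n] p := by
    intro n p
    induction n with
    | zero => rfl
    | succ n ih => rw [pow_succ', Function.iterate_succ_apply', ← ih]; rfl
  rw [← hpow]; exact h p

end TT

end

section

open Set Filter Topology Metric MeasureTheory
open scoped commutatorElement

namespace TT

lemma sl2_anti (p q r s p' q' r' s' : ℤ) (h1 : p * s - q * r = 1) (h2 : p' * s' - q' * r' = 1)
    (e1 : p * p' + q * r' = -(p' * p + q' * r)) (e2 : p * q' + q * s' = -(p' * q + q' * s))
    (e3 : r * p' + s * r' = -(r' * p + s' * r)) (e4 : r * q' + s * s' = -(r' * q + s' * s)) : False := by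
  have hps : p * p' = s * s' := by linarith
  have e5 : (p + s) * p * p' = q * r * (p' + s') := by
    have : 2 * ((p + s) * p * p') = 2 * (q * r * (p' + s')) := by
      linear_combination (p + s) * e1 - q * e3 - r * e2
    linarith
  have e6 : (p' + s') * p * p' = q' * r' * (p + s) := by
    have : 2 * ((p' + s') * p * p') = 2 * (q' * r' * (p + s)) := by
      linear_combination (p' + s') * e1 - q' * e3 - r' * e2
    linarith
  have t' : p' + s' = 0 := by
    linear_combination e5 - p * hps - (p' + s') * h1
  have t : p + s = 0 := by
    linear_combination e6 - p' * hps - (p + s) * h2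
  obtain rfl : s = -p := by linarith
  obtain rfl : s' = -p' := by linarith
  have a1 : q * r = -(1 + p ^ 2) := by linarith
  have a2 : q' * r' = -(1 + p' ^ 2) := by linarith
  have a3 : q * r' + q' * r = -2 * (p * p') := by linarith
  have a4 : (q * r' - q' * r) ^ 2 = 4 * (p * p') ^ 2 - 4 * ((1 + p ^ 2) * (1 + p' ^ 2)) := by
    have : (q * r' - q' * r) ^ 2 = (q * r' + q' * r) ^ 2 - 4 * ((q * r) * (q' * r')) := by ring
    rw [this, a1, a2, a3]; ring
  nlinarith [sq_nonneg (q * r' - q' * r), sq_nonneg p, sq_nonneg p']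

lemma par {x y z q r d q' r' d' : ℤ} (h : ¬ (x = 0 ∧ y = 0 ∧ z = 0))
    (a1 : y * r = z * q) (a2 : q * x = y * d) (a3 : z * d = r * x)
    (b1 : y * r' = z * q') (b2 : q' * x = y * d') (b3 : z * d' = r' * x) :
    q * r' = q' * r ∧ q * d' = q' * d ∧ r * d' = r' * d := by
  by_cases hx : x = 0
  · by_cases hy : y = 0
    · have hz : z ≠ 0 := fun hz => h ⟨hx, hy, hz⟩
      subst hx hy
      refine ⟨mul_left_cancel₀ hz ?_, mul_left_cancel₀ hz ?_, mul_left_cancel₀ hz ?_⟩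
      · linear_combination r * b1 - r' * a1
      · linear_combination q * b3 - q' * a3
      · linear_combination r * b3 - r' * a3
    · refine ⟨mul_left_cancel₀ hy ?_, mul_left_cancel₀ hy ?_, mul_left_cancel₀ hy ?_⟩
      · linear_combination q * b1 - q' * a1
      · linear_combination q' * a2 - q * b2
      · linear_combination d' * a1 - d * b1 + q * b3 - q' * a3 + (q * r' - q' * r) * hx
  · have hd : q * d' = q' * d := mul_left_cancel₀ hx (by linear_combination d' * a2 - d * b2)
    refine ⟨mul_left_cancel₀ hx ?_, hd, mul_left_cancel₀ hx ?_⟩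
    · linear_combination q' * a3 - q * b3 + z * hd
    · linear_combination d * b3 - d' * a3

lemma sl2_comm {a b : Matrix.SpecialLinearGroup (Fin 2) ℤ} (ha : ⁅a, b⁆ * a = a * ⁅a, b⁆)
    (hb : ⁅a, b⁆ * b = b * ⁅a, b⁆) : ⁅a, b⁆ = 1 := by
  have hab : a * b = ⁅a, b⁆ * (b * a) := by rw [commutatorElement_def]; group
  obtain ⟨c, hc⟩ : ∃ c, c = ⁅a, b⁆ := ⟨_, rfl⟩
  rw [← hc] at ha hb hab
  have A := a.det_coe
  have Bd := b.det_coe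
  have C := c.det_coe
  rw [Matrix.det_fin_two] at A Bd C
  have ext' : ∀ u v : Matrix.SpecialLinearGroup (Fin 2) ℤ, u = v ↔ u 0 0 = v 0 0 ∧ u 0 1 = v 0 1 ∧ u 1 0 = v 1 0 ∧ u 1 1 = v 1 1 := by
    intro u v
    constructor
    · rintro rfl; exact ⟨rfl, rfl, rfl, rfl⟩
    · rintro ⟨h1, h2, h3, h4⟩
      ext i j; fin_cases i <;> fin_cases j <;> assumption
  rw [ext'] at ha hb hab
  simp only [Matrix.SpecialLinearGroup.coe_mul, Matrix.mul_apply, Fin.sum_univ_two] at ha hb hab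
  obtain ⟨ha1, ha2, ha3, ha4⟩ := ha
  obtain ⟨hb1, hb2, hb3, hb4⟩ := hb
  by_cases hs : c 0 0 - c 1 1 = 0 ∧ c 0 1 = 0 ∧ c 1 0 = 0
  · obtain ⟨h1, h2, h3⟩ := hs
    have h4 : c 1 1 = c 0 0 := by linarith
    rw [h2, h3, h4] at C hab
    have h5 : c 0 0 = 1 ∨ c 0 0 = -1 := by
      apply mul_self_eq_one_iff.mp; linarith
    rcases h5 with h5 | h5
    · rw [← hc, ext', h2, h3, h4, h5]; simp
    · exfalso
      obtain ⟨e1, e2, e3, e4⟩ := hab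
      rw [h5] at e1 e2 e3 e4
      exact sl2_anti _ _ _ _ _ _ _ _ A Bd (by linarith) (by linarith) (by linarith) (by linarith)
  · obtain ⟨p1, p2, p3⟩ := par hs (q := a 0 1) (r := a 1 0) (d := a 0 0 - a 1 1)
      (q' := b 0 1) (r' := b 1 0) (d' := b 0 0 - b 1 1)
      (by linarith) (by linarith) (by linarith) (by linarith) (by linarith) (by linarith)
    rw [commutatorElement_eq_one_iff_mul_comm, ext']
    simp only [Matrix.SpecialLinearGroup.coe_mul, Matrix.mul_apply, Fin.sum_univ_two]
    refine ⟨?_, ?_, ?_, ?_⟩ <;> linarith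

lemma nilp_comm {S : Type*} [Group S] [Group.IsNilpotent S]
    (h : ∀ a b : S, (∀ x, ⁅a, b⁆ * x = x * ⁅a, b⁆) → ⁅a, b⁆ = 1) (a b : S) : ⁅a, b⁆ = 1 := by
  have step : ∀ k, (⊤ : Subgroup S).lowerCentralSeries (k + 2) = ⊥ → (⊤ : Subgroup S).lowerCentralSeries (k + 1) = ⊥ := by
    intro k hk
    rw [Subgroup.lowerCentralSeries_succ, eq_bot_iff, Subgroup.commutator_le]
    intro g hg x hx
    rw [Subgroup.mem_bot]
    apply h
    intro y
    have h1 : ⁅⁅g, x⁆, y⁆ ∈ (⊤ : Subgroup S).lowerCentralSeries (k + 1 + 1) :=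
      Subgroup.commutator_mem_commutator (Subgroup.commutator_mem_commutator hg hx) (Subgroup.mem_top y)
    rw [hk, Subgroup.mem_bot, commutatorElement_eq_one_iff_mul_comm] at h1
    exact h1
  have all : ∀ k, (⊤ : Subgroup S).lowerCentralSeries (k + 1) = ⊥ → (⊤ : Subgroup S).lowerCentralSeries 1 = ⊥ := by
    intro k
    induction k with
    | zero => exact id
    | succ k ih => exact fun h => ih (step k h)
  obtain ⟨n, hn⟩ := Subgroup.nilpotent_iff_lowerCentralSeries.mp ‹Group.IsNilpotent S›
  have h1 := all n (by rw [Subgroup.lowerCentralSeries_succ, hn]; exact Subgroup.commutator_bot_left _)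
  have h2 : ⁅a, b⁆ ∈ (⊤ : Subgroup S).lowerCentralSeries (0 + 1) :=
    Subgroup.commutator_mem_commutator (Subgroup.mem_top a) (Subgroup.mem_top b)
  rwa [h1, Subgroup.mem_bot] at h2

lemma nilp_SL {K : Type*} [Group K] [Group.IsNilpotent K] (r : K →* Matrix.SpecialLinearGroup (Fin 2) ℤ) (a b : K) :
    r ⁅a, b⁆ = 1 := by
  have : Group.IsNilpotent r.range := Group.nilpotent_of_surjective r.rangeRestrict r.rangeRestrict_surjective
  have h := nilp_comm (S := r.range) (fun a b h => by
    apply Subtype.ext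
    exact sl2_comm (congrArg Subtype.val (h a)) (congrArg Subtype.val (h b))) (r.rangeRestrict a) (r.rangeRestrict b)
  rw [map_commutatorElement]
  exact congrArg Subtype.val h

/-- action on the fundamental group -/
def M (f : T2 → T2) (A : Matrix (Fin 2) (Fin 2) ℤ) : Prop :=
  ∃ F, IsLift f F ∧ ∀ p m n, F (p + iv m n) = F p + iv (A 0 0 * m + A 0 1 * n) (A 1 0 * m + A 1 1 * n)

lemma M_exists (f : T2 ≃ₜ T2) : ∃ A, M f A := by
  obtain ⟨F, hF⟩ := exists_isLift f.continuous
  have hc : ∀ m n, ∃ m' n', ∀ p, F (p + iv m n) = F p + iv m' n' := by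
    intro m n
    obtain ⟨m', n', h⟩ := const_int (A := ℝ × ℝ) (f := fun p => F (p + iv m n)) (g := F)
      (hF.1.comp (by fun_prop)) hF.1 (fun p => by rw [hF.2, hF.2, proj_add_iv])
    exact ⟨m', n', h⟩
  obtain ⟨a, c, h1⟩ := hc 1 0
  obtain ⟨b, d, h2⟩ := hc 0 1
  refine ⟨!![a, b; c, d], F, hF, ?_⟩
  have g1 : ∀ (m : ℤ) p, F (p + iv m 0) = F p + iv (a * m) (c * m) := by
    intro m
    induction m using Int.induction_on with
    | zero => intro p; simp
    | succ i ih =>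
      intro p
      rw [show iv ((i : ℤ) + 1) 0 = iv i 0 + iv 1 0 by rw [iv_add]; simp, ← add_assoc, h1, ih, add_assoc, iv_add]
      congr 2 <;> ring
    | pred i ih =>
      intro p
      have := h1 (p + iv (-(i : ℤ) - 1) 0)
      rw [add_assoc, iv_add, sub_add_cancel, add_zero, ih] at this
      rw [← sub_eq_iff_eq_add] at this
      rw [← this, sub_eq_add_neg, iv_neg, add_assoc, iv_add]
      congr 2 <;> ring
  have g2 : ∀ (m : ℤ) p, F (p + iv 0 m) = F p + iv (b * m) (d * m) := by
    intro m
    induction m using Int.induction_on with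
    | zero => intro p; simp
    | succ i ih =>
      intro p
      rw [show iv 0 ((i : ℤ) + 1) = iv 0 i + iv 0 1 by rw [iv_add]; simp, ← add_assoc, h2, ih, add_assoc, iv_add]
      congr 2 <;> ring
    | pred i ih =>
      intro p
      have := h2 (p + iv 0 (-(i : ℤ) - 1))
      rw [add_assoc, iv_add, sub_add_cancel, add_zero, ih] at this
      rw [← sub_eq_iff_eq_add] at this
      rw [← this, sub_eq_add_neg, iv_neg, add_assoc, iv_add]
      congr 2 <;> ring
  intro p m n
  rw [show iv m n = iv m 0 + iv 0 n by rw [iv_add]; simp, ← add_assoc, g2, g1, add_assoc, iv_add]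
  simp

lemma M_unique {f : T2 → T2} {A A' : Matrix (Fin 2) (Fin 2) ℤ} (h : M f A) (h' : M f A') : A = A' := by
  obtain ⟨F, hF, h⟩ := h
  obtain ⟨F', hF', h'⟩ := h'
  obtain ⟨m0, n0, he⟩ := const_int (A := ℝ × ℝ) (f := F) (g := F') hF.1 hF'.1 (fun p => by rw [hF.2, hF'.2])
  have key : ∀ m n : ℤ, iv (A 0 0 * m + A 0 1 * n) (A 1 0 * m + A 1 1 * n) = iv (A' 0 0 * m + A' 0 1 * n) (A' 1 0 * m + A' 1 1 * n) := by
    intro m n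
    have h1 := h 0 m n
    rw [he, he, h', add_assoc, add_assoc] at h1
    have h2 := add_left_cancel h1
    rw [add_comm] at h2
    exact (add_left_cancel h2).symm
  have k1 := iv_inj (key 1 0)
  have k2 := iv_inj (key 0 1)
  simp at k1 k2
  ext i j; fin_cases i <;> fin_cases j <;> simp [k1, k2]

lemma M_mul {f g : T2 ≃ₜ T2} {A A' : Matrix (Fin 2) (Fin 2) ℤ} (h : M f A) (h' : M g A') : M (f * g : T2 ≃ₜ T2) (A * A') := by
  obtain ⟨F, hF, h⟩ := h
  obtain ⟨G, hG, h'⟩ := h'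
  have hl := TT.IsLift.comp hF hG
  refine ⟨F ∘ G, hl, fun p m n => ?_⟩
  simp only [Function.comp]
  rw [h', h]
  congr 2 <;> simp [Matrix.mul_apply, Fin.sum_univ_two] <;> ring

lemma M_one : M (1 : T2 ≃ₜ T2) 1 := ⟨id, ⟨continuous_id, fun p => rfl⟩, fun p m n => by simp⟩

/-- the representation on the fundamental group -/
noncomputable def rho : (T2 ≃ₜ T2) →* Matrix (Fin 2) (Fin 2) ℤ where
  toFun f := (M_exists f).choose
  map_one' := M_unique (M_exists 1).choose_spec M_one
  map_mul' f g := M_unique (M_exists (f * g)).choose_spec (M_mul (M_exists f).choose_spec (M_exists g).choose_spec)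

lemma rho_spec (f : T2 ≃ₜ T2) : M f (rho f) := (M_exists f).choose_spec

lemma triv_of_rho {f : T2 ≃ₜ T2} (h : rho f = 1) : Triv f := by
  obtain ⟨F, hF, h'⟩ := rho_spec f
  refine ⟨F, hF, fun p m n => ?_⟩
  rw [h', h]; simp

lemma det_of_op {f : T2 ≃ₜ T2} (h : OrientationPreserving f) : (rho f).det = 1 := by
  obtain ⟨A, ⟨F, hF, h1⟩, h2⟩ := h
  have : M f A := ⟨F, hF, fun p m n => h1 p m n⟩
  rw [M_unique (rho_spec f) this, h2]

lemma comm_triv (K : Subgroup (T2 ≃ₜ T2)) (hn : Group.IsNilpotent K) (hK : ∀ f ∈ K, (rho f).det = 1) :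
    ∀ f ∈ ⁅K, K⁆, Triv f := by
  let r : K →* Matrix.SpecialLinearGroup (Fin 2) ℤ :=
    { toFun := fun k => ⟨rho k, hK k k.2⟩
      map_one' := Subtype.ext (map_one rho)
      map_mul' := fun a b => Subtype.ext (map_mul rho _ _) }
  have : ⁅K, K⁆ ≤ TrivG := by
    rw [Subgroup.commutator_le]
    intro a ha b hb
    apply triv_of_rho
    have := nilp_SL r ⟨a, ha⟩ ⟨b, hb⟩
    exact congrArg Subtype.val this
  exact this

lemma det_comm (K : Subgroup (T2 ≃ₜ T2)) : ∀ f ∈ ⁅K, K⁆, (rho f).det = 1 := by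
  let d : (T2 ≃ₜ T2) →* ℤ := Matrix.detMonoidHom.comp rho
  have : ⁅K, K⁆ ≤ d.toHomUnits.ker := by
    rw [Subgroup.commutator_le]
    intro a ha b hb
    rw [MonoidHom.mem_ker, map_commutatorElement, commutatorElement_eq_one_iff_mul_comm, mul_comm]
  intro f hf
  have h := congrArg Units.val (MonoidHom.mem_ker.mp (this hf))
  exact h

end TT

end

section

namespace TT

lemma nilp_mono {A B : Subgroup (T2 ≃ₜ T2)} (h : A ≤ B) (hB : Group.IsNilpotent B) : Group.IsNilpotent A := by
  refine Subgroup.isNilpotent_of_ker_le_center (Subgroup.inclusion h) ?_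
  rw [(MonoidHom.ker_eq_bot_iff _).mpr (Subgroup.inclusion_injective h)]
  exact bot_le

lemma comm_le (A : Subgroup (T2 ≃ₜ T2)) : ⁅A, A⁆ ≤ A :=
  Subgroup.commutator_le.mpr fun a ha b hb =>
    A.mul_mem (A.mul_mem (A.mul_mem ha hb) (A.inv_mem ha)) (A.inv_mem hb)

end TT

end

/-- **Theorem (main3).** Let `G` be a nilpotent subgroup of `Homeo(T²)`. Then:
(i) if `G ⊆ Homeo₀(T²)` every element of `G' = [G,G]` is irrotational;
(ii) if `G ⊆ Homeo₊(T²)` every element of `G'' = [G',G']` is irrotational;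
(iii) every element of `G''' = [G'',G'']` is irrotational. -/
theorem stmt_2
    (G : Subgroup (T2 ≃ₜ T2))
    (hnilp : Group.IsNilpotent G) :
    ((∀ ψ ∈ G, IsotopicToId (⇑ψ)) → ∀ ψ ∈ ⁅G, G⁆, IsIrrotational ψ) ∧
    ((∀ ψ ∈ G, OrientationPreserving (⇑ψ)) →
        ∀ ψ ∈ ⁅(⁅G, G⁆ : Subgroup (T2 ≃ₜ T2)), (⁅G, G⁆ : Subgroup (T2 ≃ₜ T2))⁆,
          IsIrrotational ψ) ∧
    (∀ ψ ∈ ⁅(⁅(⁅G, G⁆ : Subgroup (T2 ≃ₜ T2)), (⁅G, G⁆ : Subgroup (T2 ≃ₜ T2))⁆ :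
          Subgroup (T2 ≃ₜ T2)),
        (⁅(⁅G, G⁆ : Subgroup (T2 ≃ₜ T2)), (⁅G, G⁆ : Subgroup (T2 ≃ₜ T2))⁆ :
          Subgroup (T2 ≃ₜ T2))⁆, IsIrrotational ψ) := by
  have h1 : Group.IsNilpotent (⁅G, G⁆ : Subgroup (T2 ≃ₜ T2)) := TT.nilp_mono (TT.comm_le G) hnilp
  have h2 : Group.IsNilpotent (⁅(⁅G, G⁆ : Subgroup (T2 ≃ₜ T2)), (⁅G, G⁆ : Subgroup (T2 ≃ₜ T2))⁆ :
      Subgroup (T2 ≃ₜ T2)) := TT.nilp_mono (TT.comm_le _) h1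
  refine ⟨fun h => ?_, fun h => ?_, ?_⟩
  · exact TT.core G hnilp fun f hf => TT.Iso_le (TT.mem_Iso.mpr (h f hf))
  · exact TT.core _ h1 (TT.comm_triv G hnilp fun f hf => TT.det_of_op (h f hf))
  · exact TT.core _ h2 (TT.comm_triv _ h1 (TT.det_comm G))
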